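/- arXiv:2004.07396 — 6 statements merged into one kernel-verified Lean document; each statement's English description precedes it below -/
import Mathlib

section
/- Contraction of the iteration: under the setup of the iteration (same hypotheses and definitions of the sequences (w_n) and (h_n) as in the uniform-bounds lemma, with U>0 chosen sufficiently small), if ‖h₀'‖_{L^{∞,2-δ}_r} is sufficiently small then the sequence (h_n) contracts in L^∞_U L^∞_r: there exists a constant 0 ≤ κ < 1 such that ‖h_{n+1}-h_n‖_{L^∞_U L^∞_r} ≤ κ ‖h_n - h_{n-1}‖_{L^∞_U L^∞_r} for all n ≥ 2. -/
open Set MeasureTheory Real Filter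

/-- Radial average: `w̄(r) = (1/r)∫₀ʳ w(s) ds` for `r ≠ 0`, with `w̄(0) = w(0)`. -/
noncomputable def radAvg (w : ℝ → ℝ) (r : ℝ) : ℝ :=
  if r = 0 then w 0 else (∫ s in (0:ℝ)..r, w s) / r

/-- Metric coefficient `f[h](u,r) = exp((1/2)∫₀ʳ (h(u,s)-h̄(u,s))²/s ds)`. -/
noncomputable def metF (h : ℝ → ℝ → ℝ) (u r : ℝ) : ℝ :=
  Real.exp (2⁻¹ * ∫ s in (0:ℝ)..r, (h u s - radAvg (h u) s) ^ 2 / s)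

/-- Metric coefficient `f̃[h](u,r) = (1/r)∫₀ʳ (1-3s²) f[h](u,s) ds` (with value `1` at `r=0`). -/
noncomputable def metFt (h : ℝ → ℝ → ℝ) (u r : ℝ) : ℝ :=
  if r = 0 then 1 else (∫ s in (0:ℝ)..r, (1 - 3 * s ^ 2) * metF h u s) / r

/-- Coefficient `G[h](u,r) = (1/(2r))[(f-f̃)(u,r) - 3 f(u,r) r²]` (with value `0` at `r=0`). -/
noncomputable def coefG (h : ℝ → ℝ → ℝ) (u r : ℝ) : ℝ :=
  if r = 0 then 0 else ((metF h u r - metFt h u r) - 3 * metF h u r * r ^ 2) / (2 * r)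

/-- Coefficient `J[h] = 3G[h] + 3 r f[h] - ((1-3r²)/2) ∂_r f[h]`. -/
noncomputable def coefJ (h : ℝ → ℝ → ℝ) (u r : ℝ) : ℝ :=
  3 * coefG h u r + 3 * r * metF h u r - ((1 - 3 * r ^ 2) / 2) * deriv (fun s => metF h u s) r
/-- The weighted norm `‖w‖_{L^{∞,p}_r} = sup_{r ≥ 0} (1+r)^p |w(r)|`. -/
noncomputable def wnorm (p : ℝ) (w : ℝ → ℝ) : ℝ :=
  ⨆ r : Ici (0:ℝ), (1 + r.1) ^ p * |w r.1|

/-- The setup of the iteration scheme: `h₀ ∈ C²([0,∞))` bounded with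
`‖h₀'‖_{L^{∞,2-δ}_r} < ∞` and `‖h₀''‖_{L^{∞,3-δ}_r} < ∞`; `h_U ∈ C¹` solves
`Dh_U = G[h_U](h_U - h̄_U)` on `[0,U]²` with `h_U(0,·) = h₀`; `w₁(u,r) = h₀'(r)`,
`h_n(u,r) = h_U(u,0) + ∫₀ʳ w_n(u,s) ds`, and `w_{n+1}` is a `C¹` solution of the
linear transport problem `D_n w_{n+1} = 2 G_n w_{n+1} - J_n (h_n - h̄_n)/r`,
`w_{n+1}(0,·) = h₀'`. -/
def IterSetup (δ U : ℝ) (h₀ : ℝ → ℝ) (hU : ℝ → ℝ → ℝ)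
    (w h : ℕ → ℝ → ℝ → ℝ) : Prop :=
  ContDiff ℝ 2 h₀ ∧
  (∃ M : ℝ, ∀ r : ℝ, 0 ≤ r → |h₀ r| ≤ M) ∧
  BddAbove (range fun r : Ici (0:ℝ) => (1 + r.1) ^ (2 - δ) * |deriv h₀ r.1|) ∧
  BddAbove (range fun r : Ici (0:ℝ) => (1 + r.1) ^ (3 - δ) * |deriv (deriv h₀) r.1|) ∧
  ContDiff ℝ 1 (Function.uncurry hU) ∧
  (∀ u ∈ Icc (0:ℝ) U, ∀ r ∈ Icc (0:ℝ) U,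
    deriv (fun u' => hU u' r) u - 2⁻¹ * metFt hU u r * deriv (hU u) r =
      coefG hU u r * (hU u r - radAvg (hU u) r)) ∧
  (∀ r ∈ Icc (0:ℝ) U, hU 0 r = h₀ r) ∧
  (∀ u r : ℝ, w 1 u r = deriv h₀ r) ∧
  (∀ n : ℕ, 1 ≤ n → ContDiff ℝ 1 (Function.uncurry (w n))) ∧
  (∀ n : ℕ, 1 ≤ n → ∀ u r : ℝ, h n u r = hU u 0 + ∫ s in (0:ℝ)..r, w n u s) ∧
  (∀ n : ℕ, 1 ≤ n → ∀ r : ℝ, 0 ≤ r → w (n + 1) 0 r = deriv h₀ r) ∧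
  (∀ n : ℕ, 1 ≤ n → ∀ u ∈ Icc (0:ℝ) U, ∀ r : ℝ, 0 < r →
    deriv (fun u' => w (n + 1) u' r) u - 2⁻¹ * metFt (h n) u r * deriv (w (n + 1) u) r =
      2 * coefG (h n) u r * w (n + 1) u r -
        coefJ (h n) u r * (h n u r - radAvg (h n u) r) / r)


section Tools

lemma intervalIntegrable_zero_of_bounded {φ : ℝ → ℝ} (hc : ContinuousOn φ (Ioi 0)) {C r : ℝ}
    (hr : 0 ≤ r) (hb : ∀ s, 0 < s → s ≤ r → |φ s| ≤ C) :
    IntervalIntegrable φ volume 0 r := by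
  rw [intervalIntegrable_iff_integrableOn_Ioc_of_le hr]
  refine IntegrableOn.of_bound (by simp) ?_ C ?_
  · exact (hc.mono fun s hs => hs.1).aestronglyMeasurable measurableSet_Ioc
  · exact (ae_restrict_iff' measurableSet_Ioc).2 (Eventually.of_forall fun s hs => hb s hs.1 hs.2)

lemma abs_integral_le_primitive {φ g P : ℝ → ℝ} {r : ℝ} (hr : 0 ≤ r)
    (hb : ∀ s, 0 < s → s ≤ r → |φ s| ≤ g s)
    (hP : ∀ s, 0 ≤ s → HasDerivAt P (g s) s) (hg : ContinuousOn g (Ici 0)) :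
    |∫ s in (0:ℝ)..r, φ s| ≤ P r - P 0 := by
  have hgi : IntervalIntegrable g volume 0 r :=
    (hg.mono fun s hs => by rw [uIcc_of_le hr] at hs; exact hs.1).intervalIntegrable
  have h := intervalIntegral.norm_integral_le_of_norm_le hr
    (Eventually.of_forall fun s hs => hb s hs.1 hs.2 : ∀ᵐ s, s ∈ Ioc 0 r → ‖φ s‖ ≤ g s) hgi
  rwa [intervalIntegral.integral_eq_sub_of_hasDerivAt
    (fun s hs => by rw [uIcc_of_le hr] at hs; exact hP s hs.1) hgi] at h

lemma hasDerivAt_primitive_of_pos {φ : ℝ → ℝ} (hc : ContinuousOn φ (Ioi 0)) {r : ℝ} (hr : 0 < r)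
    (hi : IntervalIntegrable φ volume 0 r) :
    HasDerivAt (fun t => ∫ s in (0:ℝ)..t, φ s) (φ r) r :=
  intervalIntegral.integral_hasDerivAt_right hi
    (hc.stronglyMeasurableAtFilter isOpen_Ioi r hr) (hc.continuousAt (Ioi_mem_nhds hr))

lemma continuousOn_Ici_of_pos_of_lipschitz_zero {φ : ℝ → ℝ} (hc : ContinuousOn φ (Ioi 0)) {C : ℝ}
    (h0 : ∀ s, 0 < s → s ≤ 1 → |φ s - φ 0| ≤ C * s) : ContinuousOn φ (Ici 0) := by
  intro s hs
  rcases eq_or_lt_of_le (show (0:ℝ) ≤ s from hs) with rfl | hs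
  · rw [ContinuousWithinAt, tendsto_iff_norm_sub_tendsto_zero]
    have hlim : Tendsto (fun s : ℝ => C * s) (nhdsWithin 0 (Ici 0)) (nhds 0) := by
      have : Tendsto (fun s : ℝ => C * s) (nhds 0) (nhds (C * 0)) :=
        (continuous_const.mul continuous_id).tendsto 0
      rw [mul_zero] at this
      exact this.mono_left nhdsWithin_le_nhds
    refine squeeze_zero' (Eventually.of_forall fun _ => norm_nonneg _) ?_ hlim
    filter_upwards [self_mem_nhdsWithin, mem_nhdsWithin_of_mem_nhds (Iio_mem_nhds one_pos)]
      with s hs hs1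
    rcases eq_or_lt_of_le (show (0:ℝ) ≤ s from hs) with rfl | hs
    · simp
    · exact h0 s hs (le_of_lt hs1)
  · exact (hc.continuousAt (Ioi_mem_nhds hs)).continuousWithinAt

lemma one_le_sqrt_one_add {s : ℝ} (hs : 0 ≤ s) : 1 ≤ √(1 + s) := by
  rw [Real.one_le_sqrt]; linarith

lemma hasDerivAt_sqrt_one_add {s : ℝ} (hs : 0 ≤ s) :
    HasDerivAt (fun t => √(1 + t)) (1 / (2 * √(1 + s))) s := by
  have h1 : HasDerivAt (fun t : ℝ => 1 + t) 1 s := by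
    simpa using (hasDerivAt_id s).const_add (1:ℝ)
  exact h1.sqrt (by positivity)

lemma hasDerivAt_inv_sqrt_one_add {s : ℝ} (hs : 0 ≤ s) :
    HasDerivAt (fun t => 1 / √(1 + t)) (-(1 / (2 * √(1 + s) ^ 3))) s := by
  have hq := one_le_sqrt_one_add hs
  have h : HasDerivAt (fun t => (√(1 + t))⁻¹) _ s :=
    (hasDerivAt_sqrt_one_add hs).inv (by positivity)
  have h' := h.congr_deriv (g' := -(1 / (2 * √(1 + s) ^ 3))) (by field_simp)
  simpa only [one_div] using h'

lemma hasDerivAt_inv_sqrt_one_add_cube {s : ℝ} (hs : 0 ≤ s) :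
    HasDerivAt (fun t => 1 / √(1 + t) ^ 3) (-(3 / (2 * √(1 + s) ^ 5))) s := by
  have hq := one_le_sqrt_one_add hs
  have h : HasDerivAt (fun t => (√(1 + t) ^ 3)⁻¹) _ s :=
    ((hasDerivAt_sqrt_one_add hs).pow 3).inv (pow_pos (by positivity) 3).ne'
  have h' := h.congr_deriv (g' := -(3 / (2 * √(1 + s) ^ 5)))
    (by simp only [Pi.pow_apply]; push_cast; field_simp)
  simpa only [one_div] using h'

/-- Weak maximum principle on a rectangle with outgoing lateral boundaries. -/
lemma nonpos_of_transport {Z Zu Zr c : ℝ → ℝ → ℝ} {U a R : ℝ}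
    (hU : 0 ≤ U) (haR : a ≤ R)
    (hcont : ContinuousOn (Function.uncurry Z) (Icc 0 U ×ˢ Icc a R))
    (hZu : ∀ u ∈ Icc 0 U, ∀ r ∈ Icc a R, HasDerivAt (fun t => Z t r) (Zu u r) u)
    (hZr : ∀ u ∈ Icc 0 U, ∀ r ∈ Icc a R, HasDerivAt (Z u) (Zr u r) r)
    (hca : ∀ u ∈ Icc 0 U, c u a ≤ 0) (hcR : ∀ u ∈ Icc 0 U, 0 ≤ c u R)
    (hinit : ∀ r ∈ Icc a R, Z 0 r ≤ 0)
    (hneg : ∀ u ∈ Icc 0 U, ∀ r ∈ Icc a R, 0 < Z u r → (∀ s ∈ Icc a R, Z u s ≤ Z u r) →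
      Zu u r + c u r * Zr u r < 0) :
    ∀ u ∈ Icc 0 U, ∀ r ∈ Icc a R, Z u r ≤ 0 := by
  obtain ⟨⟨u, r⟩, ⟨hu, hr⟩, hmax⟩ := (isCompact_Icc.prod isCompact_Icc).exists_isMaxOn
    ⟨(0, a), ⟨⟨le_refl _, hU⟩, ⟨le_refl _, haR⟩⟩⟩ hcont
  have hmax' : ∀ v ∈ Icc 0 U, ∀ s ∈ Icc a R, Z v s ≤ Z u r :=
    fun v hv s hs => isMaxOn_iff.1 hmax (v, s) ⟨hv, hs⟩
  by_contra! hcon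
  obtain ⟨u₁, hu₁, r₁, hr₁, hpos⟩ := hcon
  have hpos : 0 < Z u r := hpos.trans_le (hmax' _ hu₁ _ hr₁)
  have hlt := hneg u hu r hr hpos (fun s hs => hmax' u hu s hs)
  simp only at hu hr
  have hu0 : 0 < u := by
    rcases eq_or_lt_of_le hu.1 with h | h
    · rw [← h] at hpos; exact absurd (hinit r hr) (not_le.2 hpos)
    · exact h
  have left_nonneg : ∀ {y : ℝ → ℝ} {d b t : ℝ}, b < t → HasDerivAt y d t →
      (∀ s ∈ Icc b t, y s ≤ y t) → 0 ≤ d := by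
    intro y d b t hbt hd hle
    have ht : Tendsto (slope y t) (nhdsWithin t (Iio t)) (nhds d) :=
      (hasDerivAt_iff_tendsto_slope.1 hd).mono_left (nhdsWithin_mono _ fun s hs => ne_of_lt hs)
    refine ge_of_tendsto ht ?_
    filter_upwards [Ioo_mem_nhdsLT hbt] with s hs
    rw [slope_def_field]
    exact div_nonneg_of_nonpos (by linarith [hle s ⟨hs.1.le, hs.2.le⟩]) (by linarith [hs.2])
  have right_nonpos : ∀ {y : ℝ → ℝ} {d b t : ℝ}, t < b → HasDerivAt y d t →
      (∀ s ∈ Icc t b, y s ≤ y t) → d ≤ 0 := by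
    intro y d b t hbt hd hle
    have ht : Tendsto (slope y t) (nhdsWithin t (Ioi t)) (nhds d) :=
      (hasDerivAt_iff_tendsto_slope.1 hd).mono_left (nhdsWithin_mono _ fun s hs => ne_of_gt hs)
    refine le_of_tendsto ht ?_
    filter_upwards [Ioo_mem_nhdsGT hbt] with s hs
    rw [slope_def_field]
    exact div_nonpos_of_nonpos_of_nonneg (by linarith [hle s ⟨hs.1.le, hs.2.le⟩])
      (by linarith [hs.1])
  have h1 : 0 ≤ Zu u r := left_nonneg hu0 (hZu u hu r hr)
    (fun s hs => hmax' s ⟨hs.1, hs.2.trans hu.2⟩ r hr)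
  have hl : a < r → 0 ≤ Zr u r := fun h => left_nonneg h (hZr u hu r hr)
    (fun s hs => hmax' u hu s ⟨hs.1, hs.2.trans hr.2⟩)
  have hrt : r < R → Zr u r ≤ 0 := fun h => right_nonpos h (hZr u hu r hr)
    (fun s hs => hmax' u hu s ⟨hr.1.trans hs.1, hs.2⟩)
  have h2 : 0 ≤ c u r * Zr u r := by
    rcases eq_or_lt_of_le hr.1 with h | h
    · subst h
      rcases eq_or_lt_of_le hr.2 with h' | h'
      · subst h'
        rw [le_antisymm (hca u hu) (hcR u hu), zero_mul]
      · exact mul_nonneg_of_nonpos_of_nonpos (hca u hu) (hrt h')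
    · rcases eq_or_lt_of_le hr.2 with h' | h'
      · subst h'
        exact mul_nonneg (hcR u hu) (hl h)
      · rw [le_antisymm (hrt h') (hl h), mul_zero]
  linarith

end Tools

section Profile

/-- Deviation of `h(u,·)` from its radial average. -/
noncomputable def devAvg (h : ℝ → ℝ → ℝ) (u r : ℝ) : ℝ := h u r - radAvg (h u) r

/-- The radial derivative of `metF`. -/
noncomputable def metFd (h : ℝ → ℝ → ℝ) (u r : ℝ) : ℝ :=
  metF h u r * devAvg h u r ^ 2 / (2 * r)

/-- The deviation of `coefG` from its leading part `-r f`. -/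
noncomputable def coefK (h : ℝ → ℝ → ℝ) (u r : ℝ) : ℝ := coefG h u r + r * metF h u r

/-- At fixed `u`, the function `h u` is a primitive of `W`, which is of size `x (1+r)^(-3/2)`. -/
structure Profile (x : ℝ) (h : ℝ → ℝ → ℝ) (u : ℝ) (W : ℝ → ℝ) : Prop where
  pos : 0 < x
  le : x ≤ 1 / 1000
  cont : Continuous W
  rep : ∃ c, ∀ r, h u r = c + ∫ s in (0:ℝ)..r, W s
  bound : ∀ s, 0 < s → |W s| ≤ x / √(1 + s) ^ 3

variable {x u r B : ℝ} {h h₁ h₂ : ℝ → ℝ → ℝ} {W W₁ W₂ : ℝ → ℝ}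

lemma sq_sqrt_one_add (hr : 0 < r) : √(1 + r) ^ 2 = 1 + r := Real.sq_sqrt (by linarith)

namespace Profile

lemma hasDerivAt (P : Profile x h u W) (r : ℝ) : HasDerivAt (h u) (W r) r := by
  obtain ⟨c, hc⟩ := P.rep
  have : h u = fun r => c + ∫ s in (0:ℝ)..r, W s := funext hc
  rw [this]
  exact (P.cont.integral_hasStrictDerivAt 0 r).hasDerivAt.const_add c

lemma continuous_slice (P : Profile x h u W) : Continuous (h u) :=
  continuous_iff_continuousAt.2 fun r => (P.hasDerivAt r).continuousAt

lemma devAvg_eq (P : Profile x h u W) (hr : 0 < r) :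
    devAvg h u r = (∫ s in (0:ℝ)..r, s * W s) / r := by
  have hd : ∀ s ∈ uIcc 0 r, HasDerivAt (fun s => s * h u s) (h u s + s * W s) s := fun s _ => by
    have h1 : HasDerivAt (fun s => s * h u s) _ s := (hasDerivAt_id s).mul (P.hasDerivAt s)
    exact h1.congr_deriv (by simp)
  have i1 : IntervalIntegrable (h u) volume 0 r := P.continuous_slice.intervalIntegrable _ _
  have i2 : IntervalIntegrable (fun s => s * W s) volume 0 r :=
    (continuous_id.mul P.cont).intervalIntegrable _ _
  have h1 := intervalIntegral.integral_eq_sub_of_hasDerivAt hd (i1.add i2)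
  rw [intervalIntegral.integral_add i1 i2] at h1
  rw [devAvg, radAvg, if_neg hr.ne']
  field_simp
  linarith

lemma devAvg_bound (P : Profile x h u W) (hr : 0 < r) :
    |devAvg h u r| ≤ 2 * x * r / √(1 + r) ^ 3 := by
  have hx := P.pos
  have key := abs_integral_le_primitive (φ := fun s => s * W s)
    (g := fun s => x * (1 / √(1 + s) - 1 / √(1 + s) ^ 3))
    (P := fun s => x * (2 * √(1 + s) + 2 * (1 / √(1 + s)))) hr.le ?_ ?_ ?_
  · rw [P.devAvg_eq hr, abs_div, abs_of_pos hr, div_le_iff₀ hr]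
    refine key.trans ?_
    have h1 := one_le_sqrt_one_add hr.le
    have h2 := sq_sqrt_one_add hr
    obtain ⟨q, hq⟩ : ∃ q, q = √(1 + r) := ⟨_, rfl⟩
    rw [← hq] at h1 h2 ⊢
    obtain rfl : r = q ^ 2 - 1 := by linarith
    simp only [add_zero, Real.sqrt_one]
    have : 2 * x * (q ^ 2 - 1) / q ^ 3 * (q ^ 2 - 1) -
        (x * (2 * q + 2 * (1 / q)) - x * (2 * 1 + 2 * (1 / 1))) =
        2 * x * (q - 1) ^ 2 * (2 * q + 1) / q ^ 3 := by
      field_simp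
      ring
    have : 0 ≤ 2 * x * (q - 1) ^ 2 * (2 * q + 1) / q ^ 3 := by positivity
    linarith
  · intro s hs _
    have h1 := one_le_sqrt_one_add hs.le
    have h2 := sq_sqrt_one_add hs
    rw [abs_mul, abs_of_pos hs]
    refine (mul_le_mul_of_nonneg_left (P.bound s hs) hs.le).trans (le_of_eq ?_)
    obtain ⟨q, hq⟩ : ∃ q, q = √(1 + s) := ⟨_, rfl⟩
    rw [← hq] at h1 h2 ⊢
    obtain rfl : s = q ^ 2 - 1 := by linarith
    field_simp
  · intro s hs
    have := (((hasDerivAt_sqrt_one_add hs).const_mul 2).add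
      ((hasDerivAt_inv_sqrt_one_add hs).const_mul 2)).const_mul x
    refine this.congr_deriv ?_
    have h1 := one_le_sqrt_one_add hs
    field_simp
    ring
  · intro s hs
    have h1 := one_le_sqrt_one_add (show (0:ℝ) ≤ s from hs)
    exact ContinuousAt.continuousWithinAt (by fun_prop (disch := positivity))

lemma devAvg_sq_bound (P : Profile x h u W) (hr : 0 < r) :
    devAvg h u r ^ 2 ≤ 4 * x ^ 2 * r ^ 2 / (1 + r) ^ 3 := by
  have hx := P.pos
  have h1 := P.devAvg_bound hr
  have h2 := sq_sqrt_one_add hr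
  have h3 := pow_le_pow_left₀ (abs_nonneg _) h1 2
  rw [sq_abs] at h3
  refine h3.trans (le_of_eq ?_)
  have h4 : (√(1 + r) ^ 3) ^ 2 = (1 + r) ^ 3 := by rw [← pow_mul, mul_comm, pow_mul, h2]
  rw [div_pow, h4]
  ring

lemma continuousOn_devAvg (P : Profile x h u W) : ContinuousOn (devAvg h u) (Ioi 0) := by
  have h1 : ContinuousOn (fun r => (∫ s in (0:ℝ)..r, s * W s) / r) (Ioi 0) := by
    refine ContinuousOn.div (Continuous.continuousOn ?_) continuousOn_id fun r hr => ne_of_gt hr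
    have := P.cont
    exact intervalIntegral.continuous_primitive
      (fun a b => (continuous_id.mul this).intervalIntegrable a b) 0
  exact h1.congr fun r hr => P.devAvg_eq hr

lemma continuousOn_dens (P : Profile x h u W) :
    ContinuousOn (fun s => devAvg h u s ^ 2 / s) (Ioi 0) :=
  (P.continuousOn_devAvg.pow 2).div continuousOn_id fun _ hr => ne_of_gt hr

lemma dens_nonneg (hr : 0 < r) : 0 ≤ devAvg h u r ^ 2 / r := by positivity

lemma dens_bound (P : Profile x h u W) (hr : 0 < r) :
    devAvg h u r ^ 2 / r ≤ 4 * x ^ 2 * r / (1 + r) ^ 3 := by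
  rw [div_le_iff₀ hr]
  refine (P.devAvg_sq_bound hr).trans (le_of_eq ?_)
  field_simp

lemma dens_bound' (P : Profile x h u W) (hr : 0 < r) :
    |devAvg h u r ^ 2 / r| ≤ 4 * x ^ 2 * (1 / (1 + r) ^ 2) := by
  have hx := P.pos
  rw [abs_of_nonneg (dens_nonneg hr)]
  refine (P.dens_bound hr).trans ?_
  have : 4 * x ^ 2 * (1 / (1 + r) ^ 2) - 4 * x ^ 2 * r / (1 + r) ^ 3 =
    4 * x ^ 2 / (1 + r) ^ 3 := by field_simp; ring
  have : 0 ≤ 4 * x ^ 2 / (1 + r) ^ 3 := by positivity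
  linarith

lemma intervalIntegrable_dens (P : Profile x h u W) (hr : 0 ≤ r) :
    IntervalIntegrable (fun s => devAvg h u s ^ 2 / s) volume 0 r := by
  refine intervalIntegrable_zero_of_bounded P.continuousOn_dens (C := 4 * x ^ 2) hr fun s hs _ => ?_
  refine (P.dens_bound' hs).trans ?_
  have : 1 / (1 + s) ^ 2 ≤ 1 := by
    rw [div_le_one (by positivity)]; nlinarith
  nlinarith [sq_nonneg x]

lemma hasDerivAt_inv_one_add {s : ℝ} (hs : 0 ≤ s) :
    HasDerivAt (fun t : ℝ => -(1 / (1 + t))) (1 / (1 + s) ^ 2) s := by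
  have h1 : HasDerivAt (fun t : ℝ => 1 + t) 1 s := by
    simpa using (hasDerivAt_id s).const_add (1:ℝ)
  have h : HasDerivAt (fun t : ℝ => -(1 + t)⁻¹) _ s := (h1.inv (by positivity)).neg
  simpa only [one_div, neg_div, neg_neg] using h

lemma exponent_bound (P : Profile x h u W) (hr : 0 ≤ r) :
    |∫ s in (0:ℝ)..r, devAvg h u s ^ 2 / s| ≤ 4 * x ^ 2 := by
  have hx := P.pos
  refine (abs_integral_le_primitive hr (fun s hs _ => P.dens_bound' hs)
    (fun s hs => (hasDerivAt_inv_one_add hs).const_mul _) ?_).trans ?_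
  · intro s hs
    have : (0:ℝ) ≤ s := hs
    exact ContinuousAt.continuousWithinAt (by fun_prop (disch := positivity))
  · have : 0 ≤ 1 / (1 + r) := by positivity
    nlinarith [sq_nonneg x]

lemma metF_eq (h : ℝ → ℝ → ℝ) (u r : ℝ) :
    metF h u r = Real.exp (2⁻¹ * ∫ s in (0:ℝ)..r, devAvg h u s ^ 2 / s) := rfl

lemma one_le_metF (hr : 0 ≤ r) : 1 ≤ metF h u r := by
  rw [metF_eq, Real.one_le_exp_iff]
  refine mul_nonneg (by norm_num) (intervalIntegral.integral_nonneg hr fun s hs => ?_)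
  have := hs.1
  positivity

lemma metF_le_two (P : Profile x h u W) (hr : 0 ≤ r) : metF h u r ≤ 2 := by
  have hx := P.pos
  have hx' := P.le
  have h1 := (abs_le.1 (P.exponent_bound hr)).2
  have h2 : Real.exp (1 / 2) ≤ 2 := by
    have := Real.exp_bound_div_one_sub_of_interval (x := 1 / 2) (by norm_num) (by norm_num)
    norm_num at this ⊢
    exact this
  refine le_trans ?_ h2
  rw [metF_eq, Real.exp_le_exp]
  nlinarith

lemma hasDerivAt_metF (P : Profile x h u W) (hr : 0 < r) :
    HasDerivAt (metF h u) (metFd h u r) r := by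
  have h1 := hasDerivAt_primitive_of_pos P.continuousOn_dens hr (P.intervalIntegrable_dens hr.le)
  have h2 := (h1.const_mul 2⁻¹).exp
  refine h2.congr_deriv ?_
  rw [metFd, metF_eq]
  field_simp

lemma continuousOn_metFd (P : Profile x h u W) : ContinuousOn (metFd h u) (Ioi 0) := by
  have h1 : ContinuousOn (metF h u) (Ioi 0) :=
    fun r hr => (P.hasDerivAt_metF hr).continuousAt.continuousWithinAt
  exact (h1.mul (P.continuousOn_devAvg.pow 2)).div (by fun_prop)
    fun r hr => mul_ne_zero two_ne_zero (ne_of_gt hr)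

lemma metFd_nonneg (hr : 0 < r) : 0 ≤ metFd h u r := by
  have := one_le_metF (h := h) (u := u) hr.le
  rw [metFd]; positivity

lemma metFd_le (P : Profile x h u W) (hr : 0 < r) :
    metFd h u r ≤ 4 * x ^ 2 * r / (1 + r) ^ 3 := by
  have h1 := P.metF_le_two hr.le
  have h2 := one_le_metF (h := h) (u := u) hr.le
  have h3 := P.dens_bound hr
  have h4 := dens_nonneg (h := h) (u := u) hr
  have : metFd h u r = metF h u r / 2 * (devAvg h u r ^ 2 / r) := by
    rw [metFd]; field_simp
  rw [this]
  nlinarith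

lemma continuousOn_metF (P : Profile x h u W) : ContinuousOn (metF h u) (Ici 0) := by
  have hd : ∀ R, 0 ≤ R → ContinuousOn (fun b => ∫ s in (0:ℝ)..b, devAvg h u s ^ 2 / s)
      (Icc 0 R) := fun R hR => by
    have := intervalIntegral.continuousOn_primitive_interval' (P.intervalIntegrable_dens hR)
      (left_mem_uIcc)
    rwa [uIcc_of_le hR] at this
  intro r hr
  have hr : (0:ℝ) ≤ r := hr
  have h1 := (hd (r + 1) (by linarith)) r ⟨hr, by linarith⟩
  have h2 : ContinuousWithinAt (metF h u) (Icc 0 (r + 1)) r :=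
    (continuousWithinAt_const.mul h1).rexp
  refine h2.mono_of_mem_nhdsWithin ?_
  filter_upwards [self_mem_nhdsWithin, mem_nhdsWithin_of_mem_nhds (Iio_mem_nhds (lt_add_one r))]
    with s hs hs1
  exact ⟨hs, le_of_lt hs1⟩

lemma metF_zero : metF h u 0 = 1 := by simp [metF]

lemma metFt_eq (h : ℝ → ℝ → ℝ) (u r : ℝ) :
    metFt h u r = (1 - r ^ 2) * metF h u r - 2 * r * coefK h u r := by
  rcases eq_or_ne r 0 with rfl | hr
  · simp [metFt, metF_zero]
  · rw [coefK, coefG, if_neg hr]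
    field_simp
    ring

lemma metFt_of_pos (hr : 0 < r) :
    metFt h u r = (∫ s in (0:ℝ)..r, (1 - 3 * s ^ 2) * metF h u s) / r := by
  rw [metFt, if_neg hr.ne']

lemma intervalIntegrable_metFt (P : Profile x h u W) (hr : 0 ≤ r) :
    IntervalIntegrable (fun s => (1 - 3 * s ^ 2) * metF h u s) volume 0 r := by
  refine ContinuousOn.intervalIntegrable ?_
  rw [uIcc_of_le hr]
  exact (Continuous.continuousOn (by fun_prop)).mul (P.continuousOn_metF.mono fun s hs => hs.1)

lemma coefK_dens_bound (P : Profile x h u W) {s : ℝ} (hs : 0 < s) :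
    |(s - s ^ 3) * metFd h u s| ≤ 4 * x ^ 2 * s ∧
      |(s - s ^ 3) * metFd h u s| ≤ 4 * x ^ 2 * s ^ 2 := by
  have h1 := P.metFd_le hs
  have h2 := metFd_nonneg (h := h) (u := u) hs
  have h3 : |s - s ^ 3| ≤ s * (1 + s) ^ 2 := by
    rw [abs_le]; constructor <;> nlinarith [pow_pos hs 2, pow_pos hs 3]
  rw [abs_mul, abs_of_nonneg h2]
  have h4 : |s - s ^ 3| * metFd h u s ≤ s * (1 + s) ^ 2 * (4 * x ^ 2 * s / (1 + s) ^ 3) :=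
    mul_le_mul h3 h1 h2 (by positivity)
  have h5 : s * (1 + s) ^ 2 * (4 * x ^ 2 * s / (1 + s) ^ 3) = 4 * x ^ 2 * s ^ 2 / (1 + s) := by
    field_simp
  rw [h5] at h4
  constructor
  · refine h4.trans ?_
    rw [div_le_iff₀ (by linarith)]
    have : 0 ≤ 4 * x ^ 2 * s := by positivity
    nlinarith
  · refine h4.trans (div_le_self (by positivity) (by linarith))

lemma continuousOn_coefK_dens (P : Profile x h u W) :
    ContinuousOn (fun s => (s - s ^ 3) * metFd h u s) (Ioi 0) :=
  (Continuous.continuousOn (by fun_prop)).mul P.continuousOn_metFd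

lemma intervalIntegrable_coefK_dens (P : Profile x h u W) (hr : 0 ≤ r) :
    IntervalIntegrable (fun s => (s - s ^ 3) * metFd h u s) volume 0 r :=
  intervalIntegrable_zero_of_bounded P.continuousOn_coefK_dens (C := 4 * x ^ 2 * r) hr
    fun s hs hsr => (P.coefK_dens_bound hs).1.trans (by gcongr)

lemma coefK_eq (P : Profile x h u W) (hr : 0 < r) :
    coefK h u r = (∫ s in (0:ℝ)..r, (s - s ^ 3) * metFd h u s) / (2 * r ^ 2) := by
  have hd : ∀ s ∈ Ioo 0 r, HasDerivAt (fun s => (s - s ^ 3) * metF h u s)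
      ((1 - 3 * s ^ 2) * metF h u s + (s - s ^ 3) * metFd h u s) s := fun s hs => by
    have h1 : HasDerivAt (fun s : ℝ => s - s ^ 3) (1 - 3 * s ^ 2) s :=
      ((hasDerivAt_id s).sub (hasDerivAt_pow 3 s)).congr_deriv (by simp)
    exact h1.mul (P.hasDerivAt_metF hs.1)
  have h1 := intervalIntegral.integral_eq_sub_of_hasDerivAt_of_le hr.le
    ((Continuous.continuousOn (by fun_prop)).mul (P.continuousOn_metF.mono fun s hs => hs.1)) hd
    ((P.intervalIntegrable_metFt hr.le).add (P.intervalIntegrable_coefK_dens hr.le))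
  rw [intervalIntegral.integral_add (P.intervalIntegrable_metFt hr.le)
    (P.intervalIntegrable_coefK_dens hr.le)] at h1
  simp only [Pi.mul_apply] at h1
  have h2 := metFt_eq h u r
  rw [metFt_of_pos hr, div_eq_iff hr.ne'] at h2
  rw [eq_div_iff (by positivity)]
  linarith

lemma coefK_bound (P : Profile x h u W) (hr : 0 < r) :
    |coefK h u r| ≤ x ^ 2 ∧ |coefK h u r| ≤ x ^ 2 * r := by
  rw [P.coefK_eq hr, abs_div, abs_of_pos (by positivity : 0 < 2 * r ^ 2)]
  constructor
  · rw [div_le_iff₀ (by positivity)]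
    have := abs_integral_le_primitive (g := fun s => 4 * x ^ 2 * s)
      (P := fun s => 4 * x ^ 2 * (s ^ 2 / 2)) hr.le
      (fun s hs _ => (P.coefK_dens_bound hs).1)
      (fun s _ => by simpa using ((hasDerivAt_pow 2 s).div_const 2).const_mul (4 * x ^ 2))
      (Continuous.continuousOn (by fun_prop))
    linarith
  · rw [div_le_iff₀ (by positivity)]
    have := abs_integral_le_primitive (g := fun s => 4 * x ^ 2 * s ^ 2)
      (P := fun s => 4 * x ^ 2 * (s ^ 3 / 3)) hr.le
      (fun s hs _ => (P.coefK_dens_bound hs).2)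
      (fun s _ => by simpa using ((hasDerivAt_pow 3 s).div_const 3).const_mul (4 * x ^ 2))
      (Continuous.continuousOn (by fun_prop))
    have : 0 ≤ x ^ 2 * r ^ 3 := by positivity
    nlinarith

lemma hasDerivAt_metFt (P : Profile x h u W) (hr : 0 < r) :
    HasDerivAt (metFt h u) (2 * coefG h u r) r := by
  have h1 := hasDerivAt_primitive_of_pos
    (φ := fun s => (1 - 3 * s ^ 2) * metF h u s)
    ((Continuous.continuousOn (by fun_prop)).mul (P.continuousOn_metF.mono Ioi_subset_Ici_self))
    hr (P.intervalIntegrable_metFt hr.le)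
  have h2 := (h1.div (hasDerivAt_id r) hr.ne').congr_of_eventuallyEq
    (f₁ := metFt h u) (by
      filter_upwards [Ioi_mem_nhds hr] with s hs
      exact metFt_of_pos hs)
  refine h2.congr_deriv ?_
  have h3 := metFt_of_pos (h := h) (u := u) hr
  rw [coefG, if_neg hr.ne', h3]
  simp only [id]
  field_simp
  ring

lemma coefG_eq (h : ℝ → ℝ → ℝ) (u r : ℝ) :
    coefG h u r = coefK h u r - r * metF h u r := by rw [coefK]; ring

lemma coefG_zero : coefG h u 0 = 0 := by simp [coefG]

lemma coefJ_eq (P : Profile x h u W) (hr : 0 < r) :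
    coefJ h u r = 3 * coefK h u r - (1 - 3 * r ^ 2) / 2 * metFd h u r := by
  rw [coefJ, (P.hasDerivAt_metF hr).deriv, coefK]; ring

lemma coefJ_bound (P : Profile x h u W) (hr : 0 < r) :
    |coefJ h u r| ≤ 12 * x ^ 2 * r / (1 + r) := by
  rw [P.coefJ_eq hr]
  obtain ⟨k1, k2⟩ := P.coefK_bound hr
  have h1 := P.metFd_le hr
  have h2 := metFd_nonneg (h := h) (u := u) hr
  have h3 : |coefK h u r| ≤ 2 * x ^ 2 * r / (1 + r) := by
    rw [le_div_iff₀ (by linarith)]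
    nlinarith
  have h4 : |(1 - 3 * r ^ 2) / 2| ≤ 3 / 2 * (1 + r) ^ 2 := by
    rw [abs_le]; constructor <;> nlinarith
  have h5 : |(1 - 3 * r ^ 2) / 2 * metFd h u r| ≤
      3 / 2 * (1 + r) ^ 2 * (4 * x ^ 2 * r / (1 + r) ^ 3) := by
    rw [abs_mul, abs_of_nonneg h2]
    exact mul_le_mul h4 h1 h2 (by positivity)
  have h6 : 3 / 2 * (1 + r) ^ 2 * (4 * x ^ 2 * r / (1 + r) ^ 3) = 6 * x ^ 2 * r / (1 + r) := by
    field_simp; ring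
  have h7 : 12 * x ^ 2 * r / (1 + r) = 3 * (2 * x ^ 2 * r / (1 + r)) + 6 * x ^ 2 * r / (1 + r) := by
    field_simp; ring
  rw [h6] at h5
  rw [h7]
  refine (abs_sub _ _).trans (add_le_add ?_ h5)
  rw [abs_mul, abs_of_pos (by norm_num : (0:ℝ) < 3)]
  linarith

lemma continuousOn_coefG_pos (P : Profile x h u W) : ContinuousOn (coefG h u) (Ioi 0) := by
  have h1 : ContinuousOn (metFt h u) (Ioi 0) :=
    fun r hr => (P.hasDerivAt_metFt hr).continuousAt.continuousWithinAt
  have h2 : ContinuousOn (metF h u) (Ioi 0) := P.continuousOn_metF.mono Ioi_subset_Ici_self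
  have h3 : ContinuousOn (fun r => ((metF h u r - metFt h u r) - 3 * metF h u r * r ^ 2) / (2 * r))
      (Ioi 0) :=
    ((h1.neg.add h2).congr (fun r _ => by simp; ring) |>.sub
      ((continuousOn_const.mul h2).mul (by fun_prop))).div (by fun_prop)
      fun r hr => mul_ne_zero two_ne_zero (ne_of_gt hr)
  exact h3.congr fun r hr => by rw [coefG, if_neg (ne_of_gt hr)]

lemma coefG_bound (P : Profile x h u W) (hr : 0 < r) : |coefG h u r| ≤ 3 * r := by
  have hx := P.pos
  have hx' := P.le
  have h1 := abs_le.1 (P.coefK_bound hr).2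
  have h2 := P.metF_le_two hr.le
  have h3 := one_le_metF (h := h) (u := u) hr.le
  rw [coefG_eq, abs_le]
  have : x ^ 2 ≤ 1 := by nlinarith
  constructor <;> nlinarith

lemma coefG_nonpos (P : Profile x h u W) (hr : 0 ≤ r) : coefG h u r ≤ 0 := by
  rcases eq_or_lt_of_le hr with rfl | hr
  · rw [coefG_zero]
  have hx := P.pos
  have hx' := P.le
  have h1 := abs_le.1 (P.coefK_bound hr).2
  have h3 := one_le_metF (h := h) (u := u) hr.le
  rw [coefG_eq]
  have : x ^ 2 ≤ 1 := by nlinarith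
  nlinarith

lemma continuousOn_coefG (P : Profile x h u W) : ContinuousOn (coefG h u) (Ici 0) :=
  continuousOn_Ici_of_pos_of_lipschitz_zero P.continuousOn_coefG_pos (C := 3) fun s hs _ => by
    rw [coefG_zero, sub_zero]; exact P.coefG_bound hs

lemma continuousOn_metFt (P : Profile x h u W) : ContinuousOn (metFt h u) (Ici 0) := by
  have h1 : ContinuousOn (fun r => (1 - r ^ 2) * metF h u r -
      2 * r * (coefG h u r + r * metF h u r)) (Ici 0) :=
    (ContinuousOn.mul (by fun_prop) P.continuousOn_metF).sub
      (ContinuousOn.mul (by fun_prop) (P.continuousOn_coefG.add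
        (continuousOn_id.mul P.continuousOn_metF)))
  exact h1.congr fun r _ => metFt_eq h u r

lemma hasDerivAt_coefG (P : Profile x h u W) (hr : 0 < r) :
    HasDerivAt (coefG h u) ((coefG h u r - coefJ h u r) / r) r := by
  have h1 := P.hasDerivAt_metF hr
  have h2 := P.hasDerivAt_metFt hr
  have h3 : HasDerivAt (fun r => ((metF h u r - metFt h u r) - 3 * metF h u r * r ^ 2) / (2 * r))
      _ r :=
    ((h1.sub h2).sub ((h1.const_mul 3).mul (hasDerivAt_pow 2 r))).div
      ((hasDerivAt_id r).const_mul 2) (by simp [hr.ne'])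
  have h4 := h3.congr_of_eventuallyEq (f₁ := coefG h u) (by
      filter_upwards [Ioi_mem_nhds hr] with s hs
      rw [coefG, if_neg (ne_of_gt hs)])
  refine h4.congr_deriv ?_
  have h5 : metFt h u r = metF h u r - 3 * metF h u r * r ^ 2 - 2 * r * coefG h u r := by
    rw [coefG, if_neg hr.ne']; field_simp; ring
  rw [coefJ, h1.deriv]
  simp only [Pi.sub_apply, Pi.mul_apply, h5]
  field_simp
  push_cast
  ring

lemma continuousOn_coefJ (P : Profile x h u W) : ContinuousOn (coefJ h u) (Ioi 0) := by
  have h2 : ContinuousOn (metF h u) (Ioi 0) := P.continuousOn_metF.mono Ioi_subset_Ici_self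
  have h1 : ContinuousOn (fun r => 3 * coefG h u r + 3 * r * metF h u r -
      ((1 - 3 * r ^ 2) / 2) * metFd h u r) (Ioi 0) :=
    ((continuousOn_const.mul P.continuousOn_coefG_pos).add
      (ContinuousOn.mul (by fun_prop) h2)).sub
      (ContinuousOn.mul (by fun_prop) P.continuousOn_metFd)
  exact h1.congr fun r hr => by rw [coefJ, (P.hasDerivAt_metF hr).deriv]

lemma coefG_deriv_bound (P : Profile x h u W) (hr : 0 < r) :
    |(coefG h u r - coefJ h u r) / r| ≤ 4 ∧ (coefG h u r - coefJ h u r) / r ≤ 0 := by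
  have hx := P.pos
  have hx' := P.le
  have hx2 : x ^ 2 ≤ 1 / 1000 := by nlinarith
  have h1 := abs_le.1 (P.coefK_bound hr).2
  have h2 := P.metF_le_two hr.le
  have h3 := one_le_metF (h := h) (u := u) hr.le
  have h4 : |coefJ h u r| ≤ 12 * x ^ 2 * r :=
    (P.coefJ_bound hr).trans (div_le_self (by positivity) (by linarith))
  have h5 := abs_le.1 h4
  have h6 := coefG_eq h u r
  constructor
  · rw [abs_div, abs_of_pos hr, div_le_iff₀ hr, abs_le]
    constructor <;> nlinarith
  · refine div_nonpos_of_nonpos_of_nonneg ?_ hr.le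
    nlinarith

end Profile
end Profile

section Difference

variable {x u r B : ℝ} {h h₁ h₂ : ℝ → ℝ → ℝ} {W W₁ W₂ : ℝ → ℝ}

namespace Profile

lemma devAvg_sub_bound (P₁ : Profile x h₁ u W₁) (P₂ : Profile x h₂ u W₂)
    (hB : ∀ r, 0 ≤ r → |h₁ u r - h₂ u r| ≤ B) (hr : 0 < r) :
    |devAvg h₁ u r - devAvg h₂ u r| ≤ 2 * B := by
  have h1 : |∫ s in (0:ℝ)..r, (h₁ u s - h₂ u s)| ≤ B * r := by
    have := abs_integral_le_primitive (φ := fun s => h₁ u s - h₂ u s) (g := fun _ => B)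
      (P := fun s => B * s) hr.le (fun s hs _ => hB s hs.le)
      (fun s _ => by simpa using (hasDerivAt_id s).const_mul B) continuousOn_const
    simpa using this
  rw [intervalIntegral.integral_sub (P₁.continuous_slice.intervalIntegrable _ _)
    (P₂.continuous_slice.intervalIntegrable _ _)] at h1
  have h2 : devAvg h₁ u r - devAvg h₂ u r = (h₁ u r - h₂ u r) -
      ((∫ s in (0:ℝ)..r, h₁ u s) - ∫ s in (0:ℝ)..r, h₂ u s) / r := by
    simp only [devAvg, radAvg, if_neg hr.ne']
    ring
  have h3 : |((∫ s in (0:ℝ)..r, h₁ u s) - ∫ s in (0:ℝ)..r, h₂ u s) / r| ≤ B := by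
    rw [abs_div, abs_of_pos hr, div_le_iff₀ hr]; exact h1
  rw [h2]
  exact (abs_sub _ _).trans (by linarith [hB r hr.le])

lemma dens_sub_bound (P₁ : Profile x h₁ u W₁) (P₂ : Profile x h₂ u W₂)
    (hB : ∀ r, 0 ≤ r → |h₁ u r - h₂ u r| ≤ B) (hr : 0 < r) :
    |devAvg h₁ u r ^ 2 / r - devAvg h₂ u r ^ 2 / r| ≤ 8 * x * B * (1 / √(1 + r) ^ 3) := by
  have hx := P₁.pos
  have hq := one_le_sqrt_one_add hr.le
  have h1 := P₁.devAvg_bound hr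
  have h2 := P₂.devAvg_bound hr
  have h3 := P₁.devAvg_sub_bound P₂ hB hr
  have h4 : |devAvg h₁ u r + devAvg h₂ u r| ≤ 2 * (2 * x * r / √(1 + r) ^ 3) :=
    (abs_add_le _ _).trans (by linarith)
  have h5 : devAvg h₁ u r ^ 2 / r - devAvg h₂ u r ^ 2 / r =
      (devAvg h₁ u r + devAvg h₂ u r) * (devAvg h₁ u r - devAvg h₂ u r) / r := by ring
  rw [h5, abs_div, abs_of_pos hr, abs_mul, div_le_iff₀ hr]
  refine (mul_le_mul h4 h3 (abs_nonneg _) (by positivity)).trans (le_of_eq ?_)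
  ring

lemma abs_exp_sub_exp_le {a b : ℝ} (ha : Real.exp a ≤ 2) (hb : Real.exp b ≤ 2) :
    |Real.exp a - Real.exp b| ≤ 2 * |a - b| := by
  have key : ∀ {a b : ℝ}, b ≤ a → Real.exp a ≤ 2 → |Real.exp a - Real.exp b| ≤ 2 * |a - b| := by
    intro a b hab ha
    rw [abs_of_nonneg (by linarith [Real.exp_le_exp.2 hab]), abs_of_nonneg (by linarith)]
    have h1 : Real.exp b = Real.exp a * Real.exp (b - a) := by rw [← Real.exp_add]; ring_nf
    have h2 := Real.add_one_le_exp (b - a)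
    have h3 := Real.exp_pos a
    nlinarith
  rcases le_total b a with hab | hab
  · exact key hab ha
  · rw [abs_sub_comm, abs_sub_comm a]; exact key hab hb

lemma metF_sub_bound (P₁ : Profile x h₁ u W₁) (P₂ : Profile x h₂ u W₂) (hB0 : 0 ≤ B)
    (hB : ∀ r, 0 ≤ r → |h₁ u r - h₂ u r| ≤ B) (hr : 0 ≤ r) :
    |metF h₁ u r - metF h₂ u r| ≤ 16 * x * B := by
  have hx := P₁.pos
  have h1 := abs_integral_le_primitive
    (φ := fun s => devAvg h₁ u s ^ 2 / s - devAvg h₂ u s ^ 2 / s)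
    (g := fun s => 8 * x * B * (1 / √(1 + s) ^ 3))
    (P := fun s => 8 * x * B * (-2 * (1 / √(1 + s)))) hr
    (fun s hs _ => P₁.dens_sub_bound P₂ hB hs)
    (fun s hs => by
      have h1 := one_le_sqrt_one_add hs
      refine (((hasDerivAt_inv_sqrt_one_add hs).const_mul (-2)).const_mul (8 * x * B)).congr_deriv ?_
      field_simp)
    (fun s hs => by
      have h1 := one_le_sqrt_one_add (show (0:ℝ) ≤ s from hs)
      exact ContinuousAt.continuousWithinAt (by fun_prop (disch := positivity)))
  rw [intervalIntegral.integral_sub (P₁.intervalIntegrable_dens hr)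
    (P₂.intervalIntegrable_dens hr)] at h1
  have h2 := P₁.metF_le_two hr
  have h3 := P₂.metF_le_two hr
  rw [metF_eq] at h2 h3 ⊢
  rw [metF_eq h₂]
  refine (abs_exp_sub_exp_le h2 h3).trans ?_
  rw [← mul_sub, abs_mul, abs_of_pos (by norm_num : (0:ℝ) < 2⁻¹)]
  simp only [add_zero, Real.sqrt_one] at h1
  have hq := one_le_sqrt_one_add hr
  have : 0 ≤ 8 * x * B * (2 * (1 / √(1 + r))) := by positivity
  linarith

lemma metFd_sub_bound (P₁ : Profile x h₁ u W₁) (P₂ : Profile x h₂ u W₂) (hB0 : 0 ≤ B)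
    (hB : ∀ r, 0 ≤ r → |h₁ u r - h₂ u r| ≤ B) (hr : 0 < r) :
    |metFd h₁ u r - metFd h₂ u r| ≤ 9 * x * B / √(1 + r) ^ 3 := by
  have hx := P₁.pos
  have hx' := P₁.le
  have hq := one_le_sqrt_one_add hr.le
  have hq2 := sq_sqrt_one_add hr
  have h1 := P₁.metF_sub_bound P₂ hB0 hB hr.le
  have h2 := P₁.dens_sub_bound P₂ hB hr
  have h3 := P₁.dens_bound' hr
  have h4 := P₂.metF_le_two hr.le
  have h5 := one_le_metF (h := h₂) (u := u) hr.le
  have e : metFd h₁ u r - metFd h₂ u r =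
      ((metF h₁ u r - metF h₂ u r) * (devAvg h₁ u r ^ 2 / r) +
      metF h₂ u r * (devAvg h₁ u r ^ 2 / r - devAvg h₂ u r ^ 2 / r)) / 2 := by
    simp only [metFd]; field_simp; ring
  have h6 := mul_le_mul h1 h3 (abs_nonneg _) (by positivity)
  have h7 := mul_le_mul h4 h2 (abs_nonneg _) (by norm_num)
  rw [← abs_of_nonneg (by linarith : (0:ℝ) ≤ metF h₂ u r), ← abs_mul] at h7
  rw [← abs_mul] at h6
  rw [e, abs_div, abs_of_pos (by norm_num : (0:ℝ) < 2), div_le_iff₀ (by norm_num)]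
  refine (abs_add_le _ _).trans ((add_le_add h6 h7).trans ?_)
  generalize √(1 + r) = q at hq hq2 ⊢
  rw [← hq2]
  have : 9 * x * B / q ^ 3 * 2 - (16 * x * B * (4 * x ^ 2 * (1 / (q ^ 2) ^ 2)) +
      2 * (8 * x * B * (1 / q ^ 3))) = 2 * x * B * (q - 32 * x ^ 2) / q ^ 4 := by
    field_simp; ring
  have h8 : 0 ≤ q - 32 * x ^ 2 := by nlinarith
  have : 0 ≤ 2 * x * B * (q - 32 * x ^ 2) / q ^ 4 := by positivity
  linarith

lemma coefK_sub_bound (P₁ : Profile x h₁ u W₁) (P₂ : Profile x h₂ u W₂) (hB0 : 0 ≤ B)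
    (hB : ∀ r, 0 ≤ r → |h₁ u r - h₂ u r| ≤ B) (hr : 0 < r) :
    |coefK h₁ u r - coefK h₂ u r| ≤ 3 * x * B * √(1 + r) := by
  have hx := P₁.pos
  have hb : ∀ s, 0 < s → s ≤ r → |(s - s ^ 3) * metFd h₁ u s - (s - s ^ 3) * metFd h₂ u s| ≤
      9 * x * B * √(1 + r) * s := by
    intro s hs hsr
    have h1 := P₁.metFd_sub_bound P₂ hB0 hB hs
    have h3 : |s - s ^ 3| ≤ s * (1 + s) ^ 2 := by
      rw [abs_le]; constructor <;> nlinarith [pow_pos hs 2, pow_pos hs 3]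
    rw [← mul_sub, abs_mul]
    refine (mul_le_mul h3 h1 (abs_nonneg _) (by positivity)).trans ?_
    have hq := one_le_sqrt_one_add hs.le
    have hq2 := sq_sqrt_one_add hs
    have hle : √(1 + s) ≤ √(1 + r) := Real.sqrt_le_sqrt (by linarith)
    have e : s * (1 + s) ^ 2 * (9 * x * B / √(1 + s) ^ 3) = 9 * x * B * √(1 + s) * s := by
      generalize √(1 + s) = q at *
      rw [← hq2]; field_simp
    rw [e]
    gcongr
  have h1 := abs_integral_le_primitive (P := fun s => 9 * x * B * √(1 + r) * (s ^ 2 / 2)) hr.le hb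
    (fun s _ => by
      simpa using ((hasDerivAt_pow 2 s).div_const 2).const_mul (9 * x * B * √(1 + r)))
    (Continuous.continuousOn (by fun_prop))
  rw [intervalIntegral.integral_sub (P₁.intervalIntegrable_coefK_dens hr.le)
    (P₂.intervalIntegrable_coefK_dens hr.le)] at h1
  rw [P₁.coefK_eq hr, P₂.coefK_eq hr, ← sub_div, abs_div, abs_of_pos (by positivity : 0 < 2 * r ^ 2),
    div_le_iff₀ (by positivity)]
  refine h1.trans ?_
  have : 0 ≤ x * B * √(1 + r) * r ^ 2 := by positivity
  nlinarith

lemma coefG_sub_bound (P₁ : Profile x h₁ u W₁) (P₂ : Profile x h₂ u W₂) (hB0 : 0 ≤ B)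
    (hB : ∀ r, 0 ≤ r → |h₁ u r - h₂ u r| ≤ B) (hr : 0 < r) :
    |coefG h₁ u r - coefG h₂ u r| ≤ 19 * x * B * (1 + r) := by
  have hx := P₁.pos
  have h1 := abs_le.1 (P₁.coefK_sub_bound P₂ hB0 hB hr)
  have h2 := abs_le.1 (P₁.metF_sub_bound P₂ hB0 hB hr.le)
  have hq := one_le_sqrt_one_add hr.le
  have hq2 := sq_sqrt_one_add hr
  have hq3 : √(1 + r) ≤ 1 + r := by nlinarith
  have h3 : 3 * x * B * √(1 + r) ≤ 3 * x * B * (1 + r) := by gcongr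
  have h4 := mul_le_mul_of_nonneg_left h2.1 hr.le
  have h5 := mul_le_mul_of_nonneg_left h2.2 hr.le
  have h6 : 0 ≤ x * B := by positivity
  rw [coefG_eq, coefG_eq h₂, abs_le]
  constructor <;> nlinarith

lemma coefJ_sub_bound (P₁ : Profile x h₁ u W₁) (P₂ : Profile x h₂ u W₂) (hB0 : 0 ≤ B)
    (hB : ∀ r, 0 ≤ r → |h₁ u r - h₂ u r| ≤ B) (hr : 0 < r) :
    |coefJ h₁ u r - coefJ h₂ u r| ≤ 23 * x * B * √(1 + r) := by
  have hx := P₁.pos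
  have h1 := P₁.coefK_sub_bound P₂ hB0 hB hr
  have h2 := P₁.metFd_sub_bound P₂ hB0 hB hr
  have hq := one_le_sqrt_one_add hr.le
  have hq2 := sq_sqrt_one_add hr
  have h3 : |(1 - 3 * r ^ 2) / 2| ≤ 3 / 2 * (1 + r) ^ 2 := by
    rw [abs_le]; constructor <;> nlinarith
  have h4 := mul_le_mul h3 h2 (abs_nonneg _) (by positivity)
  have e : 3 / 2 * (1 + r) ^ 2 * (9 * x * B / √(1 + r) ^ 3) = 27 / 2 * x * B * √(1 + r) := by
    generalize √(1 + r) = q at *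
    rw [← hq2]; field_simp; ring
  rw [← abs_mul, e] at h4
  have e2 : coefJ h₁ u r - coefJ h₂ u r = 3 * (coefK h₁ u r - coefK h₂ u r) -
      (1 - 3 * r ^ 2) / 2 * (metFd h₁ u r - metFd h₂ u r) := by
    rw [P₁.coefJ_eq hr, P₂.coefJ_eq hr]; ring
  rw [e2]
  refine (abs_sub _ _).trans ((add_le_add (le_of_eq (abs_mul _ _)) h4).trans ?_)
  rw [abs_of_pos (by norm_num : (0:ℝ) < 3)]
  have : 0 ≤ x * B * √(1 + r) := by positivity
  nlinarith

lemma metFt_sub_bound (P₁ : Profile x h₁ u W₁) (P₂ : Profile x h₂ u W₂) (hB0 : 0 ≤ B)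
    (hB : ∀ r, 0 ≤ r → |h₁ u r - h₂ u r| ≤ B) (hr : 0 < r) :
    |metFt h₁ u r - metFt h₂ u r| ≤ 22 * x * B * (1 + r) ^ 2 := by
  have hx := P₁.pos
  have h1 := P₁.coefK_sub_bound P₂ hB0 hB hr
  have h2 := P₁.metF_sub_bound P₂ hB0 hB hr.le
  have hq := one_le_sqrt_one_add hr.le
  have hq2 := sq_sqrt_one_add hr
  have hq3 : √(1 + r) ≤ 1 + r := by nlinarith
  have h6 : 0 ≤ x * B := by positivity
  have e : metFt h₁ u r - metFt h₂ u r = (1 - r ^ 2) * (metF h₁ u r - metF h₂ u r) -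
      2 * r * (coefK h₁ u r - coefK h₂ u r) := by rw [metFt_eq, metFt_eq h₂]; ring
  have h3 : |1 - r ^ 2| ≤ (1 + r) ^ 2 := by rw [abs_le]; constructor <;> nlinarith
  have h4 := mul_le_mul h3 h2 (abs_nonneg _) (by positivity)
  have h5 : 2 * r * |coefK h₁ u r - coefK h₂ u r| ≤ 2 * (1 + r) * (3 * x * B * (1 + r)) :=
    mul_le_mul (by linarith) (h1.trans (by gcongr)) (abs_nonneg _) (by positivity)
  rw [e]
  refine (abs_sub _ _).trans ?_
  rw [abs_mul, abs_mul, abs_of_pos (by positivity : 0 < 2 * r)]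
  nlinarith

/-- The zeroth order part of the source of the transport equation for the primitive. -/
lemma continuousOn_source (P : Profile x h u W) :
    ContinuousOn (fun s => coefJ h u s * devAvg h u s / s) (Ioi 0) :=
  (P.continuousOn_coefJ.mul P.continuousOn_devAvg).div continuousOn_id fun _ hs => ne_of_gt hs

lemma source_bound (P : Profile x h u W) (hr : 0 < r) :
    |coefJ h u r * devAvg h u r / r| ≤ 24 * x ^ 3 / √(1 + r) ^ 3 := by
  have hx := P.pos
  have hq := one_le_sqrt_one_add hr.le
  have h1 := P.coefJ_bound hr
  have h1' : 12 * x ^ 2 * r / (1 + r) ≤ 12 * x ^ 2 := by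
    rw [div_le_iff₀ (by linarith)]
    have : 0 ≤ x ^ 2 := sq_nonneg x
    nlinarith
  rw [abs_div, abs_of_pos hr, div_le_iff₀ hr, abs_mul]
  refine (mul_le_mul (h1.trans h1') (P.devAvg_bound hr) (abs_nonneg _)
    (by positivity)).trans (le_of_eq ?_)
  ring

lemma intervalIntegrable_source (P : Profile x h u W) (hr : 0 ≤ r) :
    IntervalIntegrable (fun s => coefJ h u s * devAvg h u s / s) volume 0 r := by
  have hx := P.pos
  refine intervalIntegrable_zero_of_bounded P.continuousOn_source (C := 24 * x ^ 3) hr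
    fun s hs _ => (P.source_bound hs).trans ?_
  exact div_le_self (by positivity) (one_le_pow₀ (one_le_sqrt_one_add hs.le))

lemma intervalIntegrable_coefG_mul (P : Profile x h u W) {y : ℝ → ℝ} (hy : Continuous y)
    (hr : 0 ≤ r) : IntervalIntegrable (fun s => coefG h u s * y s) volume 0 r := by
  refine ContinuousOn.intervalIntegrable ?_
  rw [uIcc_of_le hr]
  exact (P.continuousOn_coefG.mono fun s hs => hs.1).mul hy.continuousOn

lemma integral_source_sub_bound (P₁ : Profile x h₁ u W₁) (P₂ : Profile x h₂ u W₂) (hB0 : 0 ≤ B)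
    (hB : ∀ r, 0 ≤ r → |h₁ u r - h₂ u r| ≤ B) (hr : 0 < r) :
    |∫ s in (0:ℝ)..r, ((coefG h₁ u s - coefG h₂ u s) * W₁ s -
      (coefJ h₁ u s * devAvg h₁ u s / s - coefJ h₂ u s * devAvg h₂ u s / s))| ≤
      178 * x ^ 2 * B * √(1 + r) := by
  have hx := P₁.pos
  have key := abs_integral_le_primitive (g := fun s => 89 * x ^ 2 * B * (1 / √(1 + s)))
    (P := fun s => 89 * x ^ 2 * B * (2 * √(1 + s)))
    (φ := fun s => (coefG h₁ u s - coefG h₂ u s) * W₁ s -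
      (coefJ h₁ u s * devAvg h₁ u s / s - coefJ h₂ u s * devAvg h₂ u s / s)) hr.le ?_ ?_ ?_
  · refine key.trans ?_
    simp only [add_zero, Real.sqrt_one]
    have : 0 ≤ x ^ 2 * B := by positivity
    linarith
  · intro s hs _
    have hq := one_le_sqrt_one_add hs.le
    have hq2 := sq_sqrt_one_add hs
    have h1 := mul_le_mul (P₁.coefG_sub_bound P₂ hB0 hB hs) (P₁.bound s hs) (abs_nonneg _)
      (by positivity)
    have h2 := mul_le_mul (P₁.coefJ_bound hs) (P₁.devAvg_sub_bound P₂ hB hs) (abs_nonneg _)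
      (by positivity)
    have h3 := mul_le_mul (P₁.coefJ_sub_bound P₂ hB0 hB hs) (P₂.devAvg_bound hs) (abs_nonneg _)
      (by positivity)
    rw [← abs_mul] at h1 h2 h3
    have e : (coefG h₁ u s - coefG h₂ u s) * W₁ s -
        (coefJ h₁ u s * devAvg h₁ u s / s - coefJ h₂ u s * devAvg h₂ u s / s) =
        (coefG h₁ u s - coefG h₂ u s) * W₁ s -
        (coefJ h₁ u s * (devAvg h₁ u s - devAvg h₂ u s) +
          (coefJ h₁ u s - coefJ h₂ u s) * devAvg h₂ u s) / s := by ring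
    rw [e]
    refine (abs_sub _ _).trans ?_
    rw [abs_div, abs_of_pos hs]
    have h4 := div_le_div_of_nonneg_right ((abs_add_le _ _).trans (add_le_add h2 h3)) hs.le
    refine (add_le_add h1 h4).trans ?_
    have e2 : (12 * x ^ 2 * s / (1 + s) * (2 * B) +
        23 * x * B * √(1 + s) * (2 * x * s / √(1 + s) ^ 3)) / s =
        70 * x ^ 2 * B / √(1 + s) ^ 2 := by
      generalize √(1 + s) = q at hq hq2 ⊢
      rw [← hq2]
      field_simp
      ring
    have e3 : 19 * x * B * (1 + s) * (x / √(1 + s) ^ 3) = 19 * x ^ 2 * B * (1 / √(1 + s)) := by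
      generalize √(1 + s) = q at hq hq2 ⊢
      rw [← hq2]
      field_simp
    rw [e2, e3]
    have h5 : 70 * x ^ 2 * B / √(1 + s) ^ 2 ≤ 70 * x ^ 2 * B / √(1 + s) := by
      gcongr
      nlinarith
    have e4 : 89 * x ^ 2 * B * (1 / √(1 + s)) = 19 * x ^ 2 * B * (1 / √(1 + s)) +
      70 * x ^ 2 * B / √(1 + s) := by ring
    rw [e4]
    linarith
  · intro s hs
    refine (((hasDerivAt_sqrt_one_add hs).const_mul 2).const_mul (89 * x ^ 2 * B)).congr_deriv ?_
    have h1 := one_le_sqrt_one_add hs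
    field_simp
  · intro s hs
    have h1 := one_le_sqrt_one_add (show (0:ℝ) ≤ s from hs)
    exact ContinuousAt.continuousWithinAt (by fun_prop (disch := positivity))

lemma metFt_le (P : Profile x h u W) (hr : 0 ≤ r) :
    metFt h u r ≤ 9 / 2 - (1 + r) ^ 2 / 2 := by
  rcases eq_or_lt_of_le hr with rfl | hr
  · simp [metFt]; norm_num
  have hx := P.pos
  have hx' := P.le
  have h1 := abs_le.1 (P.coefK_bound hr).1
  have h2 := P.metF_le_two hr.le
  have h3 := one_le_metF (h := h) (u := u) hr.le
  rw [metFt_eq]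
  have h4 : x ^ 2 ≤ 1 / 2 := by nlinarith
  have h5 : -(2 * r * coefK h u r) ≤ r := by nlinarith
  have h6 : (1 - r ^ 2) * metF h u r ≤ 2 - r ^ 2 := by nlinarith [sq_nonneg r]
  nlinarith [sq_nonneg (r - 2)]

/-- The transport equation for `y`, integrated in the radial variable. -/
lemma integral_transport (P : Profile x h u W) {y y' a : ℝ → ℝ}
    (hy : ∀ r, HasDerivAt y (y' r) r) (hy' : Continuous y')
    (ha : ∀ r, 0 < r → a r - 2⁻¹ * metFt h u r * y' r =
      2 * coefG h u r * y r - coefJ h u r * devAvg h u r / r) (hr : 0 ≤ r) :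
    ∫ s in (0:ℝ)..r, a s = 2⁻¹ * metFt h u r * y r - 2⁻¹ * y 0 +
      ((∫ s in (0:ℝ)..r, coefG h u s * y s) -
        ∫ s in (0:ℝ)..r, coefJ h u s * devAvg h u s / s) := by
  have hyc : Continuous y := continuous_iff_continuousAt.2 fun r => (hy r).continuousAt
  have i1 := P.intervalIntegrable_coefG_mul hyc hr
  have i2 := P.intervalIntegrable_source hr
  have i3 : IntervalIntegrable (fun s => metFt h u s * y' s) volume 0 r := by
    refine ContinuousOn.intervalIntegrable ?_
    rw [uIcc_of_le hr]
    exact (P.continuousOn_metFt.mono fun s hs => hs.1).mul hy'.continuousOn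
  have hd : ∀ s, 2⁻¹ * (2 * coefG h u s * y s + metFt h u s * y' s) =
      coefG h u s * y s + 2⁻¹ * (metFt h u s * y' s) := fun s => by ring
  have h1 := intervalIntegral.integral_eq_sub_of_hasDerivAt_of_le
    (f := fun s => 2⁻¹ * (metFt h u s * y s))
    (f' := fun s => coefG h u s * y s + 2⁻¹ * (metFt h u s * y' s)) hr
    (continuousOn_const.mul ((P.continuousOn_metFt.mono fun s hs => hs.1).mul hyc.continuousOn))
    (fun s hs => (((P.hasDerivAt_metFt hs.1).mul (hy s)).const_mul 2⁻¹).congr_deriv (hd s))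
    (i1.add (i3.const_mul _))
  have h2 : ∫ s in (0:ℝ)..r, a s = ∫ s in (0:ℝ)..r,
      ((coefG h u s * y s + 2⁻¹ * (metFt h u s * y' s)) +
        (coefG h u s * y s - coefJ h u s * devAvg h u s / s)) := by
    refine intervalIntegral.integral_congr_ae (Eventually.of_forall fun s hs => ?_)
    rw [uIoc_of_le hr] at hs
    linarith [ha s hs.1]
  rw [h2, intervalIntegral.integral_add (i1.add (i3.const_mul _)) (i1.sub i2), h1,
    intervalIntegral.integral_sub i1 i2]
  have h0 : metFt h u 0 = 1 := by simp [metFt]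
  simp only [h0]
  ring

/-- Monotonicity of `coefG` makes the nonlocal term nonpositive at a maximum. -/
lemma integral_coefG_mul_deriv_nonpos (P : Profile x h u W) {y y' : ℝ → ℝ}
    (hy : ∀ s, 0 ≤ s → HasDerivAt y (y' s) s) (hy' : ContinuousOn y' (Ici 0)) (hr : 0 ≤ r)
    (hmax : ∀ s, 0 ≤ s → s ≤ r → y s ≤ y r) :
    ∫ s in (0:ℝ)..r, coefG h u s * y' s ≤ 0 := by
  have hyc : ContinuousOn y (Icc 0 r) := fun s hs => (hy s hs.1).continuousAt.continuousWithinAt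
  have hGc : ContinuousOn (coefG h u) (Icc 0 r) := P.continuousOn_coefG.mono fun s hs => hs.1
  have i1 : IntervalIntegrable (fun s => coefG h u s * y' s) volume 0 r := by
    refine ContinuousOn.intervalIntegrable ?_
    rw [uIcc_of_le hr]
    exact hGc.mul (hy'.mono fun s hs => hs.1)
  have i0 : IntervalIntegrable (fun s => (coefG h u s - coefJ h u s) / s) volume 0 r :=
    intervalIntegrable_zero_of_bounded
      ((P.continuousOn_coefG_pos.sub P.continuousOn_coefJ).div continuousOn_id
        fun _ hs => ne_of_gt hs) hr fun s hs _ => (P.coefG_deriv_bound hs).1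
  have i2 : IntervalIntegrable (fun s => (coefG h u s - coefJ h u s) / s * (y s - y r))
      volume 0 r := by
    refine i0.mul_continuousOn ?_
    rw [uIcc_of_le hr]
    exact hyc.sub continuousOn_const
  have h1 := intervalIntegral.integral_eq_sub_of_hasDerivAt_of_le
    (f := fun s => coefG h u s * (y s - y r)) hr (hGc.mul (hyc.sub continuousOn_const))
    (fun s hs => (P.hasDerivAt_coefG hs.1).mul ((hy s hs.1.le).sub_const (y r))) (i2.add i1)
  rw [intervalIntegral.integral_add i2 i1, sub_self, mul_zero, coefG_zero, zero_mul, sub_self] at h1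
  have h2 : 0 ≤ ∫ s in (0:ℝ)..r, (coefG h u s - coefJ h u s) / s * (y s - y r) := by
    refine intervalIntegral.integral_nonneg hr fun s hs => ?_
    rcases eq_or_lt_of_le hs.1 with rfl | h0
    · simp
    · exact mul_nonneg_of_nonpos_of_nonpos (P.coefG_deriv_bound h0).2
        (sub_nonpos.2 (hmax s hs.1 hs.2))
  linarith

end Profile
end Difference

section SmoothFamily

variable {w : ℝ → ℝ → ℝ}

lemma hasDerivAt_fst (hw : ContDiff ℝ 1 (Function.uncurry w)) (u r : ℝ) :
    HasDerivAt (fun t => w t r) (deriv (fun t => w t r) u) u :=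
  DifferentiableAt.hasDerivAt <|
    ((hw.differentiable one_ne_zero).comp
      (differentiable_id.prodMk (differentiable_const r))).differentiableAt

lemma hasDerivAt_snd (hw : ContDiff ℝ 1 (Function.uncurry w)) (u r : ℝ) :
    HasDerivAt (w u) (deriv (w u) r) r :=
  DifferentiableAt.hasDerivAt <|
    ((hw.differentiable one_ne_zero).comp
      ((differentiable_const u).prodMk differentiable_id)).differentiableAt

lemma continuous_deriv_fst (hw : ContDiff ℝ 1 (Function.uncurry w)) :
    Continuous (Function.uncurry fun u r => deriv (fun t => w t r) u) := by
  have h1 : Continuous fun p => fderiv ℝ (Function.uncurry w) p (1, 0) :=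
    (hw.continuous_fderiv one_ne_zero).clm_apply continuous_const
  refine h1.congr fun p => ?_
  have h2 := ((hw.differentiable one_ne_zero).differentiableAt (x := p)).hasFDerivAt
  have h3 : HasDerivAt (fun t => (t, p.2)) ((1:ℝ), (0:ℝ)) p.1 :=
    (hasDerivAt_id p.1).prodMk (hasDerivAt_const p.1 p.2)
  exact (HasDerivAt.deriv (h2.comp_hasDerivAt p.1 h3)).symm

lemma continuous_deriv_snd (hw : ContDiff ℝ 1 (Function.uncurry w)) (u : ℝ) :
    Continuous (deriv (w u)) :=
  (hw.comp (contDiff_const.prodMk contDiff_id : ContDiff ℝ 1 fun r : ℝ => (u, r))).continuous_deriv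
    le_rfl

lemma continuous_slice_snd (hw : ContDiff ℝ 1 (Function.uncurry w)) (u : ℝ) : Continuous (w u) :=
  hw.continuous.comp (continuous_const.prodMk continuous_id)

lemma continuous_uncurry_integral (hw : Continuous (Function.uncurry w)) :
    Continuous (Function.uncurry fun u r => ∫ s in (0:ℝ)..r, w u s) :=
  intervalIntegral.continuous_parametric_primitive_of_continuous hw

lemma hasDerivAt_integral_fst (hw : ContDiff ℝ 1 (Function.uncurry w)) (u r : ℝ) :
    HasDerivAt (fun t => ∫ s in (0:ℝ)..r, w t s)
      (∫ s in (0:ℝ)..r, deriv (fun t => w t s) u) u := by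
  have hc := continuous_deriv_fst hw
  obtain ⟨C, hC⟩ := ((isCompact_Icc (a := u - 1) (b := u + 1)).prod
    (isCompact_uIcc (a := (0:ℝ)) (b := r))).exists_bound_of_continuousOn hc.continuousOn
  refine (intervalIntegral.hasDerivAt_integral_of_dominated_loc_of_deriv_le
    (F' := fun t s => deriv (fun t => w t s) t) (bound := fun _ => C)
    (Icc_mem_nhds (by linarith : u - 1 < u) (by linarith : u < u + 1))
    (Eventually.of_forall fun t => (continuous_slice_snd hw t).aestronglyMeasurable)
    ((continuous_slice_snd hw u).intervalIntegrable _ _)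
    (Continuous.aestronglyMeasurable (hc.comp (continuous_const.prodMk continuous_id)))
    (ae_of_all _ fun s hs t ht => hC (t, s) ⟨ht, uIoc_subset_uIcc hs⟩)
    (continuous_const.intervalIntegrable _ _)
    (ae_of_all _ fun s _ t _ => hasDerivAt_fst hw t s)).2

end SmoothFamily

section UniformBound

namespace Profile

variable {x u r : ℝ} {h : ℝ → ℝ → ℝ} {W : ℝ → ℝ}

lemma metFt_nonpos_of_two_le (P : Profile x h u W) (hr : 2 ≤ r) : metFt h u r ≤ 0 := by
  have := P.metFt_le (by linarith : 0 ≤ r)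
  nlinarith

lemma metFt_nonneg_of_le_half (P : Profile x h u W) (hr : 0 < r) (hr' : r ≤ 1 / 2) :
    0 ≤ metFt h u r := by
  have h1 := (P.coefK_bound hr).1
  have h2 := P.le
  have h3 := P.pos
  have h4 : 1 ≤ metF h u r := one_le_metF hr.le
  rw [metFt_eq]
  have h5 := (abs_le.1 h1).2
  have h6 : x ^ 2 ≤ 1 / 1000000 := by nlinarith
  have h7 : 3 / 4 ≤ 1 - r ^ 2 := by nlinarith
  have h8 := mul_le_mul h7 h4 zero_le_one (by linarith)
  have h9 := mul_le_mul_of_nonneg_left (h5.trans h6) hr.le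
  linarith

lemma slope_barrier_neg (P : Profile x h u W) (hr : 0 < r) :
    2 * coefG h u r * (x * (1 / √(1 + r) ^ 3)) + 24 * x ^ 3 / √(1 + r) ^ 3 -
      3 / 4 * x * metFt h u r / √(1 + r) ^ 5 < 0 := by
  have hx := P.pos
  have hx' := P.le
  have h1 := one_le_sqrt_one_add hr.le
  have h2 := sq_sqrt_one_add hr
  have hf : 1 ≤ metF h u r := one_le_metF hr.le
  have hK := (abs_le.1 (P.coefK_bound hr).1).2
  have hx2 : x ^ 2 ≤ 1 / 1000000 := by nlinarith
  have key : (1 + r) * (2 * coefG h u r + 24 * x ^ 2) - 3 / 4 * metFt h u r < 0 := by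
    rw [coefG_eq, metFt_eq]
    have e1 : (3 / 4 + 5 / 4 * r) * 1 ≤ (3 / 4 + 5 / 4 * r) * metF h u r :=
      mul_le_mul_of_nonneg_left hf (by positivity)
    have e2 := mul_le_mul_of_nonneg_left hK (by positivity : 0 ≤ 2 * (1 + r) + 3 / 2 * r)
    have e3 := mul_le_mul_of_nonneg_left e1 (by positivity : 0 ≤ 1 + r)
    nlinarith [mul_le_mul_of_nonneg_left hx2 hr.le]
  have : 2 * coefG h u r * (x * (1 / √(1 + r) ^ 3)) + 24 * x ^ 3 / √(1 + r) ^ 3 -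
      3 / 4 * x * metFt h u r / √(1 + r) ^ 5 = x / √(1 + r) ^ 5 *
        (√(1 + r) ^ 2 * (2 * coefG h u r + 24 * x ^ 2) - 3 / 4 * metFt h u r) := by
    field_simp
  rw [this, h2]
  exact mul_neg_of_pos_of_neg (by positivity) key

lemma bound_of_transport {U : ℝ} {y V : ℝ → ℝ → ℝ} (hU : 0 ≤ U)
    (P : ∀ u ∈ Icc 0 U, Profile x h u (V u)) (hy : ContDiff ℝ 1 (Function.uncurry y))
    (h0 : ∀ r, 0 < r → |y 0 r| ≤ x / √(1 + r) ^ 3)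
    (hpde : ∀ u ∈ Icc 0 U, ∀ r, 0 < r →
      deriv (fun t => y t r) u - 2⁻¹ * metFt h u r * deriv (y u) r =
        2 * coefG h u r * y u r - coefJ h u r * devAvg h u r / r) :
    ∀ u ∈ Icc 0 U, ∀ r, 0 < r → |y u r| ≤ x / √(1 + r) ^ 3 := by
  have key : ∀ σ : ℝ, |σ| = 1 → ∀ u ∈ Icc 0 U, ∀ r, 0 < r → σ * y u r ≤ x / √(1 + r) ^ 3 := by
    intro σ hσ u hu r hr
    have ha : 0 < min r (1 / 2) := lt_min hr (by norm_num)
    have := nonpos_of_transport (Z := fun u r => σ * y u r - x * (1 / √(1 + r) ^ 3))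
      (Zu := fun u r => σ * deriv (fun t => y t r) u)
      (Zr := fun u r => σ * deriv (y u) r - x * (-(3 / (2 * √(1 + r) ^ 5))))
      (c := fun u r => -(2⁻¹ * metFt h u r)) (U := U) (a := min r (1 / 2)) (R := max r 2)
      hU ((min_le_left _ _).trans (le_max_left _ _)) ?_ ?_ ?_ ?_ ?_ ?_ ?_ u hu r
      ⟨min_le_left _ _, le_max_left _ _⟩
    · have e : x * (1 / √(1 + r) ^ 3) = x / √(1 + r) ^ 3 := by ring
      simp only [e] at this
      linarith
    · have hc := hy.continuous
      refine ContinuousOn.sub (continuousOn_const.mul hc.continuousOn) ?_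
      intro p hp
      have h1 := one_le_sqrt_one_add (ha.le.trans hp.2.1)
      refine ContinuousAt.continuousWithinAt ?_
      fun_prop (disch := positivity)
    · intro u _ s _
      exact ((hasDerivAt_fst hy u s).const_mul σ).sub_const _
    · intro u _ s hs
      exact ((hasDerivAt_snd hy u s).const_mul σ).sub
        ((hasDerivAt_inv_sqrt_one_add_cube (ha.le.trans hs.1)).const_mul x)
    · intro u hu
      have := (P u hu).metFt_nonneg_of_le_half ha (min_le_right _ _)
      linarith
    · intro u hu
      have := (P u hu).metFt_nonpos_of_two_le (le_max_right r 2)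
      linarith
    · intro s hs
      have h1 := h0 s (ha.trans_le hs.1)
      have h2 : σ * y 0 s ≤ |y 0 s| := (le_abs_self _).trans (by rw [abs_mul, hσ, one_mul])
      have e : x * (1 / √(1 + s) ^ 3) = x / √(1 + s) ^ 3 := by ring
      simp only [e]
      linarith
    · intro u hu s hs hpos _
      have hs0 := ha.trans_le hs.1
      have h1 := (P u hu).slope_barrier_neg hs0
      have h2 := (P u hu).source_bound hs0
      have h3 := hpde u hu s hs0
      have h4 : -(σ * (coefJ h u s * devAvg h u s / s)) ≤ |coefJ h u s * devAvg h u s / s| :=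
        (neg_le_abs _).trans (by rw [abs_mul, hσ, one_mul])
      have h5 := mul_le_mul_of_nonpos_left (sub_pos.1 hpos).le ((P u hu).coefG_nonpos hs0.le)
      have e : σ * deriv (fun t => y t s) u + -(2⁻¹ * metFt h u s) *
          (σ * deriv (y u) s - x * (-(3 / (2 * √(1 + s) ^ 5)))) =
          σ * (deriv (fun t => y t s) u - 2⁻¹ * metFt h u s * deriv (y u) s) -
            3 / 4 * x * metFt h u s / √(1 + s) ^ 5 := by
        have := one_le_sqrt_one_add hs0.le
        field_simp
        ring
      simp only [e, h3]
      linarith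
  intro u hu r hr
  refine abs_le.2 ⟨?_, ?_⟩
  · linarith [key (-1) (by norm_num) u hu r hr]
  · linarith [key 1 (by norm_num) u hu r hr]

end Profile
end UniformBound

section Contraction

namespace Profile

variable {x U B : ℝ} {h₁ h₂ y₁ y₂ y₃ : ℝ → ℝ → ℝ}

lemma integral_sub_transport_bound {u r : ℝ} (P₁ : Profile x h₁ u (y₁ u))
    (P₂ : Profile x h₂ u (y₂ u))
    (hy₁ : ContDiff ℝ 1 (Function.uncurry y₁)) (hy₃ : ContDiff ℝ 1 (Function.uncurry y₃))
    (hp₃ : ∀ r, 0 < r → deriv (fun t => y₃ t r) u - 2⁻¹ * metFt h₁ u r * deriv (y₃ u) r =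
      2 * coefG h₁ u r * y₃ u r - coefJ h₁ u r * devAvg h₁ u r / r)
    (hp₁ : ∀ r, 0 < r → deriv (fun t => y₁ t r) u - 2⁻¹ * metFt h₂ u r * deriv (y₁ u) r =
      2 * coefG h₂ u r * y₁ u r - coefJ h₂ u r * devAvg h₂ u r / r)
    (hB0 : 0 ≤ B) (hB : ∀ r, 0 ≤ r → |h₁ u r - h₂ u r| ≤ B) (hr : 0 ≤ r) :
    |(∫ s in (0:ℝ)..r, deriv (fun t => y₃ t s - y₁ t s) u) + 2⁻¹ * (y₃ u 0 - y₁ u 0) -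
      2⁻¹ * metFt h₁ u r * (y₃ u r - y₁ u r) -
        ∫ s in (0:ℝ)..r, coefG h₁ u s * (y₃ u s - y₁ u s)| ≤ 200 * x ^ 2 * B * √(1 + r) := by
  rcases hr.eq_or_lt with rfl | hr'
  · have h0 : metFt h₁ u 0 = 1 := by simp [metFt]
    rw [intervalIntegral.integral_same, intervalIntegral.integral_same, h0]
    have : (0:ℝ) ≤ 200 * x ^ 2 * B * √(1 + 0) := by positivity
    refine le_trans (le_of_eq ?_) this
    rw [abs_eq_zero]
    ring
  have hd : (∫ s in (0:ℝ)..r, deriv (fun t => y₃ t s - y₁ t s) u) =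
      (∫ s in (0:ℝ)..r, deriv (fun t => y₃ t s) u) - ∫ s in (0:ℝ)..r, deriv (fun t => y₁ t s) u := by
    have i : ∀ {y : ℝ → ℝ → ℝ}, ContDiff ℝ 1 (Function.uncurry y) →
        IntervalIntegrable (fun s => deriv (fun t => y t s) u) volume 0 r := fun hy =>
      Continuous.intervalIntegrable
        ((continuous_deriv_fst hy).comp (continuous_const.prodMk continuous_id)) _ _
    rw [← intervalIntegral.integral_sub (i hy₃) (i hy₁)]
    exact intervalIntegral.integral_congr fun s _ =>
      ((hasDerivAt_fst hy₃ u s).sub (hasDerivAt_fst hy₁ u s)).deriv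
  have t₃ := P₁.integral_transport (hasDerivAt_snd hy₃ u) (continuous_deriv_snd hy₃ u) hp₃ hr
  have t₁ := P₂.integral_transport (hasDerivAt_snd hy₁ u) (continuous_deriv_snd hy₁ u) hp₁ hr
  have c₁ := continuous_slice_snd hy₁ u
  have c₃ := continuous_slice_snd hy₃ u
  have e₁ : (∫ s in (0:ℝ)..r, coefG h₁ u s * (y₃ u s - y₁ u s)) =
      (∫ s in (0:ℝ)..r, coefG h₁ u s * y₃ u s) - ∫ s in (0:ℝ)..r, coefG h₁ u s * y₁ u s := by
    rw [← intervalIntegral.integral_sub (P₁.intervalIntegrable_coefG_mul c₃ hr)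
      (P₁.intervalIntegrable_coefG_mul c₁ hr)]
    exact intervalIntegral.integral_congr fun s _ => mul_sub _ _ _
  have e₂ : (∫ s in (0:ℝ)..r, ((coefG h₁ u s - coefG h₂ u s) * y₁ u s -
      (coefJ h₁ u s * devAvg h₁ u s / s - coefJ h₂ u s * devAvg h₂ u s / s))) =
      ((∫ s in (0:ℝ)..r, coefG h₁ u s * y₁ u s) - ∫ s in (0:ℝ)..r, coefG h₂ u s * y₁ u s) -
      ((∫ s in (0:ℝ)..r, coefJ h₁ u s * devAvg h₁ u s / s) -
        ∫ s in (0:ℝ)..r, coefJ h₂ u s * devAvg h₂ u s / s) := by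
    have j₁ := P₁.intervalIntegrable_coefG_mul c₁ hr
    have j₂ := P₂.intervalIntegrable_coefG_mul c₁ hr
    have j₃ := P₁.intervalIntegrable_source hr
    have j₄ := P₂.intervalIntegrable_source hr
    rw [← intervalIntegral.integral_sub j₁ j₂, ← intervalIntegral.integral_sub j₃ j₄,
      ← intervalIntegral.integral_sub (j₁.sub j₂) (j₃.sub j₄)]
    simp only [sub_mul]
  have b₂ := integral_source_sub_bound P₁ P₂ hB0 hB hr'
  have b₁ : |2⁻¹ * (metFt h₁ u r - metFt h₂ u r) * y₁ u r| ≤ 11 * x ^ 2 * B * √(1 + r) := by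
    have hx := P₁.pos
    have h1 := one_le_sqrt_one_add hr
    have h2 := sq_sqrt_one_add hr'
    rw [abs_mul, abs_mul, abs_of_pos (by norm_num : (0:ℝ) < 2⁻¹)]
    refine (mul_le_mul (mul_le_mul_of_nonneg_left (metFt_sub_bound P₁ P₂ hB0 hB hr') (by norm_num))
      (P₁.bound r hr') (abs_nonneg _) (by positivity)).trans (le_of_eq ?_)
    generalize √(1 + r) = q at h1 h2 ⊢
    rw [← h2]
    field_simp
    ring
  rw [e₂] at b₂
  have hfin := (abs_add_le _ _).trans (add_le_add b₁ b₂)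
  have hle : 11 * x ^ 2 * B * √(1 + r) + 178 * x ^ 2 * B * √(1 + r) ≤
      200 * x ^ 2 * B * √(1 + r) := by
    have : 0 ≤ x ^ 2 * B * √(1 + r) := by positivity
    linarith
  refine le_trans (le_of_eq ?_) (hfin.trans hle)
  congr 1
  rw [hd, t₃, t₁, e₁]
  ring

lemma barrier_transport {h : ℝ → ℝ → ℝ} {W : ℝ → ℝ} {u r : ℝ} (P : Profile x h u W)
    (hr : 0 ≤ r) : √(1 + r) / 8 < 2 - 2⁻¹ * metFt h u r * (1 / (2 * √(1 + r) ^ 3)) := by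
  have h1 := one_le_sqrt_one_add hr
  have h2 : √(1 + r) ^ 2 = 1 + r := Real.sq_sqrt (by linarith)
  have h3 := P.metFt_le hr
  rw [← h2] at h3
  set q := √(1 + r)
  have h4 : 2⁻¹ * metFt h u r * (1 / (2 * q ^ 3)) ≤ 9 / 8 - q / 8 := by
    have h5 : 2⁻¹ * metFt h u r * (1 / (2 * q ^ 3)) ≤
        2⁻¹ * (9 / 2 - (q ^ 2) ^ 2 / 2) * (1 / (2 * q ^ 3)) := by gcongr
    have h6 : 2⁻¹ * (9 / 2 - (q ^ 2) ^ 2 / 2) * (1 / (2 * q ^ 3)) =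
        9 / 8 * (1 / q ^ 3) - q / 8 := by
      field_simp
      ring
    have h7 : 1 / q ^ 3 ≤ 1 := by
      rw [div_le_one (by positivity)]
      exact one_le_pow₀ h1
    linarith
  linarith

lemma abs_integral_sub_le (hU : 0 ≤ U) (hU1 : U ≤ 1)
    (P₁ : ∀ u ∈ Icc 0 U, Profile x h₁ u (y₁ u)) (P₂ : ∀ u ∈ Icc 0 U, Profile x h₂ u (y₂ u))
    (hy₁ : ContDiff ℝ 1 (Function.uncurry y₁)) (hy₃ : ContDiff ℝ 1 (Function.uncurry y₃))
    (hp₃ : ∀ u ∈ Icc 0 U, ∀ r, 0 < r →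
      deriv (fun t => y₃ t r) u - 2⁻¹ * metFt h₁ u r * deriv (y₃ u) r =
        2 * coefG h₁ u r * y₃ u r - coefJ h₁ u r * devAvg h₁ u r / r)
    (hp₁ : ∀ u ∈ Icc 0 U, ∀ r, 0 < r →
      deriv (fun t => y₁ t r) u - 2⁻¹ * metFt h₂ u r * deriv (y₁ u) r =
        2 * coefG h₂ u r * y₁ u r - coefJ h₂ u r * devAvg h₂ u r / r)
    (h0 : ∀ r, 0 ≤ r → y₃ 0 r = y₁ 0 r) (hB0 : 0 < B)
    (hB : ∀ u ∈ Icc 0 U, ∀ r, 0 ≤ r → |h₁ u r - h₂ u r| ≤ B) :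
    ∀ u ∈ Icc 0 U, ∀ r, 0 ≤ r → |∫ s in (0:ℝ)..r, (y₃ u s - y₁ u s)| ≤ 2⁻¹ * B := by
  have hx := (P₁ 0 ⟨le_rfl, hU⟩).pos
  have hx' := (P₁ 0 ⟨le_rfl, hU⟩).le
  have hω : ContDiff ℝ 1 (Function.uncurry fun u s => y₃ u s - y₁ u s) := hy₃.sub hy₁
  have hω0 : Continuous fun t => y₃ t 0 - y₁ t 0 :=
    hω.continuous.comp (continuous_id.prodMk continuous_const)
  have hωs : ∀ u, Continuous fun s => y₃ u s - y₁ u s := continuous_slice_snd hω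
  set k : ℝ := 1601 * x ^ 2 * B with hk
  have hk0 : 0 < k := by positivity
  set E : ℝ → ℝ → ℝ := fun u r =>
    (∫ s in (0:ℝ)..r, (y₃ u s - y₁ u s)) + 2⁻¹ * ∫ t in (0:ℝ)..u, (y₃ t 0 - y₁ t 0) with hE
  have key : ∀ σ : ℝ, |σ| = 1 → ∀ u ∈ Icc 0 U, ∀ r, 0 ≤ r → σ * E u r ≤ 3 * k := by
    intro σ hσ u hu r hr
    have hR : (0:ℝ) ≤ max r 2 := hr.trans (le_max_left _ _)
    have hZ : ∀ v s : ℝ, 0 ≤ s →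
        HasDerivAt (fun s => σ * E v s - k * (2 * v + 1 - 1 / √(1 + s)))
          (σ * (y₃ v s - y₁ v s) - k * (1 / (2 * √(1 + s) ^ 3))) s := by
      intro v s hs
      have d1 : HasDerivAt (E v) (y₃ v s - y₁ v s) s :=
        ((hωs v).integral_hasStrictDerivAt 0 s).hasDerivAt.add_const _
      have d2 := ((hasDerivAt_inv_sqrt_one_add hs).const_sub (2 * v + 1)).const_mul k
      exact ((d1.const_mul σ).sub d2).congr_deriv (by ring)
    have := nonpos_of_transport
      (Z := fun u r => σ * E u r - k * (2 * u + 1 - 1 / √(1 + r)))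
      (Zu := fun u r => σ * ((∫ s in (0:ℝ)..r, deriv (fun t => y₃ t s - y₁ t s) u) +
        2⁻¹ * (y₃ u 0 - y₁ u 0)) - k * 2)
      (Zr := fun u r => σ * (y₃ u r - y₁ u r) - k * (1 / (2 * √(1 + r) ^ 3)))
      (c := fun u r => -(2⁻¹ * metFt h₁ u r)) (U := U) (a := 0) (R := max r 2)
      hU hR ?_ ?_ ?_ ?_ ?_ ?_ ?_ u hu r ⟨hr, le_max_left _ _⟩
    · have h1 : 0 ≤ 1 / √(1 + r) := by positivity
      have h2 := hu.2
      nlinarith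
    · have c1 := continuous_uncurry_integral hω.continuous
      have c2 : Continuous fun u => ∫ t in (0:ℝ)..u, (y₃ t 0 - y₁ t 0) :=
        intervalIntegral.continuous_primitive (fun a b => hω0.intervalIntegrable a b) 0
      have c3 : Continuous (Function.uncurry E) :=
        c1.add (continuous_const.mul (c2.comp continuous_fst))
      refine ContinuousOn.sub (continuousOn_const.mul c3.continuousOn) ?_
      intro p hp
      have h1 := one_le_sqrt_one_add hp.2.1
      refine ContinuousAt.continuousWithinAt ?_
      fun_prop (disch := positivity)
    · intro v _ s _
      have d1 := hasDerivAt_integral_fst hω v s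
      have d2 := (hω0.integral_hasStrictDerivAt 0 v).hasDerivAt.const_mul 2⁻¹
      have d3 : HasDerivAt (fun t : ℝ => k * (2 * t + 1 - 1 / √(1 + s))) (k * (2 * 1)) v :=
        ((((hasDerivAt_id v).const_mul 2).add_const 1).sub_const _).const_mul k
      exact (((d1.add d2).const_mul σ).sub d3).congr_deriv (by ring)
    · intro v _ s hs
      exact hZ v s hs.1
    · intro v _
      simp [metFt]
    · intro v hv
      have := (P₁ v hv).metFt_nonpos_of_two_le (le_max_right r 2)
      linarith
    · intro s hs
      have h1 := one_le_sqrt_one_add hs.1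
      have h2 : E 0 s = 0 := by
        simp only [hE, intervalIntegral.integral_same, mul_zero, add_zero]
        refine (intervalIntegral.integral_congr (g := fun _ => 0) fun t ht => ?_).trans (by simp)
        rw [uIcc_of_le hs.1] at ht
        simp [h0 t ht.1]
      have h3 : 1 / √(1 + s) ≤ 1 := by
        rw [div_le_one (by positivity)]
        exact h1
      simp only [h2]
      nlinarith
    · intro v hv s hs _ hmax
      have P := P₁ v hv
      have hb := integral_sub_transport_bound P (P₂ v hv) hy₁ hy₃ (hp₃ v hv) (hp₁ v hv) hB0.le
        (hB v hv) hs.1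
      have hβ := P.barrier_transport hs.1
      have hc : ContinuousOn (fun r => σ * (y₃ v r - y₁ v r) - k * (1 / (2 * √(1 + r) ^ 3)))
          (Ici 0) := by
        refine ContinuousOn.sub (continuousOn_const.mul (hωs v).continuousOn) ?_
        intro t ht
        have h1 := one_le_sqrt_one_add (show (0:ℝ) ≤ t from ht)
        refine ContinuousAt.continuousWithinAt ?_
        fun_prop (disch := positivity)
      have hI₁ := P.integral_coefG_mul_deriv_nonpos (hZ v) hc hs.1
        fun t ht0 hts => hmax t ⟨ht0, hts.trans hs.2⟩
      have hI₂ : (∫ t in (0:ℝ)..s, coefG h₁ v t * (σ * (y₃ v t - y₁ v t))) ≤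
          ∫ t in (0:ℝ)..s, coefG h₁ v t *
            (σ * (y₃ v t - y₁ v t) - k * (1 / (2 * √(1 + t) ^ 3))) := by
        refine intervalIntegral.integral_mono_on hs.1
          (P.intervalIntegrable_coefG_mul (continuous_const.mul (hωs v)) hs.1)
          (ContinuousOn.intervalIntegrable ((P.continuousOn_coefG.mul hc).mono ?_)) fun t ht => ?_
        · rw [uIcc_of_le hs.1]
          exact Icc_subset_Ici_self
        · refine mul_le_mul_of_nonpos_left ?_ (P.coefG_nonpos ht.1)
          have : 0 ≤ k * (1 / (2 * √(1 + t) ^ 3)) := by positivity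
          linarith
      have hI₃ : (∫ t in (0:ℝ)..s, coefG h₁ v t * (σ * (y₃ v t - y₁ v t))) =
          σ * ∫ t in (0:ℝ)..s, coefG h₁ v t * (y₃ v t - y₁ v t) := by
        rw [← intervalIntegral.integral_const_mul]
        exact intervalIntegral.integral_congr fun t _ => mul_left_comm _ _ _
      have hσb : ∀ a : ℝ, σ * a ≤ |a| := fun a =>
        (le_abs_self _).trans (by rw [abs_mul, hσ, one_mul])
      have hb' := (hσb _).trans hb
      have h5 := mul_lt_mul_of_pos_left hβ hk0
      have h6 : 200 * x ^ 2 * B * √(1 + s) ≤ k * (√(1 + s) / 8) := by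
        have : 0 ≤ x ^ 2 * B * √(1 + s) := by positivity
        rw [hk]
        linarith
      linarith
  have key2 : ∀ u ∈ Icc 0 U, ∀ r, 0 ≤ r → |E u r| ≤ 3 * k := fun u hu r hr =>
    abs_le.2 ⟨by linarith [key (-1) (by norm_num) u hu r hr],
      by linarith [key 1 (by norm_num) u hu r hr]⟩
  intro u hu r hr
  have e : (∫ s in (0:ℝ)..r, (y₃ u s - y₁ u s)) = E u r - E u 0 := by simp [hE]
  rw [e]
  refine (abs_sub _ _).trans ?_
  have hx2 : x ^ 2 ≤ 1 / 1000000 := by nlinarith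
  have := key2 u hu r hr
  have := key2 u hu 0 le_rfl
  have : k ≤ 1601 * (1 / 1000000) * B := by rw [hk]; gcongr
  linarith

end Profile
end Contraction

section Iteration

variable {δ U : ℝ} {h₀ : ℝ → ℝ} {hU : ℝ → ℝ → ℝ} {w h : ℕ → ℝ → ℝ → ℝ}

lemma abs_le_of_wnorm_le {v : ℝ → ℝ} {x r : ℝ} (hδ : δ ≤ 1 / 2)
    (hb : BddAbove (range fun r : Ici (0:ℝ) => (1 + r.1) ^ (2 - δ) * |v r.1|))
    (hv : wnorm (2 - δ) v ≤ x) (hr : 0 ≤ r) : |v r| ≤ x / √(1 + r) ^ 3 := by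
  have h1 : (1 + r) ^ (2 - δ) * |v r| ≤ x := (le_ciSup hb ⟨r, hr⟩).trans hv
  have h2 := one_le_sqrt_one_add hr
  have h3 : √(1 + r) ^ 3 ≤ (1 + r) ^ (2 - δ) := by
    rw [Real.sqrt_eq_rpow, ← Real.rpow_natCast, ← Real.rpow_mul (by linarith)]
    exact Real.rpow_le_rpow_of_exponent_le (by linarith) (by norm_num; linarith)
  rw [le_div_iff₀ (by positivity), mul_comm]
  exact (mul_le_mul_of_nonneg_right h3 (abs_nonneg _)).trans h1

lemma IterSetup.profile (S : IterSetup δ U h₀ hU w h) (hδ : δ ≤ 1 / 2) (hU0 : 0 ≤ U)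
    (hv : wnorm (2 - δ) (deriv h₀) ≤ 1 / 1000) (n : ℕ) (hn : 1 ≤ n) :
    ∀ u ∈ Icc 0 U, Profile (1 / 1000) (h n) u (w n u) := by
  obtain ⟨-, -, hb, -, -, -, -, hw1, hwC, hh, hw0, hpde⟩ := S
  have hb0 : ∀ r, 0 ≤ r → |deriv h₀ r| ≤ 1 / 1000 / √(1 + r) ^ 3 := fun r hr =>
    abs_le_of_wnorm_le hδ hb hv hr
  have mk : ∀ n, 1 ≤ n → ∀ u, (∀ r, 0 < r → |w n u r| ≤ 1 / 1000 / √(1 + r) ^ 3) →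
      Profile (1 / 1000) (h n) u (w n u) := fun n hn u hbd =>
    ⟨by norm_num, le_rfl, continuous_slice_snd (hwC n hn) u, ⟨hU u 0, hh n hn u⟩, hbd⟩
  induction n, hn using Nat.le_induction with
  | base =>
    intro u _
    refine mk 1 le_rfl u fun r hr => ?_
    rw [hw1]
    exact hb0 r hr.le
  | succ n hn ih =>
    intro u hu
    refine mk (n + 1) (by omega) u fun r hr => ?_
    refine Profile.bound_of_transport hU0 ih (hwC (n + 1) (by omega)) (fun r hr => ?_)
      (hpde n hn) u hu r hr
    rw [hw0 n hn r hr.le]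
    exact hb0 r hr.le

end Iteration

theorem iteration_contracts (δ : ℝ) (hδ₁ : 0 < δ) (hδ₂ : δ < 1/2) :
    ∃ x₀' > (0:ℝ), ∃ U₀ > (0:ℝ), ∀ U : ℝ, 0 < U → U ≤ U₀ →
      ∀ (h₀ : ℝ → ℝ) (hU : ℝ → ℝ → ℝ) (w h : ℕ → ℝ → ℝ → ℝ),
        IterSetup δ U h₀ hU w h →
        wnorm (2 - δ) (deriv h₀) ≤ x₀' →
        ∃ κ : ℝ, 0 ≤ κ ∧ κ < 1 ∧
          ∀ n : ℕ, 2 ≤ n → ∀ B : ℝ, 0 ≤ B →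
            (∀ u ∈ Icc (0:ℝ) U, ∀ r : ℝ, 0 ≤ r → |h n u r - h (n - 1) u r| ≤ B) →
            ∀ u ∈ Icc (0:ℝ) U, ∀ r : ℝ, 0 ≤ r →
              |h (n + 1) u r - h n u r| ≤ κ * B := by
  refine ⟨1 / 1000, by norm_num, 1, one_pos, fun U hU0 hU1 h₀ hU w h S hv =>
    ⟨2⁻¹, by norm_num, by norm_num, fun n hn B hB0 hB u hu r hr => ?_⟩⟩
  have hP := S.profile hδ₂.le hU0.le hv
  obtain ⟨-, -, -, -, -, -, -, -, hwC, hh, hw0, hpde⟩ := S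
  obtain ⟨m, rfl⟩ : ∃ m, n = m + 1 := ⟨n - 1, by omega⟩
  have hm : 1 ≤ m := by omega
  rw [Nat.add_sub_cancel] at hB
  have hm1 : 1 ≤ m + 1 := by omega
  have hm2 : 1 ≤ m + 1 + 1 := by omega
  have e : h (m + 1 + 1) u r - h (m + 1) u r =
      ∫ s in (0:ℝ)..r, (w (m + 1 + 1) u s - w (m + 1) u s) := by
    rw [hh _ hm2, hh _ hm1, intervalIntegral.integral_sub
      ((continuous_slice_snd (hwC _ hm2) u).intervalIntegrable _ _)
      ((continuous_slice_snd (hwC _ hm1) u).intervalIntegrable _ _)]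
    ring
  rw [e]
  have key : ∀ ε > 0, |∫ s in (0:ℝ)..r, (w (m + 1 + 1) u s - w (m + 1) u s)| ≤
      2⁻¹ * B + ε := by
    intro ε hε
    have := Profile.abs_integral_sub_le (B := B + ε) hU0.le hU1 (hP _ hm1) (hP _ hm)
      (hwC _ hm1) (hwC _ hm2) (hpde _ hm1) (hpde _ hm)
      (fun s hs => (hw0 _ hm1 s hs).trans (hw0 _ hm s hs).symm) (by linarith)
      (fun v hv s hs => (hB v hv s hs).trans (by linarith)) u hu r hr
    linarith
  exact le_of_forall_pos_le_add key
end

section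
/- Uniqueness for the coupled system: given h_U ∈ C¹([0,1]×[0,1]) and h₀ ∈ C²([0,1]) with ‖h₀'‖_{L^∞} sufficiently small, there exists 0<U≤1 such that the initial value problem consisting of the two equations Dh(u,r) = G[h](h-h̄)(u,r) + (1/2)(∂_r h_U(u,0) - ∂_r h(u,0)) and D∂_r h = 2G[h]∂_r h - J[h](h-h̄)/r on [0,U]×[0,U], with initial conditions h(0,r)=h₀(r) and ∂_r h(0,r)=h₀'(r), admits at most one solution h ∈ C¹([0,U]×[0,U]) whose second radial derivative ∂²_r h exists and is continuous. -/
open Set MeasureTheory Real Filter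

/-- `h` is a `C¹` solution, with existing continuous second radial derivative, of the
coupled system `Dh = G[h](h-h̄) + (1/2)(∂_r h_U(u,0) - ∂_r h(u,0))` and
`D ∂_r h = 2 G[h] ∂_r h - J[h](h-h̄)/r` on `[0,U]×[0,U]`, with initial data
`h(0,·) = h₀` and `∂_r h(0,·) = h₀'`. -/
def IsCoupledSol (U : ℝ) (hU : ℝ → ℝ → ℝ) (h₀ : ℝ → ℝ) (h : ℝ → ℝ → ℝ) : Prop :=
  ContDiff ℝ 1 (Function.uncurry h) ∧
  (∀ u : ℝ, Differentiable ℝ (deriv (h u))) ∧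
  Continuous (fun p : ℝ × ℝ => deriv (deriv (h p.1)) p.2) ∧
  (∀ u ∈ Icc (0:ℝ) U, ∀ r ∈ Icc (0:ℝ) U,
    deriv (fun u' => h u' r) u - 2⁻¹ * metFt h u r * deriv (h u) r =
      coefG h u r * (h u r - radAvg (h u) r) +
        2⁻¹ * (deriv (hU u) 0 - deriv (h u) 0)) ∧
  (∀ u ∈ Icc (0:ℝ) U, ∀ r ∈ Ioc (0:ℝ) U,
    deriv (fun u' => deriv (h u') r) u - 2⁻¹ * metFt h u r * deriv (deriv (h u)) r =
      2 * coefG h u r * deriv (h u) r -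
        coefJ h u r * (h u r - radAvg (h u) r) / r) ∧
  (∀ r ∈ Icc (0:ℝ) U, h 0 r = h₀ r) ∧
  (∀ r ∈ Icc (0:ℝ) U, deriv (h 0) r = deriv h₀ r)

/-- The weighted radial average `∫₀¹ tⁿ a(u, rt) dt`. -/
noncomputable def avgPow (n : ℕ) (a : ℝ → ℝ → ℝ) (u r : ℝ) : ℝ :=
  ∫ t in (0:ℝ)..1, t ^ n * a u (r * t)

/-- `(h - h̄) / r` in terms of `q = ∂_r h`. -/
noncomputable def oscQuot (q : ℝ → ℝ → ℝ) : ℝ → ℝ → ℝ := avgPow 1 q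

/-- The metric coefficient `f` in terms of `q = ∂_r h`. -/
noncomputable def slopeF (q : ℝ → ℝ → ℝ) (u r : ℝ) : ℝ :=
  Real.exp (2⁻¹ * (r * avgPow 0 (fun u s => s * oscQuot q u s ^ 2) u r))

/-- The integrand `(1 - 3r²) f` of `f̃`, in terms of `q = ∂_r h`. -/
noncomputable def slopePhi (q : ℝ → ℝ → ℝ) (u r : ℝ) : ℝ :=
  (1 - 3 * r ^ 2) * slopeF q u r

/-- The radial derivative of `slopePhi q`. -/
noncomputable def slopePhiDeriv (q : ℝ → ℝ → ℝ) (u r : ℝ) : ℝ :=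
  (-6 * r + (1 - 3 * r ^ 2) * (2⁻¹ * (r * oscQuot q u r ^ 2))) * slopeF q u r

/-- The metric coefficient `f̃` in terms of `q = ∂_r h`. -/
noncomputable def slopeFt (q : ℝ → ℝ → ℝ) : ℝ → ℝ → ℝ := avgPow 0 (slopePhi q)

/-- The coefficient `G` in terms of `q = ∂_r h`. -/
noncomputable def slopeG (q : ℝ → ℝ → ℝ) (u r : ℝ) : ℝ :=
  2⁻¹ * avgPow 1 (slopePhiDeriv q) u r

/-- The zeroth order term in the transport equation for `q = ∂_r h`. -/
noncomputable def slopeSource (q : ℝ → ℝ → ℝ) (u r : ℝ) : ℝ :=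
  2 * (slopeG q u r * q u r) +
    (2⁻¹ * slopePhiDeriv q u r - 3 * slopeG q u r) * oscQuot q u r

/-- The part of `∂_u h` that is determined by `q = ∂_r h`. -/
noncomputable def slopeRate (q : ℝ → ℝ → ℝ) (u r : ℝ) : ℝ :=
  2⁻¹ * (slopeFt q u r * q u r) + slopeG q u r * (r * oscQuot q u r) - 2⁻¹ * q u 0

/-- The rate `∂_u q` of `q = ∂_r h`, in terms of `q` and `q₁ = ∂_r q`. -/
noncomputable def slopeTransport (q q₁ : ℝ → ℝ → ℝ) (u r : ℝ) : ℝ :=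
  2⁻¹ * slopeFt q u r * q₁ u r + slopeSource q u r

/-! ### Joint continuity -/

lemma continuous_avgPow (n : ℕ) {a : ℝ → ℝ → ℝ} (ha : Continuous (Function.uncurry a)) :
    Continuous (Function.uncurry (avgPow n a)) := by
  have h : Continuous (Function.uncurry
      (fun (p : ℝ × ℝ) (t : ℝ) => t ^ n * a p.1 (p.2 * t))) := by
    have h2 : Continuous (fun x : (ℝ × ℝ) × ℝ => Function.uncurry a (x.1.1, x.1.2 * x.2)) :=
      ha.comp (by fun_prop)
    exact (continuous_snd.pow n).mul h2
  exact intervalIntegral.continuous_parametric_intervalIntegral_of_continuous' h 0 1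

variable {q : ℝ → ℝ → ℝ}

lemma continuous_oscQuot (hq : Continuous (Function.uncurry q)) :
    Continuous (Function.uncurry (oscQuot q)) := continuous_avgPow 1 hq

lemma continuous_slopeF (hq : Continuous (Function.uncurry q)) :
    Continuous (Function.uncurry (slopeF q)) := by
  have h1 : Continuous (Function.uncurry (fun u s => s * oscQuot q u s ^ 2)) :=
    continuous_snd.mul ((continuous_oscQuot hq).pow 2)
  exact (continuous_const.mul (continuous_snd.mul (continuous_avgPow 0 h1))).rexp

lemma continuous_slopePhi (hq : Continuous (Function.uncurry q)) :
    Continuous (Function.uncurry (slopePhi q)) :=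
  Continuous.mul (by fun_prop) (continuous_slopeF hq)

lemma continuous_slopePhiDeriv (hq : Continuous (Function.uncurry q)) :
    Continuous (Function.uncurry (slopePhiDeriv q)) := by
  refine Continuous.mul (Continuous.add (by fun_prop) (Continuous.mul (by fun_prop) ?_))
    (continuous_slopeF hq)
  exact continuous_const.mul (continuous_snd.mul ((continuous_oscQuot hq).pow 2))

lemma continuous_slopeFt (hq : Continuous (Function.uncurry q)) :
    Continuous (Function.uncurry (slopeFt q)) := continuous_avgPow 0 (continuous_slopePhi hq)

lemma continuous_slopeG (hq : Continuous (Function.uncurry q)) :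
    Continuous (Function.uncurry (slopeG q)) :=
  continuous_const.mul (continuous_avgPow 1 (continuous_slopePhiDeriv hq))

lemma continuous_slopeSource (hq : Continuous (Function.uncurry q)) :
    Continuous (Function.uncurry (slopeSource q)) := by
  have hG := continuous_slopeG hq
  exact (continuous_const.mul (hG.mul hq)).add
    (((continuous_const.mul (continuous_slopePhiDeriv hq)).sub
      (continuous_const.mul hG)).mul (continuous_oscQuot hq))

lemma continuous_slopeTransport {q₁ : ℝ → ℝ → ℝ} (hq : Continuous (Function.uncurry q))
    (hq₁ : Continuous (Function.uncurry q₁)) :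
    Continuous (Function.uncurry (slopeTransport q q₁)) :=
  ((continuous_const.mul (continuous_slopeFt hq)).mul hq₁).add (continuous_slopeSource hq)

lemma continuous_slopeRate (hq : Continuous (Function.uncurry q)) :
    Continuous (Function.uncurry (slopeRate q)) := by
  have h0 : Continuous (fun p : ℝ × ℝ => q p.1 0) :=
    hq.comp (continuous_fst.prodMk continuous_const)
  exact ((continuous_const.mul ((continuous_slopeFt hq).mul hq)).add
    ((continuous_slopeG hq).mul (continuous_snd.mul (continuous_oscQuot hq)))).sub
    (continuous_const.mul h0)

/-! ### Averages and their radial derivatives -/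

lemma continuous_slice_fst {a : ℝ → ℝ → ℝ} (ha : Continuous (Function.uncurry a)) (r : ℝ) :
    Continuous fun u => a u r := ha.comp (continuous_id.prodMk continuous_const)

lemma continuous_slice {a : ℝ → ℝ → ℝ} (ha : Continuous (Function.uncurry a)) (u : ℝ) :
    Continuous (a u) := ha.comp (continuous_const.prodMk continuous_id)

lemma mul_avgPow_zero (a : ℝ → ℝ → ℝ) (u r : ℝ) :
    r * avgPow 0 a u r = ∫ s in (0:ℝ)..r, a u s := by
  simp only [avgPow, pow_zero, one_mul]
  simp

lemma avgPow_zero_eq_radAvg (a : ℝ → ℝ → ℝ) (u r : ℝ) :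
    avgPow 0 a u r = radAvg (a u) r := by
  unfold radAvg
  split_ifs with hr
  · simp [avgPow, hr]
  · rw [← mul_avgPow_zero, mul_div_cancel_left₀ _ hr]

lemma sub_avgPow_zero {w w' : ℝ → ℝ → ℝ} {u : ℝ} (hw : ∀ r, HasDerivAt (w u) (w' u r) r)
    (hw' : Continuous (w' u)) (r : ℝ) :
    w u r - avgPow 0 w u r = r * avgPow 1 w' u r := by
  have hc : Continuous (w u) := continuous_iff_continuousAt.2 fun r => (hw r).continuousAt
  have h1 : Continuous (fun t => w u (r * t)) := by fun_prop
  have h2 : Continuous (fun t => r * (t * w' u (r * t))) := by fun_prop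
  have key : ∫ t in (0:ℝ)..1, (w u (r * t) + r * (t * w' u (r * t))) = w u r := by
    rw [intervalIntegral.integral_eq_sub_of_hasDerivAt (f := fun t => t * w u (r * t))
      (fun t _ => ?_) (Continuous.intervalIntegrable (by fun_prop) 0 1)]
    · simp
    · have h3 : HasDerivAt (fun t : ℝ => r * t) r t := by
        simpa using (hasDerivAt_id t).const_mul r
      have h4 := (hasDerivAt_id t).mul ((hw (r * t)).comp t h3)
      exact h4.congr_deriv (by simp only [id, Function.comp_apply]; ring)
  rw [intervalIntegral.integral_add (h1.intervalIntegrable _ _) (h2.intervalIntegrable _ _),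
    intervalIntegral.integral_const_mul] at key
  simp only [avgPow, pow_zero, one_mul, pow_one]
  linarith

lemma hasDerivAt_avgPow_zero {w w' : ℝ → ℝ → ℝ} {u : ℝ}
    (hw : ∀ r, HasDerivAt (w u) (w' u r) r) (hw' : Continuous (w' u)) {r : ℝ} (hr : 0 < r) :
    HasDerivAt (avgPow 0 w u) (avgPow 1 w' u r) r := by
  have hc : Continuous (w u) := continuous_iff_continuousAt.2 fun r => (hw r).continuousAt
  have h1 := (hc.integral_hasStrictDerivAt 0 r).hasDerivAt.div (hasDerivAt_id r) hr.ne'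
  have h2 : avgPow 0 w u =ᶠ[nhds r] (fun x => ∫ s in (0:ℝ)..x, w u s) / id := by
    filter_upwards [lt_mem_nhds hr] with x hx
    rw [Pi.div_apply, ← mul_avgPow_zero, id, mul_div_cancel_left₀ _ hx.ne']
  refine (h1.congr_of_eventuallyEq h2).congr_deriv ?_
  have h3 := sub_avgPow_zero hw hw' r
  rw [← mul_avgPow_zero]
  simp only [id]
  field_simp
  linarith

lemma hasDerivAt_avgPow_one {w w' : ℝ → ℝ → ℝ} {u : ℝ}
    (hw : ∀ r, HasDerivAt (w u) (w' u r) r) (hw' : Continuous (w' u)) {r : ℝ} (hr : 0 < r) :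
    HasDerivAt (avgPow 1 w' u) ((w' u r - 2 * avgPow 1 w' u r) / r) r := by
  have h1 := ((hw r).sub (hasDerivAt_avgPow_zero hw hw' hr)).div (hasDerivAt_id r) hr.ne'
  have h2 : avgPow 1 w' u =ᶠ[nhds r] (w u - avgPow 0 w u) / id := by
    filter_upwards [lt_mem_nhds hr] with x hx
    rw [Pi.div_apply, Pi.sub_apply, sub_avgPow_zero hw hw', id, mul_div_cancel_left₀ _ hx.ne']
  refine (h1.congr_of_eventuallyEq h2).congr_deriv ?_
  have h3 := sub_avgPow_zero hw hw' r
  simp only [id, Pi.sub_apply, h3]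
  field_simp
  ring

lemma hasDerivAt_slopeF (hq : Continuous (Function.uncurry q)) (u r : ℝ) :
    HasDerivAt (slopeF q u) (2⁻¹ * (r * oscQuot q u r ^ 2) * slopeF q u r) r := by
  have hc : Continuous (fun s => s * oscQuot q u s ^ 2) :=
    continuous_id.mul ((continuous_slice (continuous_oscQuot hq) u).pow 2)
  have h1 := ((hc.integral_hasStrictDerivAt 0 r).hasDerivAt.const_mul (2⁻¹ : ℝ)).exp
  have h2 : slopeF q u =
      fun x => Real.exp (2⁻¹ * ∫ s in (0:ℝ)..x, s * oscQuot q u s ^ 2) := by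
    ext x
    simp only [slopeF, mul_avgPow_zero]
  rw [h2]
  exact h1.congr_deriv (by ring)

lemma hasDerivAt_slopePhi (hq : Continuous (Function.uncurry q)) (u r : ℝ) :
    HasDerivAt (slopePhi q u) (slopePhiDeriv q u r) r := by
  have h1 : HasDerivAt (fun r : ℝ => 1 - 3 * r ^ 2) (-(3 * (2 * r))) r := by
    simpa using ((hasDerivAt_pow 2 r).const_mul 3).const_sub 1
  refine (h1.mul (hasDerivAt_slopeF hq u r)).congr_deriv ?_
  unfold slopePhiDeriv
  ring

lemma hasDerivAt_slopeRate {q₁ : ℝ → ℝ → ℝ} {h : ℝ → ℝ → ℝ}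
    (hq : Continuous (Function.uncurry q)) {u r : ℝ} (hr : 0 < r)
    (hh : ∀ r, HasDerivAt (h u) (q u r) r) (hqd : HasDerivAt (q u) (q₁ u r) r) :
    HasDerivAt (slopeRate q u) (slopeTransport q q₁ u r) r := by
  have hφ := hasDerivAt_slopePhi hq u
  have hφc := continuous_slice (continuous_slopePhiDeriv hq) u
  have h1 : HasDerivAt (slopeFt q u) (avgPow 1 (slopePhiDeriv q) u r) r :=
    hasDerivAt_avgPow_zero hφ hφc hr
  have h2 := (hasDerivAt_avgPow_one hφ hφc hr).const_mul (2⁻¹ : ℝ)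
  have h3 : HasDerivAt (oscQuot q u) ((q u r - 2 * oscQuot q u r) / r) r :=
    hasDerivAt_avgPow_one hh (continuous_slice hq u) hr
  refine ((((h1.mul hqd).const_mul (2⁻¹ : ℝ)).add
    (h2.mul ((hasDerivAt_id r).mul h3))).sub_const (2⁻¹ * q u 0)).congr_deriv ?_
  simp only [slopeTransport, slopeSource, slopeG, id, Pi.mul_apply]
  field_simp
  ring

/-! ### The metric coefficients in terms of the radial derivative -/

section Coefficients

variable {h : ℝ → ℝ → ℝ} {u : ℝ}

lemma sub_radAvg_eq (hq : Continuous (Function.uncurry q))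
    (hh : ∀ r, HasDerivAt (h u) (q u r) r) (r : ℝ) :
    h u r - radAvg (h u) r = r * oscQuot q u r := by
  rw [← avgPow_zero_eq_radAvg]
  exact sub_avgPow_zero hh (continuous_slice hq u) r

lemma metF_eq_slopeF (hq : Continuous (Function.uncurry q))
    (hh : ∀ r, HasDerivAt (h u) (q u r) r) (r : ℝ) : metF h u r = slopeF q u r := by
  unfold metF slopeF
  rw [mul_avgPow_zero]
  congr 3
  ext s
  rw [sub_radAvg_eq hq hh]
  rcases eq_or_ne s 0 with rfl | hs
  · simp
  · field_simp

lemma metFt_eq_slopeFt (hq : Continuous (Function.uncurry q))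
    (hh : ∀ r, HasDerivAt (h u) (q u r) r) (r : ℝ) : metFt h u r = slopeFt q u r := by
  unfold metFt slopeFt
  rw [avgPow_zero_eq_radAvg]
  unfold radAvg
  split_ifs
  · simp [slopePhi, slopeF]
  · simp only [slopePhi, metF_eq_slopeF hq hh]

lemma coefG_eq_slopeG (hq : Continuous (Function.uncurry q))
    (hh : ∀ r, HasDerivAt (h u) (q u r) r) (r : ℝ) : coefG h u r = slopeG q u r := by
  unfold coefG
  split_ifs with hr
  · simp [slopeG, avgPow, slopePhiDeriv, hr]
  · have h1 := sub_avgPow_zero (hasDerivAt_slopePhi hq u)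
      (continuous_slice (continuous_slopePhiDeriv hq) u) r
    rw [metF_eq_slopeF hq hh, metFt_eq_slopeFt hq hh]
    have h2 : slopeFt q u r = slopePhi q u r - r * avgPow 1 (slopePhiDeriv q) u r := by
      rw [← h1, slopeFt]; ring
    rw [h2, slopeG, slopePhi]
    field_simp
    ring

end Coefficients

lemma slopeFt_zero (q : ℝ → ℝ → ℝ) (u : ℝ) : slopeFt q u 0 = 1 := by
  simp [slopeFt, avgPow, slopePhi, slopeF]

lemma slopeFt_one_nonpos (hq : Continuous (Function.uncurry q)) (u : ℝ) :
    slopeFt q u 1 ≤ 0 := by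
  have hmono : MonotoneOn (slopeF q u) (Ici 0) := by
    refine monotoneOn_of_deriv_nonneg (convex_Ici 0)
      (continuous_slice (continuous_slopeF hq) u).continuousOn
      (fun x _ => (hasDerivAt_slopeF hq u x).differentiableAt.differentiableWithinAt) ?_
    intro x hx
    rw [interior_Ici] at hx
    have hx : 0 < x := hx
    rw [(hasDerivAt_slopeF hq u x).deriv]
    unfold slopeF
    positivity
  have hs : 0 ≤ √(1 / 3 : ℝ) := Real.sqrt_nonneg _
  have hs2 : √(1 / 3 : ℝ) ^ 2 = 1 / 3 := Real.sq_sqrt (by norm_num)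
  have hle : slopeFt q u 1 ≤
      ∫ t in (0:ℝ)..1, (1 - 3 * t ^ 2) * slopeF q u (√(1 / 3 : ℝ)) := by
    unfold slopeFt avgPow
    have hc := continuous_slice (continuous_slopePhi hq) u
    refine intervalIntegral.integral_mono_on zero_le_one
      (Continuous.intervalIntegrable (by fun_prop) _ _)
      (Continuous.intervalIntegrable (by fun_prop) _ _) fun t ht => ?_
    simp only [pow_zero, one_mul, slopePhi]
    rcases le_total t (√(1 / 3 : ℝ)) with h | h
    · exact mul_le_mul_of_nonneg_left (hmono ht.1 hs h) (by nlinarith [ht.1])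
    · exact mul_le_mul_of_nonpos_left (hmono hs ht.1 h) (by nlinarith [ht.1])
  refine hle.trans (le_of_eq ?_)
  rw [intervalIntegral.integral_mul_const, intervalIntegral.integral_sub
    (by simp) (Continuous.intervalIntegrable (by fun_prop) _ _),
    intervalIntegral.integral_const_mul, integral_pow]
  norm_num

/-! ### A maximum principle -/

lemma mul_nonpos_of_isMaxOn_Icc {f : ℝ → ℝ} {d x y : ℝ} (hf : HasDerivAt f d x)
    (hx : x ∈ Icc (0:ℝ) 1) (hy : y ∈ Icc (0:ℝ) 1) (hmax : IsMaxOn f (Icc 0 1) x) :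
    (y - x) * d ≤ 0 := by
  have h := (hmax.localize).hasFDerivWithinAt_nonpos hf.hasFDerivAt.hasFDerivWithinAt
    (sub_mem_posTangentConeAt_of_segment_subset ((convex_Icc (0:ℝ) 1).segment_subset hx hy))
  simpa using h

lemma mul_deriv_nonpos_of_isMaxOn_Icc {f : ℝ → ℝ} {b d x : ℝ} (hf : HasDerivAt f d x)
    (hx : x ∈ Icc (0:ℝ) 1) (hmax : IsMaxOn f (Icc 0 1) x)
    (h0 : x = 0 → 0 ≤ b) (h1 : x = 1 → b ≤ 0) : b * d ≤ 0 := by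
  have hl := mul_nonpos_of_isMaxOn_Icc hf hx (left_mem_Icc.2 zero_le_one) hmax
  have hr := mul_nonpos_of_isMaxOn_Icc hf hx (right_mem_Icc.2 zero_le_one) hmax
  rcases eq_or_lt_of_le hx.1 with h | h
  · subst h
    exact mul_nonpos_of_nonneg_of_nonpos (h0 rfl) (by linarith)
  rcases eq_or_lt_of_le hx.2 with h' | h'
  · subst h'
    exact mul_nonpos_of_nonpos_of_nonneg (h1 rfl) (by linarith)
  · have : d = 0 := le_antisymm (by nlinarith) (by nlinarith)
    simp [this]

lemma nonneg_deriv_of_isMaxOn_Icc {f : ℝ → ℝ} {d x : ℝ} (hf : HasDerivAt f d x)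
    (hx : x ∈ Icc (0:ℝ) 1) (hx0 : 0 < x) (hmax : IsMaxOn f (Icc 0 1) x) : 0 ≤ d := by
  have hl := mul_nonpos_of_isMaxOn_Icc hf hx (left_mem_Icc.2 zero_le_one) hmax
  nlinarith

/-- A solution of the transport equation `∂_u p = b ∂_r p + g` on the unit square, with zero initial
data, a source `g` that is pointwise dominated by the supremum of `|p|` in `r`, and no inflow
through the lateral boundary, vanishes. -/
lemma eq_zero_of_transport {p px b g : ℝ → ℝ → ℝ} {C : ℝ}
    (hp : Continuous (Function.uncurry p)) (hpx : Continuous (Function.uncurry px))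
    (hb : Continuous (Function.uncurry b)) (hg : Continuous (Function.uncurry g))
    (hpr : ∀ u r, HasDerivAt (p u) (px u r) r)
    (hpu : ∀ u ∈ Icc (0:ℝ) 1, ∀ r ∈ Icc (0:ℝ) 1,
      p u r = ∫ v in (0:ℝ)..u, (b v r * px v r + g v r))
    (hb0 : ∀ u ∈ Icc (0:ℝ) 1, 0 ≤ b u 0) (hb1 : ∀ u ∈ Icc (0:ℝ) 1, b u 1 ≤ 0)
    (hgC : ∀ u ∈ Icc (0:ℝ) 1, ∀ M, (∀ r ∈ Icc (0:ℝ) 1, |p u r| ≤ M) →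
      ∀ r ∈ Icc (0:ℝ) 1, |g u r| ≤ C * M) :
    ∀ u ∈ Icc (0:ℝ) 1, ∀ r ∈ Icc (0:ℝ) 1, p u r = 0 := by
  set K := C + 1 with hK
  have hcont : Continuous (fun z : ℝ × ℝ => |p z.1 z.2| * Real.exp (-(K * z.1))) :=
    hp.abs.mul (by fun_prop)
  obtain ⟨⟨u, r⟩, ⟨hu, hr⟩, hmax⟩ := ((isCompact_Icc (a := (0:ℝ)) (b := 1)).prod
    (isCompact_Icc (a := (0:ℝ)) (b := 1))).exists_isMaxOn ⟨(0, 0), by simp⟩ hcont.continuousOn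
  have hle : ∀ v ∈ Icc (0:ℝ) 1, ∀ s ∈ Icc (0:ℝ) 1,
      |p v s| * Real.exp (-(K * v)) ≤ |p u r| * Real.exp (-(K * u)) :=
    fun v hv s hs => hmax (⟨hv, hs⟩ : (v, s) ∈ Icc (0:ℝ) 1 ×ˢ Icc (0:ℝ) 1)
  have hur : p u r = 0 := by
    by_contra hne
    have hM : 0 < |p u r| := abs_pos.2 hne
    have hu0 : 0 < u := by
      refine lt_of_le_of_ne hu.1 fun h => hne ?_
      rw [hpu u hu r hr, ← h, intervalIntegral.integral_same]
    obtain ⟨σ, hσ1, hσp⟩ : ∃ σ : ℝ, |σ| = 1 ∧ σ * p u r = |p u r| := by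
      rcases le_total 0 (p u r) with h | h
      · exact ⟨1, by simp, by simp [abs_of_nonneg h]⟩
      · exact ⟨-1, by simp, by simp [abs_of_nonpos h]⟩
    have hσle : ∀ x : ℝ, σ * x ≤ |x| := fun x =>
      (le_abs_self _).trans (by rw [abs_mul, hσ1, one_mul])
    have hslice : ∀ s ∈ Icc (0:ℝ) 1, |p u s| ≤ |p u r| := fun s hs =>
      le_of_mul_le_mul_right (hle u hu s hs) (Real.exp_pos _)
    have hspace : b u r * (σ * px u r) ≤ 0 := by
      refine mul_deriv_nonpos_of_isMaxOn_Icc ((hpr u r).const_mul σ) hr (fun s hs => ?_)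
        (fun h => h ▸ hb0 u hu) (fun h => h ▸ hb1 u hu)
      exact (hσle _).trans ((hslice s hs).trans hσp.ge)
    have hint : Continuous (fun v => b v r * px v r + g v r) := by
      have hsl : Continuous (fun v : ℝ => (v, r)) := by fun_prop
      exact ((hb.comp hsl).mul (hpx.comp hsl)).add (hg.comp hsl)
    have hE : HasDerivAt (fun v => Real.exp (-(K * v))) (Real.exp (-(K * u)) * -K) u := by
      simpa using (((hasDerivAt_id u).const_mul K).neg).exp
    have htime := ((hint.integral_hasStrictDerivAt 0 u).hasDerivAt.const_mul σ).mul hE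
    have h0 := nonneg_deriv_of_isMaxOn_Icc htime hu hu0 (fun v hv => by
      simp only [mem_ofPred_eq, Pi.mul_apply]
      rw [← hpu v hv r hr, ← hpu u hu r hr, hσp]
      exact (mul_le_mul_of_nonneg_right (hσle _) (Real.exp_pos _).le).trans (hle v hv r hr))
    rw [← hpu u hu r hr, hσp] at h0
    have h1 : 0 ≤ (σ * (b u r * px u r + g u r) - K * |p u r|) * Real.exp (-(K * u)) := by
      linarith
    have h2 := nonneg_of_mul_nonneg_left h1 (Real.exp_pos _)
    have h3 := (hσle (g u r)).trans (hgC u hu _ hslice r hr)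
    nlinarith
  intro v hv s hs
  have h := hle v hv s hs
  rw [hur, abs_zero, zero_mul] at h
  exact abs_nonpos_iff.1 (nonpos_of_mul_nonpos_left h (Real.exp_pos _))

/-! ### Lipschitz control by the radial derivative -/

/-- At each time in `[0,1]`, the difference `a₁ - a₂` is bounded on `[0,1]` by a fixed multiple of
the supremum of `|q₁ - q₂|`. -/
def Controlled (q₁ q₂ a₁ a₂ : ℝ → ℝ → ℝ) : Prop :=
  ∃ C : ℝ, 0 ≤ C ∧ ∀ u ∈ Icc (0:ℝ) 1, ∀ M, (∀ r ∈ Icc (0:ℝ) 1, |q₁ u r - q₂ u r| ≤ M) →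
    ∀ r ∈ Icc (0:ℝ) 1, |a₁ u r - a₂ u r| ≤ C * M

lemma exists_bound_unit_square {a : ℝ → ℝ → ℝ} (ha : Continuous (Function.uncurry a)) :
    ∃ B : ℝ, 0 ≤ B ∧ ∀ u ∈ Icc (0:ℝ) 1, ∀ r ∈ Icc (0:ℝ) 1, |a u r| ≤ B := by
  obtain ⟨B, hB⟩ := ((isCompact_Icc (a := (0:ℝ)) (b := 1)).prod
    (isCompact_Icc (a := (0:ℝ)) (b := 1))).exists_bound_of_continuousOn ha.continuousOn
  have h : ∀ u ∈ Icc (0:ℝ) 1, ∀ r ∈ Icc (0:ℝ) 1, |a u r| ≤ B := fun u hu r hr =>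
    hB (u, r) ⟨hu, hr⟩
  exact ⟨B, (abs_nonneg _).trans (h 0 (by simp) 0 (by simp)), h⟩

namespace Controlled

variable {q₁ q₂ a₁ a₂ b₁ b₂ : ℝ → ℝ → ℝ}

lemma self (q₁ q₂ : ℝ → ℝ → ℝ) : Controlled q₁ q₂ q₁ q₂ :=
  ⟨1, zero_le_one, fun u _ M hM r hr => by simpa using hM r hr⟩

lemma refl (q₁ q₂ a : ℝ → ℝ → ℝ) : Controlled q₁ q₂ a a :=
  ⟨0, le_rfl, fun u _ M _ r _ => by simp⟩

lemma at_zero (q₁ q₂ : ℝ → ℝ → ℝ) :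
    Controlled q₁ q₂ (fun u _ => q₁ u 0) (fun u _ => q₂ u 0) :=
  ⟨1, zero_le_one, fun u _ M hM r _ => by simpa using hM 0 (by simp)⟩

lemma add (ha : Controlled q₁ q₂ a₁ a₂) (hb : Controlled q₁ q₂ b₁ b₂) :
    Controlled q₁ q₂ (fun u r => a₁ u r + b₁ u r) (fun u r => a₂ u r + b₂ u r) := by
  obtain ⟨C, hC, h⟩ := ha
  obtain ⟨D, hD, k⟩ := hb
  refine ⟨C + D, add_nonneg hC hD, fun u hu M hM r hr => ?_⟩
  have h1 := h u hu M hM r hr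
  have h2 := k u hu M hM r hr
  rw [abs_le] at *
  constructor <;> linarith

lemma mul (ha : Controlled q₁ q₂ a₁ a₂) (hb : Controlled q₁ q₂ b₁ b₂)
    (ha₁ : Continuous (Function.uncurry a₁)) (hb₂ : Continuous (Function.uncurry b₂)) :
    Controlled q₁ q₂ (fun u r => a₁ u r * b₁ u r) (fun u r => a₂ u r * b₂ u r) := by
  obtain ⟨C, hC, h⟩ := ha
  obtain ⟨D, hD, k⟩ := hb
  obtain ⟨A, hA, hA'⟩ := exists_bound_unit_square ha₁
  obtain ⟨B, hB, hB'⟩ := exists_bound_unit_square hb₂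
  refine ⟨A * D + C * B, by positivity, fun u hu M hM r hr => ?_⟩
  have e : a₁ u r * b₁ u r - a₂ u r * b₂ u r =
      a₁ u r * (b₁ u r - b₂ u r) + (a₁ u r - a₂ u r) * b₂ u r := by ring
  rw [e]
  refine (abs_add_le _ _).trans ?_
  rw [abs_mul, abs_mul]
  have h1 := mul_le_mul (hA' u hu r hr) (k u hu M hM r hr) (abs_nonneg _) hA
  have h2 := mul_le_mul (h u hu M hM r hr) (hB' u hu r hr) (abs_nonneg _)
    ((abs_nonneg _).trans (h u hu M hM r hr))
  linarith

lemma smul {k : ℝ → ℝ → ℝ} (hk : Continuous (Function.uncurry k))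
    (ha : Controlled q₁ q₂ a₁ a₂) :
    Controlled q₁ q₂ (fun u r => k u r * a₁ u r) (fun u r => k u r * a₂ u r) := by
  obtain ⟨C, hC, h⟩ := ha
  obtain ⟨B, hB, hB'⟩ := exists_bound_unit_square hk
  refine ⟨B * C, by positivity, fun u hu M hM r hr => ?_⟩
  rw [← mul_sub, abs_mul, mul_assoc]
  exact mul_le_mul (hB' u hu r hr) (h u hu M hM r hr) (abs_nonneg _) hB

lemma sub (ha : Controlled q₁ q₂ a₁ a₂) (hb : Controlled q₁ q₂ b₁ b₂) :
    Controlled q₁ q₂ (fun u r => a₁ u r - b₁ u r) (fun u r => a₂ u r - b₂ u r) := by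
  simpa [sub_eq_add_neg] using
    ha.add (hb.smul (k := fun _ _ => -1) continuous_const)

lemma exp (ha : Controlled q₁ q₂ a₁ a₂)
    (ha₁ : Continuous (Function.uncurry a₁)) (ha₂ : Continuous (Function.uncurry a₂)) :
    Controlled q₁ q₂ (fun u r => Real.exp (a₁ u r)) (fun u r => Real.exp (a₂ u r)) := by
  obtain ⟨C, hC, h⟩ := ha
  obtain ⟨A, hA, hA'⟩ := exists_bound_unit_square ha₁
  obtain ⟨B, hB, hB'⟩ := exists_bound_unit_square ha₂
  have key : ∀ x y E : ℝ, x ≤ E → Real.exp x - Real.exp y ≤ Real.exp E * |x - y| := by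
    intro x y E hxE
    have h1 := Real.add_one_le_exp (y - x)
    have h2 : Real.exp y = Real.exp x * Real.exp (y - x) := by
      rw [← Real.exp_add]; ring_nf
    calc Real.exp x - Real.exp y ≤ Real.exp x * (x - y) := by
          nlinarith [Real.exp_pos x]
      _ ≤ Real.exp x * |x - y| := by gcongr; exact le_abs_self _
      _ ≤ Real.exp E * |x - y| := by gcongr
  refine ⟨Real.exp (A + B) * C, by positivity, fun u hu M hM r hr => ?_⟩
  have hx := (le_abs_self _).trans (hA' u hu r hr)
  have hy := (le_abs_self _).trans (hB' u hu r hr)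
  have h1 := key (a₁ u r) (a₂ u r) (A + B) (by linarith)
  have h2 := key (a₂ u r) (a₁ u r) (A + B) (by linarith)
  rw [abs_sub_comm] at h2
  rw [mul_assoc]
  refine le_trans ?_ (mul_le_mul_of_nonneg_left (h u hu M hM r hr) (Real.exp_pos _).le)
  exact abs_sub_le_iff.2 ⟨h1, h2⟩

lemma avgPow (n : ℕ) (ha : Controlled q₁ q₂ a₁ a₂)
    (ha₁ : Continuous (Function.uncurry a₁)) (ha₂ : Continuous (Function.uncurry a₂)) :
    Controlled q₁ q₂ (avgPow n a₁) (avgPow n a₂) := by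
  obtain ⟨C, hC, h⟩ := ha
  refine ⟨C, hC, fun u hu M hM r hr => ?_⟩
  have h₁ := continuous_slice ha₁ u
  have h₂ := continuous_slice ha₂ u
  unfold _root_.avgPow
  rw [← intervalIntegral.integral_sub (Continuous.intervalIntegrable (by fun_prop) _ _)
    (Continuous.intervalIntegrable (by fun_prop) _ _)]
  have hb := intervalIntegral.norm_integral_le_of_norm_le_const (a := (0:ℝ)) (b := 1)
    (f := fun t => t ^ n * a₁ u (r * t) - t ^ n * a₂ u (r * t)) (C := C * M) (fun t ht => ?_)
  · simpa using hb
  · rw [uIoc_of_le zero_le_one] at ht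
    have hrt : r * t ∈ Icc (0:ℝ) 1 :=
      ⟨mul_nonneg hr.1 ht.1.le, mul_le_one₀ hr.2 ht.1.le ht.2⟩
    rw [Real.norm_eq_abs, ← mul_sub, abs_mul, abs_pow, abs_of_pos ht.1]
    exact (mul_le_of_le_one_left (abs_nonneg _) (pow_le_one₀ ht.1.le ht.2)).trans
      (h u hu M hM _ hrt)

end Controlled

section ControlledCoefficients

variable {q₁ q₂ : ℝ → ℝ → ℝ}

lemma controlled_oscQuot (h₁ : Continuous (Function.uncurry q₁))
    (h₂ : Continuous (Function.uncurry q₂)) :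
    Controlled q₁ q₂ (oscQuot q₁) (oscQuot q₂) := (Controlled.self q₁ q₂).avgPow 1 h₁ h₂

lemma controlled_oscQuot_sq (h₁ : Continuous (Function.uncurry q₁))
    (h₂ : Continuous (Function.uncurry q₂)) :
    Controlled q₁ q₂ (fun u r => r * oscQuot q₁ u r ^ 2) (fun u r => r * oscQuot q₂ u r ^ 2) := by
  have hA := controlled_oscQuot h₁ h₂
  simp only [sq]
  exact (hA.mul hA (continuous_oscQuot h₁) (continuous_oscQuot h₂)).smul (k := fun _ r => r)
    continuous_snd

lemma continuous_mul_oscQuot_sq (hq : Continuous (Function.uncurry q)) :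
    Continuous (Function.uncurry (fun u r => r * oscQuot q u r ^ 2)) :=
  continuous_snd.mul ((continuous_oscQuot hq).pow 2)

lemma controlled_slopeF (h₁ : Continuous (Function.uncurry q₁))
    (h₂ : Continuous (Function.uncurry q₂)) :
    Controlled q₁ q₂ (slopeF q₁) (slopeF q₂) := by
  have hc : ∀ {q : ℝ → ℝ → ℝ}, Continuous (Function.uncurry q) → Continuous (Function.uncurry
      (fun u r => 2⁻¹ * (r * avgPow 0 (fun u s => s * oscQuot q u s ^ 2) u r))) := fun hq =>
    continuous_const.mul (continuous_snd.mul (continuous_avgPow 0 (continuous_mul_oscQuot_sq hq)))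
  refine Controlled.exp ?_ (hc h₁) (hc h₂)
  exact (((controlled_oscQuot_sq h₁ h₂).avgPow 0 (continuous_mul_oscQuot_sq h₁)
    (continuous_mul_oscQuot_sq h₂)).smul (k := fun _ r => r) continuous_snd).smul
    (k := fun _ _ => 2⁻¹) continuous_const

lemma controlled_slopePhi (h₁ : Continuous (Function.uncurry q₁))
    (h₂ : Continuous (Function.uncurry q₂)) :
    Controlled q₁ q₂ (slopePhi q₁) (slopePhi q₂) :=
  (controlled_slopeF h₁ h₂).smul (k := fun _ r => 1 - 3 * r ^ 2) (by fun_prop)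

lemma controlled_slopePhiDeriv (h₁ : Continuous (Function.uncurry q₁))
    (h₂ : Continuous (Function.uncurry q₂)) :
    Controlled q₁ q₂ (slopePhiDeriv q₁) (slopePhiDeriv q₂) := by
  refine Controlled.mul ?_ (controlled_slopeF h₁ h₂) ?_ (continuous_slopeF h₂)
  · exact (Controlled.refl q₁ q₂ (fun _ r => -6 * r)).add
      (((controlled_oscQuot_sq h₁ h₂).smul (k := fun _ _ => 2⁻¹) continuous_const).smul
        (k := fun _ r => 1 - 3 * r ^ 2) (by fun_prop))
  · exact Continuous.add (by fun_prop) (Continuous.mul (by fun_prop)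
      (continuous_const.mul (continuous_mul_oscQuot_sq h₁)))

lemma controlled_slopeFt (h₁ : Continuous (Function.uncurry q₁))
    (h₂ : Continuous (Function.uncurry q₂)) :
    Controlled q₁ q₂ (slopeFt q₁) (slopeFt q₂) :=
  (controlled_slopePhi h₁ h₂).avgPow 0 (continuous_slopePhi h₁) (continuous_slopePhi h₂)

lemma controlled_slopeG (h₁ : Continuous (Function.uncurry q₁))
    (h₂ : Continuous (Function.uncurry q₂)) :
    Controlled q₁ q₂ (slopeG q₁) (slopeG q₂) :=
  ((controlled_slopePhiDeriv h₁ h₂).avgPow 1 (continuous_slopePhiDeriv h₁)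
    (continuous_slopePhiDeriv h₂)).smul (k := fun _ _ => 2⁻¹) continuous_const

lemma controlled_slopeSource (h₁ : Continuous (Function.uncurry q₁))
    (h₂ : Continuous (Function.uncurry q₂)) :
    Controlled q₁ q₂ (slopeSource q₁) (slopeSource q₂) := by
  have hG := controlled_slopeG h₁ h₂
  refine ((hG.mul (.self q₁ q₂) (continuous_slopeG h₁) h₂).smul
    (k := fun _ _ => 2) continuous_const).add (Controlled.mul ?_ (controlled_oscQuot h₁ h₂) ?_
      (continuous_oscQuot h₂))
  · exact ((controlled_slopePhiDeriv h₁ h₂).smul (k := fun _ _ => 2⁻¹) continuous_const).sub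
      (hG.smul (k := fun _ _ => 3) continuous_const)
  · exact (continuous_const.mul (continuous_slopePhiDeriv h₁)).sub
      (continuous_const.mul (continuous_slopeG h₁))

lemma controlled_slopeRate (h₁ : Continuous (Function.uncurry q₁))
    (h₂ : Continuous (Function.uncurry q₂)) :
    Controlled q₁ q₂ (slopeRate q₁) (slopeRate q₂) :=
  ((((controlled_slopeFt h₁ h₂).mul (.self q₁ q₂) (continuous_slopeFt h₁) h₂).smul
    (k := fun _ _ => 2⁻¹) continuous_const).add
    ((controlled_slopeG h₁ h₂).mul ((controlled_oscQuot h₁ h₂).smul (k := fun _ r => r)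
      continuous_snd) (continuous_slopeG h₁) (continuous_snd.mul (continuous_oscQuot h₂)))).sub
    ((Controlled.at_zero q₁ q₂).smul (k := fun _ _ => 2⁻¹) continuous_const)

end ControlledCoefficients

/-! ### The integrated equations -/

lemma hasDerivAt_snd_of_contDiff {h : ℝ → ℝ → ℝ} (hh : ContDiff ℝ 1 (Function.uncurry h))
    (u r : ℝ) : HasDerivAt (h u) (fderiv ℝ (Function.uncurry h) (u, r) (0, 1)) r := by
  have h1 := (hh.differentiable one_ne_zero (u, r)).hasFDerivAt
  have h2 : HasDerivAt (fun s : ℝ => (u, s)) ((0 : ℝ), (1 : ℝ)) r :=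
    (hasDerivAt_const r u).prodMk (hasDerivAt_id r)
  exact h1.comp_hasDerivAt r h2

lemma hasDerivAt_fst_of_contDiff {h : ℝ → ℝ → ℝ} (hh : ContDiff ℝ 1 (Function.uncurry h))
    (u r : ℝ) : HasDerivAt (fun v => h v r)
      (fderiv ℝ (Function.uncurry h) (u, r) (1, 0)) u := by
  have h1 := (hh.differentiable one_ne_zero (u, r)).hasFDerivAt
  have h2 : HasDerivAt (fun v : ℝ => (v, r)) ((1 : ℝ), (0 : ℝ)) u :=
    (hasDerivAt_id u).prodMk (hasDerivAt_const u r)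
  exact h1.comp_hasDerivAt u h2

lemma continuous_deriv_snd_s8 {h : ℝ → ℝ → ℝ} (hh : ContDiff ℝ 1 (Function.uncurry h)) :
    Continuous (Function.uncurry fun u => deriv (h u)) := by
  have e : (Function.uncurry fun u => deriv (h u)) =
      fun z => fderiv ℝ (Function.uncurry h) z (0, 1) := by
    ext ⟨u, r⟩
    exact (hasDerivAt_snd_of_contDiff hh u r).deriv
  rw [e]
  exact (hh.continuous_fderiv one_ne_zero).clm_apply continuous_const

lemma continuous_intervalIntegral_fst {R : ℝ → ℝ → ℝ} (hR : Continuous (Function.uncurry R))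
    (u : ℝ) : Continuous fun r => ∫ v in (0:ℝ)..u, R v r :=
  intervalIntegral.continuous_parametric_intervalIntegral_of_continuous'
    (f := fun r v => R v r) (hR.comp continuous_swap) 0 u

lemma hasDerivAt_intervalIntegral_of_continuous {F R : ℝ → ℝ → ℝ} {u r : ℝ}
    (hu : u ∈ Icc (0:ℝ) 1) (hr : r ∈ Ioo (0:ℝ) 1)
    (hF : ∀ r, Continuous fun v => F v r) (hR : Continuous (Function.uncurry R))
    (hFR : ∀ v, ∀ s ∈ Ioo (0:ℝ) 1, HasDerivAt (F v) (R v s) s) :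
    HasDerivAt (fun s => ∫ v in (0:ℝ)..u, F v s) (∫ v in (0:ℝ)..u, R v r) r := by
  obtain ⟨B, -, hB⟩ := exists_bound_unit_square hR
  refine (intervalIntegral.hasDerivAt_integral_of_dominated_loc_of_deriv_le
    (F := fun s v => F v s) (F' := fun s v => R v s) (bound := fun _ => B)
    (Ioo_mem_nhds hr.1 hr.2) (Filter.Eventually.of_forall fun s => (hF s).aestronglyMeasurable)
    ((hF r).intervalIntegrable _ _) ?_ ?_ (by simp) ?_).2
  · exact (hR.comp (continuous_id.prodMk continuous_const)).aestronglyMeasurable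
  · refine Filter.Eventually.of_forall fun v hv s hs => ?_
    rw [uIoc_of_le hu.1] at hv
    exact hB v ⟨hv.1.le, hv.2.trans hu.2⟩ s (Ioo_subset_Icc_self hs)
  · exact Filter.Eventually.of_forall fun v _ s hs => hFR v s hs

namespace IsCoupledSol

variable {hU h : ℝ → ℝ → ℝ} {h₀ : ℝ → ℝ}

lemma eq_integral (hUc : ContDiff ℝ 1 (Function.uncurry hU)) (hs : IsCoupledSol 1 hU h₀ h)
    {u r : ℝ} (hu : u ∈ Icc (0:ℝ) 1) (hr : r ∈ Icc (0:ℝ) 1) :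
    h u r = h₀ r + ∫ v in (0:ℝ)..u, (slopeRate (fun u => deriv (h u)) v r + 2⁻¹ * deriv (hU v) 0) := by
  obtain ⟨hC, -, -, heq, -, hinit, -⟩ := hs
  have hq := continuous_deriv_snd_s8 hC
  have hcont : Continuous (fun v => slopeRate (fun u => deriv (h u)) v r + 2⁻¹ * deriv (hU v) 0) :=
    (continuous_slice_fst (continuous_slopeRate hq) r).add
      (continuous_const.mul (continuous_slice_fst (continuous_deriv_snd_s8 hUc) 0))
  rw [intervalIntegral.integral_eq_sub_of_hasDerivAt (f := fun v => h v r) (fun v hv => ?_)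
    (hcont.intervalIntegrable _ _)]
  · rw [hinit r hr]; ring
  · rw [uIcc_of_le hu.1] at hv
    have hv' : v ∈ Icc (0:ℝ) 1 := ⟨hv.1, hv.2.trans hu.2⟩
    have hd := (hasDerivAt_fst_of_contDiff hC v r).differentiableAt.hasDerivAt
    have hh : ∀ s, HasDerivAt (h v) ((fun u => deriv (h u)) v s) s := fun s =>
      (hasDerivAt_snd_of_contDiff hC v s).differentiableAt.hasDerivAt
    have e := heq v hv' r hr
    rw [metFt_eq_slopeFt hq hh, coefG_eq_slopeG hq hh, sub_radAvg_eq hq hh] at e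
    refine hd.congr_deriv ?_
    simp only [slopeRate]
    linarith

lemma deriv_eq_integral (hUc : ContDiff ℝ 1 (Function.uncurry hU)) (h₀c : ContDiff ℝ 2 h₀)
    (hs : IsCoupledSol 1 hU h₀ h) {u r : ℝ} (hu : u ∈ Icc (0:ℝ) 1) (hr : r ∈ Icc (0:ℝ) 1) :
    deriv (h u) r = deriv h₀ r + ∫ v in (0:ℝ)..u,
      slopeTransport (fun u => deriv (h u)) (fun u => deriv (deriv (h u))) v r := by
  have hC := hs.1
  have hq := continuous_deriv_snd_s8 hC
  have hR := continuous_slopeTransport (q₁ := fun u => deriv (deriv (h u))) hq hs.2.2.1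
  have hopen : EqOn (deriv (h u)) (fun r => deriv h₀ r + ∫ v in (0:ℝ)..u,
      slopeTransport (fun u => deriv (h u)) (fun u => deriv (deriv (h u))) v r) (Ioo 0 1) := by
    intro r hr
    have hint := hasDerivAt_intervalIntegral_of_continuous hu hr
      (F := fun v r => slopeRate (fun u => deriv (h u)) v r + 2⁻¹ * deriv (hU v) 0)
      (fun r => (continuous_slice_fst (continuous_slopeRate hq) r).add
        (continuous_const.mul (continuous_slice_fst (continuous_deriv_snd_s8 hUc) 0))) hR
      (fun v s hs' => (hasDerivAt_slopeRate hq hs'.1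
        (fun s => (hasDerivAt_snd_of_contDiff hC v s).differentiableAt.hasDerivAt)
        (hs.2.1 v s).hasDerivAt).add_const _)
    have h₀d := ((h₀c.differentiable two_ne_zero) r).hasDerivAt
    have hsum := (h₀d.add hint).congr_of_eventuallyEq (f₁ := h u) (by
      filter_upwards [Ioo_mem_nhds hr.1 hr.2] with s hs'
      exact eq_integral hUc hs hu (Ioo_subset_Icc_self hs'))
    exact hsum.deriv
  refine hopen.of_subset_closure (continuous_slice hq u).continuousOn (Continuous.continuousOn ?_)
    Ioo_subset_Icc_self (by rw [closure_Ioo zero_ne_one]) hr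
  refine (h₀c.continuous_deriv one_le_two).add ?_
  exact continuous_intervalIntegral_fst hR u

end IsCoupledSol

theorem uniqueness_coupled_system :
    ∃ x > (0:ℝ), ∀ (hU : ℝ → ℝ → ℝ) (h₀ : ℝ → ℝ),
      ContDiff ℝ 1 (Function.uncurry hU) → ContDiff ℝ 2 h₀ →
      (∀ r ∈ Icc (0:ℝ) 1, |deriv h₀ r| ≤ x) →
      ∃ U : ℝ, 0 < U ∧ U ≤ 1 ∧
        ∀ h₁ h₂ : ℝ → ℝ → ℝ,
          IsCoupledSol U hU h₀ h₁ → IsCoupledSol U hU h₀ h₂ →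
          ∀ u ∈ Icc (0:ℝ) U, ∀ r ∈ Icc (0:ℝ) U, h₁ u r = h₂ u r := by
  refine ⟨1, one_pos, fun hU h₀ hUc h₀c _ => ⟨1, one_pos, le_rfl, fun h₁ h₂ hs₁ hs₂ => ?_⟩⟩
  set q₁ : ℝ → ℝ → ℝ := fun u => deriv (h₁ u) with hq₁
  set q₂ : ℝ → ℝ → ℝ := fun u => deriv (h₂ u) with hq₂
  have c₁ : Continuous (Function.uncurry q₁) := continuous_deriv_snd_s8 hs₁.1
  have c₂ : Continuous (Function.uncurry q₂) := continuous_deriv_snd_s8 hs₂.1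
  have d₁ : Continuous (Function.uncurry fun u => deriv (q₁ u)) := hs₁.2.2.1
  have d₂ : Continuous (Function.uncurry fun u => deriv (q₂ u)) := hs₂.2.2.1
  have hFt : ∀ {q : ℝ → ℝ → ℝ}, Continuous (Function.uncurry q) →
      Continuous (Function.uncurry fun u r => 2⁻¹ * slopeFt q u r) := fun hq =>
    continuous_const.mul (continuous_slopeFt hq)
  have hsrc : Controlled q₁ q₂
      (fun u r => deriv (q₂ u) r * (2⁻¹ * slopeFt q₁ u r) + slopeSource q₁ u r)
      (fun u r => deriv (q₂ u) r * (2⁻¹ * slopeFt q₂ u r) + slopeSource q₂ u r) :=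
    (((controlled_slopeFt c₁ c₂).smul (k := fun _ _ => 2⁻¹) continuous_const).smul d₂).add
      (controlled_slopeSource c₁ c₂)
  obtain ⟨C, -, hC⟩ := hsrc
  have hzero := eq_zero_of_transport (C := C) (p := fun u r => q₁ u r - q₂ u r)
    (px := fun u r => deriv (q₁ u) r - deriv (q₂ u) r) (b := fun u r => 2⁻¹ * slopeFt q₁ u r)
    (g := fun u r => (deriv (q₂ u) r * (2⁻¹ * slopeFt q₁ u r) + slopeSource q₁ u r) -
      (deriv (q₂ u) r * (2⁻¹ * slopeFt q₂ u r) + slopeSource q₂ u r))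
    (c₁.sub c₂) (d₁.sub d₂) (hFt c₁)
    (((d₂.mul (hFt c₁)).add (continuous_slopeSource c₁)).sub
      ((d₂.mul (hFt c₂)).add (continuous_slopeSource c₂)))
    (fun u r => (hs₁.2.1 u r).hasDerivAt.sub (hs₂.2.1 u r).hasDerivAt)
    (fun u hu r hr => ?_) (fun u _ => by simp [slopeFt_zero])
    (fun u _ => by linarith [slopeFt_one_nonpos c₁ u]) hC
  · have hrate : ∀ u ∈ Icc (0:ℝ) 1, ∀ r ∈ Icc (0:ℝ) 1, slopeRate q₁ u r = slopeRate q₂ u r := by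
      obtain ⟨D, -, hD⟩ := controlled_slopeRate c₁ c₂
      intro u hu r hr
      have h := hD u hu 0 (fun s hs => (abs_eq_zero.2 (hzero u hu s hs)).le) r hr
      rw [mul_zero] at h
      exact sub_eq_zero.1 (abs_nonpos_iff.1 h)
    intro u hu r hr
    rw [hs₁.eq_integral hUc hu hr, hs₂.eq_integral hUc hu hr]
    congr 1
    refine intervalIntegral.integral_congr fun v hv => ?_
    rw [uIcc_of_le hu.1] at hv
    exact congrArg (· + 2⁻¹ * deriv (hU v) 0) (hrate v ⟨hv.1, hv.2.trans hu.2⟩ r hr)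
  · have e₁ := hs₁.deriv_eq_integral hUc h₀c hu hr
    have e₂ := hs₂.deriv_eq_integral hUc h₀c hu hr
    have i₁ := continuous_slice_fst (continuous_slopeTransport c₁ d₁) r
    have i₂ := continuous_slice_fst (continuous_slopeTransport c₂ d₂) r
    calc q₁ u r - q₂ u r
        = (∫ v in (0:ℝ)..u, slopeTransport q₁ (fun u => deriv (q₁ u)) v r) -
          ∫ v in (0:ℝ)..u, slopeTransport q₂ (fun u => deriv (q₂ u)) v r := by
          simp only [hq₁, hq₂]
          rw [e₁, e₂]
          ring
      _ = _ := by
          rw [← intervalIntegral.integral_sub (i₁.intervalIntegrable _ _)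
            (i₂.intervalIntegrable _ _)]
          refine intervalIntegral.integral_congr fun v _ => ?_
          simp only [slopeTransport]
          ring
end

section
/- Let 0<δ<1. There exists a constant C_δ>0 such that for every C¹ function w on [0,∞) with ‖w'‖_{L^{∞,2-δ}_r}<∞ and every r≥0, |w(r) - w̄(r)| ≤ C_δ · (r/(1+r)^{2-δ}) · ‖w'‖_{L^{∞,2-δ}_r}. -/
open Set MeasureTheory Real

/-- Integration by parts: `∫₀ʳ s w'(s) ds = r (w(r) - w̄(r))`. -/
theorem integral_mul_deriv_eq_mul_sub_radAvg {w : ℝ → ℝ} (hw : ContDiff ℝ 1 w) {r : ℝ}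
    (hr : r ≠ 0) : ∫ s in (0:ℝ)..r, s * deriv w s = r * (w r - radAvg w r) := by
  have hparts := intervalIntegral.integral_mul_deriv_eq_deriv_mul (a := 0) (b := r)
    (u := fun s : ℝ => s) (u' := fun _ => 1) (v := w) (v' := deriv w)
    (fun x _ => hasDerivAt_id x)
    (fun x _ => (hw.differentiable one_ne_zero x).hasDerivAt)
    intervalIntegrable_const ((hw.continuous_deriv le_rfl).intervalIntegrable _ _)
  rw [hparts, radAvg, if_neg hr]
  simp only [one_mul, zero_mul, sub_zero]
  field_simp

/-- A weighted bound on `w'` controls `s w'(s)` on `(0, r]` by an integrable power of `s`. -/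
theorem mul_abs_le_rpow_of_weighted_bound {p N s r y : ℝ} (hp : 0 ≤ p) (hs : 0 < s) (hsr : s ≤ r)
    (hy : (1 + s) ^ p * y ≤ N) (hN : 0 ≤ N) :
    s * y ≤ N * (r / (1 + r)) ^ p * s ^ (1 - p) := by
  have hmono : (s / (1 + s)) ^ p ≤ (r / (1 + r)) ^ p := by
    apply rpow_le_rpow (by positivity) _ hp
    rw [div_le_div_iff₀ (by positivity) (by linarith)]
    nlinarith
  have hpow : s ^ p * s ^ (1 - p) = s := by
    rw [← rpow_add hs, add_sub_cancel, rpow_one]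
  have hpos : 0 < (1 + s) ^ p := by positivity
  calc s * y ≤ s * (N / (1 + s) ^ p) := by
        gcongr
        rwa [le_div_iff₀' hpos]
    _ = N * (s / (1 + s)) ^ p * s ^ (1 - p) := by
        rw [div_rpow hs.le (by positivity)]
        linear_combination -(N / (1 + s) ^ p) * hpow
    _ ≤ N * (r / (1 + r)) ^ p * s ^ (1 - p) := by gcongr

theorem avg_diff_weighted (δ : ℝ) (hδ₁ : 0 < δ) (hδ₂ : δ < 1) :
    ∃ C > (0:ℝ), ∀ w : ℝ → ℝ, ContDiff ℝ 1 w → ∀ N : ℝ, 0 ≤ N →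
      (∀ s : ℝ, 0 ≤ s → (1 + s) ^ (2 - δ) * |deriv w s| ≤ N) →
      ∀ r : ℝ, 0 ≤ r →
        |w r - radAvg w r| ≤ C * (r / (1 + r) ^ (2 - δ)) * N := by
  refine ⟨1 / δ, by positivity, fun w hw N hN hbound r hr => ?_⟩
  rcases hr.eq_or_lt with rfl | hr
  · simp [radAvg]
  have hexp : -1 < 1 - (2 - δ) := by linarith
  have hint : |∫ s in (0:ℝ)..r, s * deriv w s| ≤
      ∫ s in (0:ℝ)..r, N * (r / (1 + r)) ^ (2 - δ) * s ^ (1 - (2 - δ)) := by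
    rw [← norm_eq_abs]
    refine intervalIntegral.norm_integral_le_of_norm_le hr.le (ae_of_all _ fun s hs => ?_)
      ((intervalIntegral.intervalIntegrable_rpow' hexp).const_mul _)
    rw [norm_mul, norm_eq_abs, norm_eq_abs, abs_of_pos hs.1]
    exact mul_abs_le_rpow_of_weighted_bound (by linarith) hs.1 hs.2 (hbound s hs.1.le) hN
  have hδ : 1 - (2 - δ) + 1 = δ := by ring
  rw [integral_mul_deriv_eq_mul_sub_radAvg hw hr.ne', abs_mul, abs_of_pos hr,
    intervalIntegral.integral_const_mul, integral_rpow (Or.inl hexp), hδ,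
    zero_rpow hδ₁.ne', sub_zero, div_rpow hr.le (by positivity)] at hint
  have hpow : r ^ (2 - δ) * r ^ δ = r * r := by
    rw [← rpow_add hr, sub_add_cancel, rpow_two, sq]
  refine le_of_mul_le_mul_left (hint.trans_eq ?_) hr
  linear_combination N / (1 + r) ^ (2 - δ) / δ * hpow
end

section
/- Let p>2. There exists a constant C_p>0 such that for every C¹ function w on [0,∞) with ‖w'‖_{L^{∞,p}_r}<∞ and every r≥0, |w(r) - w̄(r)| ≤ C_p · (r/(1+r)²) · ‖w'‖_{L^{∞,p}_r}. Moreover, for p=2 there exists C₂>0 such that |w(r) - w̄(r)| ≤ C₂ · (r·log(2+r)/(1+r)²) · ‖w'‖_{L^{∞,2}_r}. -/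
open Set MeasureTheory Real

/-- If `s |w'(s)| ≤ B'(s)` on `[0, ∞)` and `B 0 = 0`, then `|w r - w̄ r| ≤ B r / r`. -/
lemma abs_sub_radAvg_le_div {w B b : ℝ → ℝ} (hw : ContDiff ℝ 1 w)
    (hB : ∀ s, 0 ≤ s → HasDerivAt B (b s) s) (hB0 : B 0 = 0)
    (hb : ∀ s, 0 ≤ s → s * |deriv w s| ≤ b s) {r : ℝ} (hr : 0 ≤ r) :
    |w r - radAvg w r| ≤ B r / r := by
  rcases hr.eq_or_lt with rfl | hr0
  · simp [radAvg]
  have hd (s : ℝ) : HasDerivAt (fun r => r * w r - ∫ t in (0:ℝ)..r, w t) (s * deriv w s) s := by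
    have h1 := (hasDerivAt_id s).mul ((hw.differentiable one_ne_zero) s).hasDerivAt
    have h2 := intervalIntegral.integral_hasDerivAt_right (hw.continuous.intervalIntegrable 0 s)
      (hw.continuous.stronglyMeasurableAtFilter _ _) hw.continuous.continuousAt
    refine (h1.sub h2).congr_deriv ?_
    simp
  have key : ‖r * w r - ∫ t in (0:ℝ)..r, w t‖ ≤ B r :=
    image_norm_le_of_norm_deriv_right_le_deriv_boundary' (a := 0) (b := r)
      (fun s _ => (hd s).continuousAt.continuousWithinAt)
      (fun s _ => (hd s).hasDerivWithinAt) (by simp [hB0])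
      (fun s hs => (hB s hs.1).continuousAt.continuousWithinAt)
      (fun s hs => (hB s hs.1).hasDerivWithinAt)
      (fun s hs => by
        rw [norm_mul, Real.norm_eq_abs, Real.norm_eq_abs, abs_of_nonneg hs.1]
        exact hb s hs.1)
      (right_mem_Icc.2 hr)
  have heq : w r - radAvg w r = (r * w r - ∫ t in (0:ℝ)..r, w t) / r := by
    rw [radAvg, if_neg hr0.ne']
    field_simp
  rw [heq, abs_div, abs_of_pos hr0]
  gcongr
  exact key

/-- A bound on `w'` gives linear control of `w - w̄`. -/
lemma abs_sub_radAvg_le_linear {w : ℝ → ℝ} (hw : ContDiff ℝ 1 w) {N : ℝ}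
    (hN : ∀ s, 0 ≤ s → |deriv w s| ≤ N) {r : ℝ} (hr : 0 ≤ r) :
    |w r - radAvg w r| ≤ N * r / 2 := by
  refine (abs_sub_radAvg_le_div (B := fun s => N * s ^ 2 / 2) (b := fun s => s * N) hw
    (fun s _ => ?_) (by simp) (fun s hs => mul_le_mul_of_nonneg_left (hN s hs) hs) hr).trans
    (le_of_eq ?_)
  · refine (((hasDerivAt_pow 2 s).const_mul N).div_const 2).congr_deriv ?_
    simp
    ring
  · rcases hr.eq_or_lt with rfl | hr0
    · simp
    · field_simp

/-- Weighted decay of order `p > 2` gives `w - w̄ = O(1/r)`. -/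
lemma abs_sub_radAvg_le_of_two_lt {p : ℝ} (hp : 2 < p) {w : ℝ → ℝ} (hw : ContDiff ℝ 1 w) {N : ℝ}
    (hN0 : 0 ≤ N) (hN : ∀ s : ℝ, 0 ≤ s → (1 + s) ^ p * |deriv w s| ≤ N) {r : ℝ} (hr : 0 ≤ r) :
    |w r - radAvg w r| ≤ N / (p - 2) / r := by
  have hp2 : 0 < p - 2 := by linarith
  refine (abs_sub_radAvg_le_div (B := fun s => N / (p - 2) * (1 - (1 + s) ^ (2 - p)))
    (b := fun s => N * (1 + s) ^ (1 - p)) hw (fun s hs => ?_) (by simp) (fun s hs => ?_) hr).trans ?_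
  · have h := ((hasDerivAt_id s).const_add 1).rpow_const (p := 2 - p)
      (Or.inl (by simp only [id]; positivity))
    refine ((h.const_sub 1).const_mul (N / (p - 2))).congr_deriv ?_
    rw [show 2 - p - 1 = 1 - p by ring]
    simp only [id]
    field_simp
    ring
  · have h1 : 0 < 1 + s := by positivity
    have h2 : (1 + s) ^ (1 - p) * (1 + s) ^ p = 1 + s := by
      rw [← rpow_add h1]
      simp
    calc s * |deriv w s| ≤ (1 + s) * |deriv w s| := by gcongr; linarith
      _ = (1 + s) ^ (1 - p) * ((1 + s) ^ p * |deriv w s|) := by rw [← mul_assoc, h2]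
      _ ≤ (1 + s) ^ (1 - p) * N := by gcongr; exact hN s hs
      _ = N * (1 + s) ^ (1 - p) := mul_comm _ _
  · have : 0 ≤ (1 + r) ^ (2 - p) := by positivity
    gcongr
    exact mul_le_of_le_one_right (by positivity) (by linarith)

/-- Weighted decay of order `2` gives `w - w̄ = O(log r / r)`. -/
lemma abs_sub_radAvg_le_log {w : ℝ → ℝ} (hw : ContDiff ℝ 1 w) {N : ℝ}
    (hN : ∀ s : ℝ, 0 ≤ s → (1 + s) ^ 2 * |deriv w s| ≤ N) {r : ℝ} (hr : 0 ≤ r) :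
    |w r - radAvg w r| ≤ N * Real.log (1 + r) / r := by
  refine abs_sub_radAvg_le_div (B := fun s => N * Real.log (1 + s)) (b := fun s => N * (1 / (1 + s)))
    hw (fun s hs => ?_) (by simp) (fun s hs => ?_) hr
  · exact (((hasDerivAt_id s).const_add 1).log (by simp only [id]; positivity)).const_mul N
  · have h1 : 0 < 1 + s := by positivity
    rw [mul_one_div, le_div_iff₀ h1]
    refine le_trans ?_ (hN s hs)
    nlinarith [mul_nonneg h1.le (abs_nonneg (deriv w s))]

/-- `1 / r` is comparable to `r / (1 + r)²` for `r ≥ 1`. -/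
lemma one_div_le_four_mul_div_sq {r : ℝ} (hr : 1 ≤ r) : 1 / r ≤ 4 * (r / (1 + r) ^ 2) := by
  rw [← mul_div_assoc, div_le_div_iff₀ (by positivity) (by positivity)]
  nlinarith

/-- `r` is comparable to `r / (1 + r)²` for `0 ≤ r ≤ 1`. -/
lemma le_four_mul_div_sq {r : ℝ} (hr : 0 ≤ r) (hr1 : r ≤ 1) : r ≤ 4 * (r / (1 + r) ^ 2) := by
  rw [← mul_div_assoc, le_div_iff₀ (by positivity), mul_comm 4]
  gcongr
  nlinarith

theorem avg_diff_weighted_high (p : ℝ) (hp : 2 < p) :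
    (∃ C > (0:ℝ), ∀ w : ℝ → ℝ, ContDiff ℝ 1 w → ∀ N : ℝ, 0 ≤ N →
      (∀ s : ℝ, 0 ≤ s → (1 + s) ^ p * |deriv w s| ≤ N) →
      ∀ r : ℝ, 0 ≤ r →
        |w r - radAvg w r| ≤ C * (r / (1 + r) ^ 2) * N) ∧
    (∃ C₂ > (0:ℝ), ∀ w : ℝ → ℝ, ContDiff ℝ 1 w → ∀ N : ℝ, 0 ≤ N →
      (∀ s : ℝ, 0 ≤ s → (1 + s) ^ 2 * |deriv w s| ≤ N) →
      ∀ r : ℝ, 0 ≤ r →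
        |w r - radAvg w r| ≤ C₂ * (r * Real.log (2 + r) / (1 + r) ^ 2) * N) := by
  constructor
  · have hp2 : 0 < p - 2 := by linarith
    refine ⟨2 + 4 / (p - 2), by positivity, fun w hw N hN0 hN r hr => ?_⟩
    have hq : 0 ≤ r / (1 + r) ^ 2 := by positivity
    rcases le_total r 1 with h1 | h1
    · have hN' (s : ℝ) (hs : 0 ≤ s) : |deriv w s| ≤ N :=
        (le_mul_of_one_le_left (abs_nonneg _)
          (one_le_rpow (by linarith) (by linarith))).trans (hN s hs)
      calc |w r - radAvg w r| ≤ N * r / 2 := abs_sub_radAvg_le_linear hw hN' hr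
        _ ≤ N * (4 * (r / (1 + r) ^ 2)) / 2 := by gcongr; exact le_four_mul_div_sq hr h1
        _ = 2 * (r / (1 + r) ^ 2) * N := by ring
        _ ≤ (2 + 4 / (p - 2)) * (r / (1 + r) ^ 2) * N := by
          gcongr
          exact le_add_of_nonneg_right (by positivity)
    · calc |w r - radAvg w r| ≤ N / (p - 2) / r := abs_sub_radAvg_le_of_two_lt hp hw hN0 hN hr
        _ = N / (p - 2) * (1 / r) := by ring
        _ ≤ N / (p - 2) * (4 * (r / (1 + r) ^ 2)) := by
          gcongr
          exact one_div_le_four_mul_div_sq h1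
        _ = 4 / (p - 2) * (r / (1 + r) ^ 2) * N := by ring
        _ ≤ (2 + 4 / (p - 2)) * (r / (1 + r) ^ 2) * N := by
          gcongr
          exact le_add_of_nonneg_left zero_le_two
  · refine ⟨4, by norm_num, fun w hw N hN0 hN r hr => ?_⟩
    have hq : 0 ≤ r / (1 + r) ^ 2 := by positivity
    rcases le_total r 1 with h1 | h1
    · have hN' (s : ℝ) (hs : 0 ≤ s) : |deriv w s| ≤ N :=
        (le_mul_of_one_le_left (abs_nonneg _) (one_le_pow₀ (by linarith))).trans (hN s hs)
      have hlog : 1 / 2 ≤ Real.log (2 + r) := by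
        have := Real.log_two_gt_d9
        exact le_trans (by linarith) (Real.log_le_log two_pos (by linarith : 2 ≤ 2 + r))
      calc |w r - radAvg w r| ≤ N * r / 2 := abs_sub_radAvg_le_linear hw hN' hr
        _ = N * r * (1 / 2) := by ring
        _ ≤ N * (4 * (r / (1 + r) ^ 2)) * Real.log (2 + r) := by
          gcongr
          exact le_four_mul_div_sq hr h1
        _ = 4 * (r * Real.log (2 + r) / (1 + r) ^ 2) * N := by ring
    · have hlog : 0 ≤ Real.log (2 + r) := Real.log_nonneg (by linarith)
      calc |w r - radAvg w r| ≤ N * Real.log (1 + r) / r := abs_sub_radAvg_le_log hw hN hr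
        _ ≤ N * Real.log (2 + r) / r := by
          gcongr
          norm_num
        _ = N * Real.log (2 + r) * (1 / r) := by ring
        _ ≤ N * Real.log (2 + r) * (4 * (r / (1 + r) ^ 2)) := by
          gcongr
          exact one_div_le_four_mul_div_sq h1
        _ = 4 * (r * Real.log (2 + r) / (1 + r) ^ 2) * N := by ring
end

section
/- Let 0<δ<1. There exists a constant C_δ>0 such that for every C¹ function h on [0,∞) with ‖h'‖_{L^{∞,2-δ}_r}<∞ and every r≥0, ∫₀ʳ (h(s)-h̄(s))²/s ds ≤ C_δ ‖h'‖²_{L^{∞,2-δ}_r}; consequently the function f(r)=exp((1/2)∫₀ʳ (h(s)-h̄(s))²/s ds) satisfies 1 ≤ f(r) ≤ exp(C_δ ‖h'‖²_{L^{∞,2-δ}_r}) for all r≥0. -/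
open Set MeasureTheory Real

/-- The metric coefficient `f(r) = exp((1/2)∫₀ʳ (h(s)-h̄(s))²/s ds)` built from `h`. -/
noncomputable def metF1 (h : ℝ → ℝ) (r : ℝ) : ℝ :=
  Real.exp (2⁻¹ * ∫ s in (0:ℝ)..r, (h s - radAvg h s) ^ 2 / s)

theorem intervalIntegrable_one_add_rpow (p : ℝ) {r : ℝ} (hr : 0 ≤ r) :
    IntervalIntegrable (fun u : ℝ => (1 + u) ^ p) volume 0 r := by
  refine ContinuousOn.intervalIntegrable_of_Icc hr fun u hu => ?_
  have h : (1 + u) ≠ 0 := by linarith [hu.1]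
  exact (ContinuousAt.rpow_const (by fun_prop) (Or.inl h)).continuousWithinAt

theorem integral_one_add_rpow {a : ℝ} (ha : a ≠ 0) {r : ℝ} (hr : 0 ≤ r) :
    ∫ u in (0:ℝ)..r, (1 + u) ^ (a - 1) = ((1 + r) ^ a - 1) / a := by
  rw [intervalIntegral.integral_comp_add_left (fun x : ℝ => x ^ (a - 1)) 1, integral_rpow]
  · simp
  · refine Or.inr ⟨fun h => ha (by linarith), ?_⟩
    rw [add_zero, uIcc_of_le (by linarith)]
    intro h
    linarith [h.1]

/-- Integration by parts: the deviation from the radial average is a weighted integral of the derivative. -/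
theorem sub_radAvg_eq_s13 {h : ℝ → ℝ} (hh : ContDiff ℝ 1 h) {s : ℝ} (hs : 0 < s) :
    h s - radAvg h s = (∫ u in (0:ℝ)..s, u * deriv h u) / s := by
  have key := intervalIntegral.integral_mul_deriv_eq_deriv_mul (a := 0) (b := s)
    (u := fun u : ℝ => u) (u' := fun _ => 1) (v := h) (v' := deriv h)
    (fun x _ => hasDerivAt_id x)
    (fun x _ => (hh.differentiable one_ne_zero x).hasDerivAt)
    (by simp) ((hh.continuous_deriv le_rfl).intervalIntegrable 0 s)
  rw [key, radAvg, if_neg hs.ne']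
  simp only [one_mul, zero_mul, sub_zero]
  field_simp

section Bounds

variable {δ N : ℝ} {h : ℝ → ℝ}

theorem abs_sub_radAvg_le_mul (hδ₂ : δ < 1) (hh : ContDiff ℝ 1 h)
    (hb : ∀ s : ℝ, 0 ≤ s → (1 + s) ^ (2 - δ) * |deriv h s| ≤ N) {s : ℝ} (hs : 0 < s) :
    |h s - radAvg h s| ≤ N * s := by
  rw [sub_radAvg_eq_s13 hh hs, abs_div, abs_of_pos hs, div_le_iff₀ hs]
  have := intervalIntegral.norm_integral_le_of_norm_le_const (a := 0) (b := s)
    (f := fun u => u * deriv h u) (C := N * s) ?_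
  · simpa [abs_of_pos hs] using this
  intro u hu
  rw [uIoc_of_le hs.le] at hu
  rw [Real.norm_eq_abs, abs_mul, abs_of_pos hu.1, mul_comm N s]
  have h1 : (1:ℝ) ≤ (1 + u) ^ (2 - δ) := Real.one_le_rpow (by linarith [hu.1]) (by linarith)
  have h2 : |deriv h u| ≤ N :=
    (le_mul_of_one_le_left (abs_nonneg _) h1).trans (hb u hu.1.le)
  exact mul_le_mul hu.2 h2 (abs_nonneg _) hs.le

theorem abs_sub_radAvg_le_rpow (hδ₁ : 0 < δ) (hh : ContDiff ℝ 1 h) (hN : 0 ≤ N)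
    (hb : ∀ s : ℝ, 0 ≤ s → (1 + s) ^ (2 - δ) * |deriv h s| ≤ N) {s : ℝ} (hs : 0 < s) :
    |h s - radAvg h s| ≤ N * ((1 + s) ^ δ / δ) / s := by
  rw [sub_radAvg_eq_s13 hh hs, abs_div, abs_of_pos hs]
  gcongr
  have := intervalIntegral.norm_integral_le_of_norm_le (a := 0) (b := s) (μ := volume)
    (f := fun u => u * deriv h u) (g := fun u => N * (1 + u) ^ (δ - 1)) hs.le
    (Filter.Eventually.of_forall fun u hu => ?_)
    ((intervalIntegrable_one_add_rpow (δ - 1) hs.le).const_mul N)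
  · rw [intervalIntegral.integral_const_mul, integral_one_add_rpow hδ₁.ne' hs.le] at this
    refine this.trans ?_
    gcongr
    linarith
  have hu1 : 0 < 1 + u := by linarith [hu.1]
  rw [Real.norm_eq_abs, abs_mul, abs_of_pos hu.1]
  have h1 : (1 + u) ^ (δ - 1) * (1 + u) ^ (2 - δ) = 1 + u := by
    rw [← Real.rpow_add hu1]
    norm_num
  calc u * |deriv h u| ≤ (1 + u) * |deriv h u| := by gcongr; linarith
    _ = (1 + u) ^ (δ - 1) * ((1 + u) ^ (2 - δ) * |deriv h u|) := by rw [← mul_assoc, h1]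
    _ ≤ (1 + u) ^ (δ - 1) * N := by gcongr; exact hb u hu.1.le
    _ = N * (1 + u) ^ (δ - 1) := mul_comm _ _

theorem sub_radAvg_sq_div_le (hδ₁ : 0 < δ) (hδ₂ : δ < 1) (hh : ContDiff ℝ 1 h) (hN : 0 ≤ N)
    (hb : ∀ s : ℝ, 0 ≤ s → (1 + s) ^ (2 - δ) * |deriv h s| ≤ N) {s : ℝ} (hs : 0 < s) :
    (h s - radAvg h s) ^ 2 / s ≤ 8 * N ^ 2 / δ ^ 2 * (1 + s) ^ (2 * δ - 2 - 1) := by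
  have hs1 : 0 < 1 + s := by linarith
  have hpow : (1 + s) ^ (2 * δ - 2 - 1) = ((1 + s) ^ δ) ^ 2 / (1 + s) ^ 3 := by
    rw [← Real.rpow_natCast, ← Real.rpow_mul hs1.le, ← Real.rpow_natCast, ← Real.rpow_sub hs1]
    norm_num
    ring_nf
  rw [hpow, ← sq_abs]
  have hA : 1 ≤ (1 + s) ^ δ := Real.one_le_rpow (by linarith) hδ₁.le
  set A := (1 + s) ^ δ
  rcases le_total s 1 with h1 | h1
  · have hd : 1 ≤ A / δ := by rw [le_div_iff₀ hδ₁]; linarith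
    have h8 : 1 ≤ 8 / (1 + s) ^ 3 := by
      rw [le_div_iff₀ (by positivity), one_mul]
      calc (1 + s) ^ 3 ≤ (1 + 1) ^ 3 := by gcongr
        _ = 8 := by norm_num
    calc |h s - radAvg h s| ^ 2 / s ≤ (N * s) ^ 2 / s := by
          gcongr; exact abs_sub_radAvg_le_mul hδ₂ hh hb hs
      _ = N ^ 2 * s := by field_simp
      _ ≤ N ^ 2 * ((A / δ) ^ 2 * (8 / (1 + s) ^ 3)) := by
          gcongr
          exact h1.trans (one_le_mul_of_one_le_of_one_le (one_le_pow₀ hd) h8)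
      _ = 8 * N ^ 2 / δ ^ 2 * (A ^ 2 / (1 + s) ^ 3) := by field_simp
  · have h8 : 1 / s ^ 3 ≤ 8 / (1 + s) ^ 3 := by
      rw [div_le_div_iff₀ (by positivity) (by positivity), one_mul]
      calc (1 + s) ^ 3 ≤ (2 * s) ^ 3 := by gcongr; linarith
        _ = 8 * s ^ 3 := by ring
    calc |h s - radAvg h s| ^ 2 / s ≤ (N * (A / δ) / s) ^ 2 / s := by
          gcongr; exact abs_sub_radAvg_le_rpow hδ₁ hh hN hb hs
      _ = N ^ 2 * (A / δ) ^ 2 * (1 / s ^ 3) := by field_simp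
      _ ≤ N ^ 2 * (A / δ) ^ 2 * (8 / (1 + s) ^ 3) := by gcongr
      _ = 8 * N ^ 2 / δ ^ 2 * (A ^ 2 / (1 + s) ^ 3) := by field_simp

theorem integral_sub_radAvg_sq_div_le (hδ₁ : 0 < δ) (hδ₂ : δ < 1) (hh : ContDiff ℝ 1 h)
    (hN : 0 ≤ N) (hb : ∀ s : ℝ, 0 ≤ s → (1 + s) ^ (2 - δ) * |deriv h s| ≤ N)
    {r : ℝ} (hr : 0 ≤ r) :
    ∫ s in (0:ℝ)..r, (h s - radAvg h s) ^ 2 / s ≤ 8 / δ ^ 2 / (2 - 2 * δ) * N ^ 2 := by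
  have hd : 0 < 2 - 2 * δ := by linarith
  have := intervalIntegral.norm_integral_le_of_norm_le (a := 0) (b := r) (μ := volume)
    (f := fun s => (h s - radAvg h s) ^ 2 / s)
    (g := fun s => 8 * N ^ 2 / δ ^ 2 * (1 + s) ^ (2 * δ - 2 - 1)) hr
    (Filter.Eventually.of_forall fun s hs => ?_)
    ((intervalIntegrable_one_add_rpow _ hr).const_mul _)
  · rw [intervalIntegral.integral_const_mul,
      integral_one_add_rpow (a := 2 * δ - 2) (by linarith) hr] at this
    calc _ ≤ _ := (le_abs_self _).trans this
      _ = 8 * N ^ 2 / δ ^ 2 * ((1 - (1 + r) ^ (2 * δ - 2)) / (2 - 2 * δ)) := by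
          rw [← neg_div_neg_eq (_ - 1), neg_sub, neg_sub]
      _ ≤ 8 * N ^ 2 / δ ^ 2 * (1 / (2 - 2 * δ)) := by
          gcongr
          linarith [Real.rpow_nonneg (by linarith : 0 ≤ 1 + r) (2 * δ - 2)]
      _ = 8 / δ ^ 2 / (2 - 2 * δ) * N ^ 2 := by ring
  have : 0 ≤ (h s - radAvg h s) ^ 2 / s := div_nonneg (sq_nonneg _) hs.1.le
  rw [Real.norm_of_nonneg this]
  exact sub_radAvg_sq_div_le hδ₁ hδ₂ hh hN hb hs.1

end Bounds

theorem f_bounds (δ : ℝ) (hδ₁ : 0 < δ) (hδ₂ : δ < 1) :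
    ∃ C > (0:ℝ), ∀ h : ℝ → ℝ, ContDiff ℝ 1 h → ∀ N : ℝ, 0 ≤ N →
      (∀ s : ℝ, 0 ≤ s → (1 + s) ^ (2 - δ) * |deriv h s| ≤ N) →
      ∀ r : ℝ, 0 ≤ r →
        (∫ s in (0:ℝ)..r, (h s - radAvg h s) ^ 2 / s) ≤ C * N ^ 2 ∧
        1 ≤ metF1 h r ∧ metF1 h r ≤ Real.exp (C * N ^ 2) := by
  have hd : 0 < 2 - 2 * δ := by linarith
  refine ⟨8 / δ ^ 2 / (2 - 2 * δ), by positivity, fun h hh N hN hb r hr => ?_⟩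
  have hle := integral_sub_radAvg_sq_div_le hδ₁ hδ₂ hh hN hb hr
  have hnonneg : 0 ≤ ∫ s in (0:ℝ)..r, (h s - radAvg h s) ^ 2 / s :=
    intervalIntegral.integral_nonneg hr fun s hs => div_nonneg (sq_nonneg _) hs.1
  refine ⟨hle, Real.one_le_exp (by positivity), Real.exp_le_exp.2 ?_⟩
  linarith
end

section
/- Let 0<δ<1. There exist constants x>0 and C_δ>0 such that for every C¹ function h on [0,∞) with ‖h'‖_{L^{∞,2-δ}_r} < x, the function f(r)=exp((1/2)∫₀ʳ (h(s)-h̄(s))²/s ds) satisfies, for all r>0, 0 ≤ f'(r) = (1/2) f(r) (h(r)-h̄(r))²/r ≤ C_δ · (r/(1+r)^{4-2δ}) · ‖h'‖²_{L^{∞,2-δ}_r}. -/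
open Set MeasureTheory Real

/-- A `C¹` function with `(1+s)^{2-δ}|h'(s)| ≤ N` satisfies `|h - h̄| ≤ (N/δ) r (1+r)^{δ-2}`. -/
theorem abs_sub_radAvg_le {δ : ℝ} (hδ₁ : 0 < δ) (hδ₂ : δ ≤ 2) {h : ℝ → ℝ} (hh : ContDiff ℝ 1 h)
    {N : ℝ} (hN : 0 ≤ N) (hb : ∀ s : ℝ, 0 ≤ s → (1 + s) ^ (2 - δ) * |deriv h s| ≤ N)
    {r : ℝ} (hr : 0 < r) :
    |h r - radAvg h r| ≤ N / δ * r * (1 + r) ^ (δ - 2) := by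
  have hd : ∀ s, HasDerivAt (fun r => r * h r - ∫ s in (0:ℝ)..r, h s) (s * deriv h s) s := by
    intro s
    have h1 := (hasDerivAt_id' s).mul ((hh.differentiable one_ne_zero s).hasDerivAt)
    have h2 := intervalIntegral.integral_hasDerivAt_right (a := 0)
      (hh.continuous.intervalIntegrable 0 s)
      (hh.continuous.stronglyMeasurableAtFilter _ _) hh.continuous.continuousAt
    exact (h1.sub h2).congr_deriv (by simp)
  have hB : ∀ s, 0 ≤ s → HasDerivAt (fun s : ℝ => N / δ * (s ^ 2 * (1 + s) ^ (δ - 2)))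
      (N / δ * (s * (1 + s) ^ (δ - 3) * (2 + δ * s))) s := by
    intro s hs
    have h1 : HasDerivAt (fun s : ℝ => 1 + s) 1 s := (hasDerivAt_id' s).const_add 1
    have h2 := h1.rpow_const (p := δ - 2) (Or.inl (by positivity))
    have h3 := ((hasDerivAt_pow 2 s).mul h2).const_mul (N / δ)
    refine h3.congr_deriv ?_
    have e : (1 + s) ^ (δ - 2) = (1 + s) ^ (δ - 3) * (1 + s) := by
      rw [← rpow_add_one (by positivity)]; ring_nf
    rw [e, show δ - 2 - 1 = δ - 3 by ring]
    push_cast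
    ring
  have key := image_norm_le_of_norm_deriv_right_le_deriv_boundary' (a := 0) (b := r)
    (fun s _ => (hd s).continuousAt.continuousWithinAt)
    (fun s _ => (hd s).hasDerivWithinAt) (by simp)
    (fun s hs => (hB s hs.1).continuousAt.continuousWithinAt)
    (fun s hs => (hB s hs.1).hasDerivWithinAt) (fun s hs => by
      have hs0 := hs.1
      have hp : 0 < (1 + s) ^ (δ - 3) := by positivity
      have e : (1 + s) ^ (2 - δ) * ((1 + s) ^ (δ - 3) * (1 + s)) = 1 := by
        rw [← rpow_add_one (by positivity), ← rpow_add (by positivity)]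
        ring_nf
        simp
      have h1 : |deriv h s| ≤ N * ((1 + s) ^ (δ - 3) * (1 + s)) := by
        calc |deriv h s| = (1 + s) ^ (2 - δ) * |deriv h s| * ((1 + s) ^ (δ - 3) * (1 + s)) := by
              linear_combination -|deriv h s| * e
          _ ≤ _ := by gcongr; exact hb s hs0
      rw [norm_mul, norm_eq_abs, norm_eq_abs, abs_of_nonneg hs0]
      calc s * |deriv h s| ≤ s * (N * ((1 + s) ^ (δ - 3) * (1 + s))) := by gcongr
        _ = N / δ * (s * (1 + s) ^ (δ - 3) * (δ + δ * s)) := by field_simp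
        _ ≤ _ := by gcongr)
    (right_mem_Icc.2 hr.le)
  have e : h r - radAvg h r = (r * h r - ∫ s in (0:ℝ)..r, h s) / r := by
    rw [radAvg, if_neg hr.ne']
    field_simp
  rw [e, abs_div, abs_of_pos hr, div_le_iff₀ hr]
  calc _ ≤ _ := key
    _ = _ := by ring

theorem continuousOn_radAvg {h : ℝ → ℝ} (hh : Continuous h) :
    ContinuousOn (radAvg h) (Ioi 0) := by
  have : ContinuousOn (fun r => (∫ s in (0:ℝ)..r, h s) / r) (Ioi 0) :=
    (intervalIntegral.continuous_primitive (fun a b => hh.intervalIntegrable a b) 0).continuousOn.div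
      continuousOn_id fun r hr => (mem_Ioi.1 hr).ne'
  exact this.congr fun r hr => by rw [radAvg, if_neg (mem_Ioi.1 hr).ne']

theorem sq_sub_radAvg_div_le {δ : ℝ} (hδ₁ : 0 < δ) (hδ₂ : δ ≤ 2) {h : ℝ → ℝ} (hh : ContDiff ℝ 1 h)
    {N : ℝ} (hN : 0 ≤ N) (hb : ∀ s : ℝ, 0 ≤ s → (1 + s) ^ (2 - δ) * |deriv h s| ≤ N)
    {r : ℝ} (hr : 0 < r) :
    (h r - radAvg h r) ^ 2 / r ≤ (N / δ) ^ 2 * (r / (1 + r) ^ (4 - 2 * δ)) := by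
  have h1 := abs_sub_radAvg_le hδ₁ hδ₂ hh hN hb hr
  have e : ((1 + r) ^ (δ - 2)) ^ 2 = ((1 + r) ^ (4 - 2 * δ))⁻¹ := by
    rw [← rpow_mul_natCast (by positivity), ← rpow_neg (by positivity)]
    push_cast
    ring_nf
  rw [div_le_iff₀ hr, ← sq_abs]
  calc _ ≤ (N / δ * r * (1 + r) ^ (δ - 2)) ^ 2 := by gcongr
    _ = (N / δ) ^ 2 * r ^ 2 * ((1 + r) ^ (δ - 2)) ^ 2 := by ring
    _ = _ := by rw [e]; ring

theorem integral_one_add_rpow_le {δ : ℝ} (hδ₂ : δ < 1) {r : ℝ} (hr : 0 ≤ r) :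
    ∫ s in (0:ℝ)..r, (1 + s) ^ (2 * δ - 3) ≤ (2 - 2 * δ)⁻¹ := by
  have hδ : 0 < 2 - 2 * δ := by linarith
  have h1 : ∀ s ∈ uIcc 0 r, HasDerivAt (fun s : ℝ => -(2 - 2 * δ)⁻¹ * (1 + s) ^ (2 * δ - 2))
      ((1 + s) ^ (2 * δ - 3)) s := by
    intro s hs
    rw [uIcc_of_le hr] at hs
    have hs0 := hs.1
    have h1 : HasDerivAt (fun s : ℝ => 1 + s) 1 s := (hasDerivAt_id' s).const_add 1
    have h2 := (h1.rpow_const (p := 2 * δ - 2) (Or.inl (by positivity))).const_mul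
      (-(2 - 2 * δ)⁻¹)
    refine h2.congr_deriv ?_
    rw [show 2 * δ - 2 - 1 = 2 * δ - 3 by ring]
    linear_combination (1 + s) ^ (2 * δ - 3) * inv_mul_cancel₀ hδ.ne'
  rw [intervalIntegral.integral_eq_sub_of_hasDerivAt h1]
  · have : 0 ≤ (2 - 2 * δ)⁻¹ * (1 + r) ^ (2 * δ - 2) := by positivity
    simp only [add_zero, one_rpow]
    linarith
  · refine ContinuousOn.intervalIntegrable fun s hs => ?_
    rw [uIcc_of_le hr] at hs
    have hs0 := hs.1
    exact ((continuousAt_const.add continuousAt_id).rpow_const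
      (Or.inl (by change 1 + s ≠ 0; positivity))).continuousWithinAt

theorem f_deriv_bounds (δ : ℝ) (hδ₁ : 0 < δ) (hδ₂ : δ < 1) :
    ∃ x > (0:ℝ), ∃ C > (0:ℝ), ∀ h : ℝ → ℝ, ContDiff ℝ 1 h →
      ∀ N : ℝ, 0 ≤ N → N < x →
      (∀ s : ℝ, 0 ≤ s → (1 + s) ^ (2 - δ) * |deriv h s| ≤ N) →
      ∀ r : ℝ, 0 < r →
        0 ≤ deriv (metF1 h) r ∧
        deriv (metF1 h) r = 2⁻¹ * metF1 h r * (h r - radAvg h r) ^ 2 / r ∧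
        deriv (metF1 h) r ≤ C * (r / (1 + r) ^ (4 - 2 * δ)) * N ^ 2 := by
  set M : ℝ := Real.exp (2⁻¹ * ((1 / δ) ^ 2 * (2 - 2 * δ)⁻¹)) with hM
  refine ⟨1, one_pos, 2⁻¹ * M * (1 / δ) ^ 2, by positivity, ?_⟩
  intro h hh N hN hN1 hb r hr
  have hq : ContinuousOn (fun s => (h s - radAvg h s) ^ 2 / s) (Ioi 0) :=
    ((hh.continuous.continuousOn.sub (continuousOn_radAvg hh.continuous)).pow 2).div
      continuousOn_id fun r hr => (mem_Ioi.1 hr).ne'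
  have hle : ∀ s, 0 < s → (h s - radAvg h s) ^ 2 / s ≤ (1 / δ) ^ 2 * (1 + s) ^ (2 * δ - 3) := by
    intro s hs
    have e : (1 + s) ^ (2 * δ - 3) = (1 + s) / (1 + s) ^ (4 - 2 * δ) := by
      rw [← rpow_one_sub' (by positivity) (by linarith)]; ring_nf
    rw [e]
    refine (sq_sub_radAvg_div_le hδ₁ (by linarith) hh hN hb hs).trans ?_
    gcongr
    linarith
  have hg : IntervalIntegrable (fun s : ℝ => (1 / δ) ^ 2 * (1 + s) ^ (2 * δ - 3)) volume 0 r := by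
    refine ContinuousOn.intervalIntegrable fun s hs => ?_
    rw [uIcc_of_le hr.le] at hs
    have hs0 := hs.1
    exact (continuousAt_const.mul ((continuousAt_const.add continuousAt_id).rpow_const
      (Or.inl (by change 1 + s ≠ 0; positivity)))).continuousWithinAt
  have hi : IntervalIntegrable (fun s => (h s - radAvg h s) ^ 2 / s) volume 0 r := by
    refine hg.mono_fun' ?_ ?_
    · rw [uIoc_of_le hr.le]
      exact (hq.mono Ioc_subset_Ioi_self).aestronglyMeasurable measurableSet_Ioc
    · rw [uIoc_of_le hr.le]
      refine (ae_restrict_iff' measurableSet_Ioc).2 (.of_forall fun s hs => ?_)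
      have hs0 := hs.1
      exact (norm_of_nonneg (by positivity)).trans_le (hle s hs0)
  have hf : metF1 h r ≤ M := by
    rw [metF1, hM]
    gcongr
    calc _ ≤ ∫ s in (0:ℝ)..r, (1 / δ) ^ 2 * (1 + s) ^ (2 * δ - 3) :=
          intervalIntegral.integral_mono_on_of_le_Ioo hr.le hi hg fun s hs => hle s hs.1
      _ ≤ _ := by
          rw [intervalIntegral.integral_const_mul]
          gcongr
          exact integral_one_add_rpow_le hδ₂ hr.le
  have hf0 : 0 < metF1 h r := Real.exp_pos _
  have hd : deriv (metF1 h) r = 2⁻¹ * metF1 h r * (h r - radAvg h r) ^ 2 / r := by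
    have h1 := ((intervalIntegral.integral_hasDerivAt_right hi
      (hq.stronglyMeasurableAtFilter isOpen_Ioi r hr)
      (hq.continuousAt (Ioi_mem_nhds hr))).const_mul 2⁻¹).exp
    refine h1.deriv.trans ?_
    rw [metF1]
    ring
  refine ⟨by rw [hd]; positivity, hd, ?_⟩
  rw [hd, mul_div_assoc]
  calc _ ≤ 2⁻¹ * M * ((N / δ) ^ 2 * (r / (1 + r) ^ (4 - 2 * δ))) := by
        gcongr
        exact sq_sub_radAvg_div_le hδ₁ (by linarith) hh hN hb hr
    _ = _ := by ring
end
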